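/- arXiv:2510.26590 — 2 statements merged into one kernel-verified Lean document; each statement's English description precedes it below -/
import Mathlib

section
/- Let d ≥ 1 and let f : ℝ^d → ℝ be a smooth compactly supported function with ∫_{ℝ^d} f dvol = 0 and ‖f‖_∞ + ‖f‖_{L¹} ≤ 1. Then there exist finitely many smooth compactly supported functions f_1, …, f_m : ℝ^d → ℝ, each satisfying ∫_{ℝ^d} f_i dvol = 0, such that f = f_1 + ⋯ + f_m and ∑_{i=1}^m ‖f_i‖_∞ · (vol(supp f_i) + 1) ≤ 100. -/
open MeasureTheory

/-- A smooth bump function supported in `[0, 3/2]` whose translates by natural numbers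
telescope to a partition of unity. -/
noncomputable def slabBump (t : ℝ) : ℝ :=
  Real.smoothTransition (2 * t) - Real.smoothTransition (2 * (t - 1))

lemma contDiff_slabBump : ContDiff ℝ (⊤ : ℕ∞) slabBump := by
  unfold slabBump
  exact (Real.smoothTransition.contDiff.comp (by fun_prop)).sub
    (Real.smoothTransition.contDiff.comp (by fun_prop))

lemma slabBump_nonneg (t : ℝ) : 0 ≤ slabBump t :=
  sub_nonneg.2 (Real.smoothTransition.monotone (by linarith))

lemma mem_Icc_of_slabBump_ne_zero {t : ℝ} (h : slabBump t ≠ 0) :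
    t ∈ Set.Icc (0 : ℝ) (3 / 2) := by
  contrapose! h
  rw [Set.mem_Icc, not_and_or, not_le, not_le] at h
  unfold slabBump
  rcases h with h | h
  · rw [Real.smoothTransition.zero_of_nonpos (by linarith),
      Real.smoothTransition.zero_of_nonpos (by linarith), sub_zero]
  · rw [Real.smoothTransition.one_of_one_le (by linarith),
      Real.smoothTransition.one_of_one_le (by linarith), sub_self]

lemma sum_slabBump {n : ℕ} {t : ℝ} (h : 1 ≤ t) (hn : t ≤ n) :
    ∑ j : Fin n, slabBump (t - (j : ℕ)) = 1 := by
  rw [Fin.sum_univ_eq_sum_range (fun j : ℕ => slabBump (t - j)) n]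
  have key := Finset.sum_range_sub' (fun j : ℕ => Real.smoothTransition (2 * (t - j))) n
  rw [Real.smoothTransition.zero_of_nonpos (x := 2 * (t - n)) (by linarith),
    Real.smoothTransition.one_of_one_le (x := 2 * (t - (0 : ℕ))) (by norm_num; linarith),
    sub_zero] at key
  rw [← key]
  refine Finset.sum_congr rfl fun j _ => ?_
  rw [slabBump, Nat.cast_add, Nat.cast_one, sub_sub]

lemma card_slabs_le_two (n : ℕ) (t : ℝ) :
    (Finset.univ.filter fun j : Fin n => t - (j : ℕ) ∈ Set.Icc (0 : ℝ) (3 / 2)).card ≤ 2 := by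
  classical
  rw [← Finset.card_image_of_injective _ Fin.val_injective]
  refine (Finset.card_le_card (t := {⌊t⌋₊, ⌊t⌋₊ - 1}) ?_).trans Finset.card_le_two
  intro j hj
  simp only [Finset.mem_image, Finset.mem_filter, Finset.mem_univ, true_and, Set.mem_Icc] at hj
  obtain ⟨i, ⟨h1, h2⟩, rfl⟩ := hj
  have hle : (i : ℕ) ≤ ⌊t⌋₊ := Nat.le_floor (by linarith)
  have hlt : ⌊t⌋₊ < (i : ℕ) + 2 := by
    rw [Nat.floor_lt (by linarith [(Nat.cast_nonneg (i : ℕ) : (0 : ℝ) ≤ (i : ℕ))])]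
    push_cast
    linarith
  simp only [Finset.mem_insert, Finset.mem_singleton]
  omega

/-- A smooth partition of unity, over a compact set, subordinate to the preimages under `h` of
intervals of length `ε`, at most two of which meet at any point. -/
lemma exists_slab_partition {E : Type*} [NormedAddCommGroup E] [NormedSpace ℝ E]
    {h : E → ℝ} (hh : ContDiff ℝ (⊤ : ℕ∞) h) {S : Set E} (hS : IsCompact S)
    {ε : ℝ} (hε : 0 < ε) :
    ∃ (n : ℕ) (ρ : Fin n → E → ℝ) (c : Fin n → ℝ),
      (∀ i, ContDiff ℝ (⊤ : ℕ∞) (ρ i)) ∧ (∀ i x, 0 ≤ ρ i x) ∧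
      (∀ x ∈ S, ∑ i, ρ i x = 1) ∧
      (∀ i x, ρ i x ≠ 0 → h x ∈ Set.Icc (c i) (c i + ε)) ∧
      ∀ x, ∑ i, Set.indicator (h ⁻¹' Set.Icc (c i) (c i + ε)) (fun _ => (1 : ℝ)) x ≤ 2 := by
  obtain ⟨R, hR⟩ := hS.exists_bound_of_continuousOn hh.continuous.continuousOn
  obtain ⟨q, hq, rfl⟩ : ∃ q : ℝ, 0 < q ∧ ε = 3 / 2 * q := ⟨2 / 3 * ε, by linarith, by ring⟩
  obtain ⟨n, hn⟩ := exists_nat_ge ((R + R) / q + 1)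
  have mem_iff : ∀ (i : ℕ) x, (h x + R) / q + 1 - i ∈ Set.Icc (0 : ℝ) (3 / 2) ↔
      h x ∈ Set.Icc ((i - 1) * q - R) ((i - 1) * q - R + 3 / 2 * q) := by
    intro i x
    have h1 : 0 ≤ (h x + R) / q + 1 - i ↔ (i - 1) ≤ (h x + R) / q := by
      constructor <;> intro <;> linarith
    have h2 : (h x + R) / q + 1 - i ≤ 3 / 2 ↔ (h x + R) / q ≤ i + 1 / 2 := by
      constructor <;> intro <;> linarith
    rw [Set.mem_Icc, Set.mem_Icc, h1, h2, le_div_iff₀ hq, div_le_iff₀ hq]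
    constructor <;> rintro ⟨_, _⟩ <;> constructor <;> linarith
  refine ⟨n, fun i x => slabBump ((h x + R) / q + 1 - (i : ℕ)), fun i => ((i : ℕ) - 1) * q - R,
    fun i => ?_, fun i x => slabBump_nonneg _, fun x hx => ?_, fun i x hne => ?_, fun x => ?_⟩
  · exact contDiff_slabBump.comp
      ((((hh.add contDiff_const).div_const q).add contDiff_const).sub contDiff_const)
  · have hb := abs_le.1 (hR x hx)
    refine sum_slabBump ?_ (le_trans ?_ hn)
    · have : 0 ≤ (h x + R) / q := div_nonneg (by linarith) hq.le
      linarith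
    · gcongr
      exact hb.2
  · exact (mem_iff i x).1 (mem_Icc_of_slabBump_ne_zero hne)
  · classical
    have hc := card_slabs_le_two n ((h x + R) / q + 1)
    simp only [mem_iff] at hc
    simp only [Set.indicator_apply, Set.mem_preimage, Finset.sum_boole]
    exact_mod_cast hc

/-- Greedy bin packing: items of weight at most `1/2` can be put in bins of total weight at most
`1`, so that the sum over the bins of an upper bound for the sizes of their items is controlled by
the weighted sum of the sizes. -/
lemma exists_bin_packing {ι : Type*} [DecidableEq ι] (J : Finset ι) (v s : ι → ℝ) {M : ℝ}
    (hM : 0 ≤ M) (hv : ∀ i, 0 ≤ v i) (hv' : ∀ i, v i ≤ 1 / 2) (hs : ∀ i, 0 ≤ s i)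
    (hs' : ∀ i, s i ≤ M) :
    ∃ (n : ℕ) (c : ι → ℕ) (B : ℕ → ℝ), (∀ k, 0 ≤ B k) ∧ (∀ i ∈ J, c i ≤ n ∧ s i ≤ B (c i)) ∧
      (∀ k, ∑ i ∈ J with c i = k, v i ≤ 1) ∧
      ∑ k ∈ Finset.range (n + 1), B k ≤ M + 2 * ∑ i ∈ J, v i * s i := by
  suffices H : ∃ (n : ℕ) (c : ι → ℕ) (B : ℕ → ℝ), (∀ k, 0 ≤ B k) ∧
      (∀ i ∈ J, c i ≤ n ∧ s i ≤ B (c i)) ∧ (∀ k, ∑ i ∈ J with c i = k, v i ≤ 1) ∧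
      (∑ k ∈ Finset.range (n + 1), B k ≤ M + 2 * ∑ i ∈ J with c i < n, v i * s i) ∧
      ∀ t ≤ M, (∀ i ∈ J, t ≤ s i) → t ≤ B n by
    obtain ⟨n, c, B, hB, hc, hbin, hsum, -⟩ := H
    refine ⟨n, c, B, hB, hc, hbin, hsum.trans ?_⟩
    gcongr
    · exact fun i _ _ => mul_nonneg (hv i) (hs i)
    · exact Finset.filter_subset _ _
  induction J using Finset.induction_on_min_value s with
  | empty => exact ⟨0, fun _ => 0, fun _ => M, by simp [hM]⟩
  | insert a J ha hmin ih =>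
    obtain ⟨n, c, B, hB, hc, hbin, hsum, hlast⟩ := ih
    have update_eq : ∀ m, ∀ i ∈ J, Function.update c a m i = c i := fun m i hi =>
      Function.update_of_ne (ne_of_mem_of_not_mem hi ha) _ _
    have filter_eq : ∀ m (p : ℕ → Prop) [DecidablePred p],
        J.filter (fun i => p (Function.update c a m i)) = J.filter (fun i => p (c i)) :=
      fun m p _ => Finset.filter_congr fun i hi => by rw [update_eq m i hi]
    by_cases hw : ∑ i ∈ J with c i = n, v i ≤ 1 / 2
    · refine ⟨n, Function.update c a n, B, hB, ?_, fun k => ?_, ?_, fun t htM ht => ?_⟩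
      · intro i hi
        rcases Finset.mem_insert.1 hi with rfl | hi
        · simpa using hlast _ (hs' _) hmin
        · rw [update_eq n i hi]
          exact hc i hi
      · rw [Finset.filter_insert, filter_eq n (· = k), Function.update_self]
        split_ifs with h
        · subst h
          rw [Finset.sum_insert (by simp [ha])]
          linarith [hv' a]
        · exact hbin k
      · rw [Finset.filter_insert, filter_eq n (· < n), Function.update_self,
          if_neg (lt_irrefl n)]
        exact hsum
      · exact hlast t htM fun i hi => ht i (Finset.mem_insert_of_mem hi)
    · refine ⟨n + 1, Function.update c a (n + 1), Function.update B (n + 1) (s a), fun k => ?_, ?_,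
        fun k => ?_, ?_, fun t htM ht => ?_⟩
      · rcases eq_or_ne k (n + 1) with rfl | h
        · simpa using hs a
        · simpa [h] using hB k
      · intro i hi
        rcases Finset.mem_insert.1 hi with rfl | hi
        · simp
        · rw [update_eq (n + 1) i hi, Function.update_of_ne (by have := (hc i hi).1; omega)]
          exact ⟨(hc i hi).1.trans n.le_succ, (hc i hi).2⟩
      · rw [Finset.filter_insert, filter_eq (n + 1) (· = k), Function.update_self]
        split_ifs with h
        · subst h
          have : J.filter (fun i => c i = n + 1) = ∅ :=
            Finset.filter_eq_empty_iff.2 fun i hi => by have := (hc i hi).1; omega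
          rw [this]
          simp only [insert_empty_eq, Finset.sum_singleton]
          linarith [hv' a]
        · exact hbin k
      · rw [Finset.filter_insert, filter_eq (n + 1) (· < n + 1), Function.update_self,
          if_neg (lt_irrefl _), Finset.sum_range_succ, Function.update_self]
        have hold : ∑ k ∈ Finset.range (n + 1), Function.update B (n + 1) (s a) k
            = ∑ k ∈ Finset.range (n + 1), B k :=
          Finset.sum_congr rfl fun k hk =>
            Function.update_of_ne (Finset.mem_range.1 hk).ne _ _
        have hsplit : ∑ i ∈ J with c i < n + 1, v i * s i
            = ∑ i ∈ J with c i < n, v i * s i + ∑ i ∈ J with c i = n, v i * s i := by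
          rw [← Finset.sum_union (Finset.disjoint_filter.2 fun i _ h h' => h.ne h'),
            ← Finset.filter_or]
          simp only [Nat.lt_succ_iff_lt_or_eq]
        have hbig : (∑ i ∈ J with c i = n, v i) * s a ≤ ∑ i ∈ J with c i = n, v i * s i := by
          rw [Finset.sum_mul]
          exact Finset.sum_le_sum fun i hi =>
            mul_le_mul_of_nonneg_left (hmin i (Finset.mem_filter.1 hi).1) (hv i)
        rw [hold, hsplit]
        nlinarith [mul_le_mul_of_nonneg_right (not_le.1 hw).le (hs a)]
      · simpa using ht a (Finset.mem_insert_self a J)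

open Metric in
/-- A normalised bump function of height at most `1` on a set of volume at most `2`. -/
lemma exists_normalized_bump (E : Type*) [NormedAddCommGroup E] [InnerProductSpace ℝ E]
    [FiniteDimensional ℝ E] [MeasurableSpace E] [BorelSpace E] [Nontrivial E]
    (μ : Measure E) [μ.IsAddHaarMeasure] :
    ∃ χ : E → ℝ, ContDiff ℝ (⊤ : ℕ∞) χ ∧ HasCompactSupport χ ∧ (∫ x, χ x ∂μ) = 1 ∧
      (∀ x, |χ x| ≤ 1) ∧ μ.real (tsupport χ) ≤ 2 := by
  have hD : Module.finrank ℝ E ≠ 0 := Module.finrank_pos.ne'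
  have hb : 0 < μ.real (closedBall (0 : E) 1) :=
    ENNReal.toReal_pos (measure_closedBall_pos _ _ one_pos).ne' measure_closedBall_lt_top.ne
  have hball : ∀ t : ℝ, 0 ≤ t → μ.real (closedBall (0 : E)
      ((t / μ.real (closedBall (0 : E) 1)) ^ ((Module.finrank ℝ E : ℝ)⁻¹))) = t := by
    intro t ht
    have ht' := div_nonneg ht hb.le
    rw [measureReal_def, Measure.addHaar_closedBall' _ _ (Real.rpow_nonneg ht' _),
      ENNReal.toReal_mul, Real.rpow_inv_natCast_pow ht' hD, ENNReal.toReal_ofReal ht',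
      ← measureReal_def, div_mul_cancel₀ _ hb.ne']
  let φ : ContDiffBump (0 : E) :=
    ⟨(1 / μ.real (closedBall (0 : E) 1)) ^ ((Module.finrank ℝ E : ℝ)⁻¹),
      (2 / μ.real (closedBall (0 : E) 1)) ^ ((Module.finrank ℝ E : ℝ)⁻¹), by positivity,
      Real.rpow_lt_rpow (by positivity) (by gcongr; norm_num) (by positivity)⟩
  refine ⟨φ.normed μ, φ.contDiff_normed, φ.hasCompactSupport_normed, φ.integral_normed,
    fun x => ?_, ?_⟩
  · rw [abs_of_nonneg (φ.nonneg_normed x)]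
    refine (φ.normed_le_div_measure_closedBall_rIn μ x).trans ?_
    rw [hball 1 zero_le_one, div_one]
  · rw [φ.tsupport_normed_eq]
    exact (hball 2 zero_le_two).le

/-- Subtracting its mean times a normalised bump from a function whose support has volume at most
`1` increases its cost by a bounded factor. -/
lemma cost_sub_mean_le {E : Type*} [TopologicalSpace E] [MeasurableSpace E] [OpensMeasurableSpace E]
    {μ : Measure E} [IsFiniteMeasureOnCompacts μ] {g χ : E → ℝ} {M : ℝ}
    (hgs : HasCompactSupport g) (hgM : ∀ x, |g x| ≤ M) (hM : 0 ≤ M)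
    (hg1 : μ.real (tsupport g) ≤ 1) (hχs : HasCompactSupport χ) (hχ1 : ∀ x, |χ x| ≤ 1)
    (hχ2 : μ.real (tsupport χ) ≤ 2) :
    (⨆ x, |g x - (∫ y, g y ∂μ) * χ x|) *
      (μ.real (tsupport fun x => g x - (∫ y, g y ∂μ) * χ x) + 1) ≤ 8 * M := by
  have hint : |∫ y, g y ∂μ| ≤ M := by
    rw [← setIntegral_eq_integral_of_forall_compl_eq_zero (s := tsupport g)
      fun x hx => image_eq_zero_of_notMem_tsupport hx, ← Real.norm_eq_abs]
    refine (norm_setIntegral_le_of_norm_le_const hgs.isCompact.measure_lt_top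
      fun x _ => hgM x).trans ?_
    exact mul_le_of_le_one_right hM hg1
  have hsup : (⨆ x, |g x - (∫ y, g y ∂μ) * χ x|) ≤ 2 * M := by
    refine Real.iSup_le (fun x => ?_) (by linarith)
    refine (abs_sub _ _).trans ?_
    rw [abs_mul]
    nlinarith [hgM x, hχ1 x, abs_nonneg (χ x), abs_nonneg (∫ y, g y ∂μ)]
  have hsupp : μ.real (tsupport fun x => g x - (∫ y, g y ∂μ) * χ x) ≤ 3 := by
    have hsub : (tsupport fun x => g x - (∫ y, g y ∂μ) * χ x) ⊆ tsupport g ∪ tsupport χ := by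
      refine (tsupport_sub g _).trans (Set.union_subset_union_right _ ?_)
      exact tsupport_mul_subset_right
    have hfin : μ (tsupport g ∪ tsupport χ) ≠ ⊤ :=
      (hgs.isCompact.union hχs.isCompact).measure_lt_top.ne
    linarith [measureReal_mono hsub hfin, measureReal_union_le (μ := μ) (tsupport g) (tsupport χ)]
  calc _ ≤ 2 * M * (3 + 1) := by gcongr
    _ = 8 * M := by ring

/-- Slices of a compact set orthogonal to a coordinate axis have small volume if they are thin. -/
lemma exists_thin_slab_volume_le {d : ℕ} (i₀ : Fin d) {S : Set (EuclideanSpace ℝ (Fin d))}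
    (hS : IsCompact S) {δ : ℝ} (hδ : 0 < δ) :
    ∃ ε > 0, ∀ c : ℝ,
      volume.real (S ∩ (fun x : EuclideanSpace ℝ (Fin d) => x i₀) ⁻¹' Set.Icc c (c + ε)) ≤ δ := by
  obtain ⟨R, hR0, hR⟩ := hS.isBounded.exists_pos_norm_le
  refine ⟨δ / (2 * R) ^ (d - 1), by positivity, fun c => ?_⟩
  set ε := δ / (2 * R) ^ (d - 1)
  have hε : 0 < ε := by positivity
  let B : Set (Fin d → ℝ) := Set.Icc (Function.update (fun _ => -R) i₀ c)
    (Function.update (fun _ => R) i₀ (c + ε))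
  have hB : volume B = ENNReal.ofReal δ := by
    rw [Real.volume_Icc_pi, ← Finset.mul_prod_erase _ _ (Finset.mem_univ i₀),
      Finset.prod_congr rfl (g := fun _ => ENNReal.ofReal (2 * R)) fun i hi => by
        rw [Function.update_of_ne (Finset.ne_of_mem_erase hi),
          Function.update_of_ne (Finset.ne_of_mem_erase hi)]
        ring_nf]
    rw [Finset.prod_const, Finset.card_erase_of_mem (Finset.mem_univ _), Finset.card_univ,
      Fintype.card_fin, Function.update_self, Function.update_self, add_sub_cancel_left,
      ← ENNReal.ofReal_pow (by positivity), ← ENNReal.ofReal_mul hε.le,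
      div_mul_cancel₀ _ (by positivity)]
  have hsub : S ∩ (fun x : EuclideanSpace ℝ (Fin d) => x i₀) ⁻¹' Set.Icc c (c + ε) ⊆
      WithLp.ofLp ⁻¹' B := by
    rintro x ⟨hxS, hx⟩
    have hle : ∀ i, |x i| ≤ R := fun i => (PiLp.norm_apply_le x i).trans (hR x hxS)
    refine ⟨fun i => ?_, fun i => ?_⟩ <;> rcases eq_or_ne i i₀ with rfl | hi
    · simpa using hx.1
    · simpa [hi] using (abs_le.1 (hle i)).1
    · simpa using hx.2
    · simpa [hi] using (abs_le.1 (hle i)).2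
  refine ENNReal.toReal_le_of_le_ofReal hδ.le ((measure_mono hsub).trans ?_)
  rw [(PiLp.volume_preserving_ofLp (Fin d)).measure_preimage measurableSet_Icc.nullMeasurableSet, hB]

/-- A compactly supported smooth function `f` is a finite sum of products `f * ρ i` living on
compact sets of volume at most `1/2`, at most four of which meet at any point, and on which `|f|` is
almost constant. -/
lemma exists_fine_partition {d : ℕ} (i₀ : Fin d) {f : EuclideanSpace ℝ (Fin d) → ℝ}
    (hf : ContDiff ℝ (⊤ : ℕ∞) f) (hfs : HasCompactSupport f) (hf1 : ∀ x, |f x| ≤ 1)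
    {η : ℝ} (hη : 0 < η) :
    ∃ (ι : Type) (_ : Fintype ι) (ρ : ι → EuclideanSpace ℝ (Fin d) → ℝ)
      (K : ι → Set (EuclideanSpace ℝ (Fin d))) (s : ι → ℝ),
      (∀ i, ContDiff ℝ (⊤ : ℕ∞) (ρ i)) ∧ (∀ i x, 0 ≤ ρ i x) ∧
      (∀ x ∈ tsupport f, ∑ i, ρ i x = 1) ∧ (∀ i, IsCompact (K i)) ∧
      (∀ i, K i ⊆ tsupport f) ∧ (∀ i x, f x * ρ i x ≠ 0 → x ∈ K i) ∧
      (∀ i, volume.real (K i) ≤ 1 / 2) ∧ (∀ i, 0 ≤ s i ∧ s i ≤ 1) ∧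
      (∀ i, ∀ x ∈ K i, |f x| ≤ s i ∧ s i ≤ |f x| + η) ∧
      ∀ x, ∑ i, (K i).indicator (fun _ => (1 : ℝ)) x ≤ 4 := by
  obtain ⟨ε, hε, hvol⟩ := exists_thin_slab_volume_le i₀ hfs.isCompact (δ := 1 / 2) (by norm_num)
  have hcoord : ContDiff ℝ (⊤ : ℕ∞) fun x : EuclideanSpace ℝ (Fin d) => x i₀ := by fun_prop
  obtain ⟨n, ρ, a, hρ, hρ0, hρ1, hρs, hρc⟩ :=
    exists_slab_partition hf hfs.isCompact (half_pos hη)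
  obtain ⟨m, σ, b, hσ, hσ0, hσ1, hσs, hσc⟩ :=
    exists_slab_partition hcoord hfs.isCompact hε
  refine ⟨Fin n × Fin m, inferInstance, fun i x => ρ i.1 x * σ i.2 x,
    fun i => tsupport f ∩ (f ⁻¹' Set.Icc (a i.1) (a i.1 + η / 2) ∩
      (fun x => x i₀) ⁻¹' Set.Icc (b i.2) (b i.2 + ε)),
    fun i => min 1 (|a i.1| + η / 2), fun i => (hρ _).mul (hσ _),
    fun i x => mul_nonneg (hρ0 _ _) (hσ0 _ _), fun x hx => ?_, fun i => ?_,
    fun i => Set.inter_subset_left, fun i x hx => ?_, fun i => ?_, fun i => ?_,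
    fun i x hx => ?_, fun x => ?_⟩
  · simp only [Fintype.sum_prod_type]
    rw [← Finset.sum_mul_sum, hρ1 x hx, hσ1 x hx, one_mul]
  · exact hfs.isCompact.inter_right ((isClosed_Icc.preimage hf.continuous).inter
      (isClosed_Icc.preimage hcoord.continuous))
  · have hx' := right_ne_zero_of_mul hx
    exact ⟨subset_tsupport f (left_ne_zero_of_mul hx), hρs _ _ (left_ne_zero_of_mul hx'),
      hσs _ _ (right_ne_zero_of_mul hx')⟩
  · refine (measureReal_mono ?_ ?_).trans (hvol (b i.2))
    · exact Set.inter_subset_inter_right _ Set.inter_subset_right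
    · exact measure_ne_top_of_subset Set.inter_subset_left hfs.isCompact.measure_lt_top.ne
  · exact ⟨by positivity, min_le_left _ _⟩
  · obtain ⟨-, hx, -⟩ := hx
    have hclose : |f x - a i.1| ≤ η / 2 := abs_le.2 ⟨by linarith [hx.1], by linarith [hx.2]⟩
    have h1 := abs_sub_abs_le_abs_sub (f x) (a i.1)
    have h2 := abs_sub_abs_le_abs_sub (a i.1) (f x)
    rw [abs_sub_comm] at h2
    exact ⟨le_min (hf1 x) (by linarith), (min_le_right _ _).trans (by linarith)⟩
  · calc _ ≤ ∑ i : Fin n × Fin m,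
          (f ⁻¹' Set.Icc (a i.1) (a i.1 + η / 2)).indicator (fun _ => (1 : ℝ)) x *
          ((fun x : EuclideanSpace ℝ (Fin d) => x i₀) ⁻¹' Set.Icc (b i.2) (b i.2 + ε)).indicator
            (fun _ => (1 : ℝ)) x := by
          refine Finset.sum_le_sum fun i _ => ?_
          rw [← Set.inter_indicator_mul]
          simp only [mul_one]
          exact Set.indicator_le_indicator_of_subset Set.inter_subset_right
            (fun _ => zero_le_one) x
      _ ≤ 2 * 2 := by
          simp only [Fintype.sum_prod_type]
          rw [← Finset.sum_mul_sum]
          exact mul_le_mul (hρc x) (hσc x)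
            (Finset.sum_nonneg fun i _ => Set.indicator_nonneg (fun _ _ => zero_le_one) x)
            zero_le_two
      _ = 4 := by norm_num

/-- Integrating a function over a finite family of subsets of `S` with bounded overlap. -/
lemma sum_setIntegral_le_of_overlap {α ι : Type*} [MeasurableSpace α] [Fintype ι] {μ : Measure α}
    {K : ι → Set α} {S : Set α} {h : α → ℝ} {C : ℝ} (hK : ∀ i, MeasurableSet (K i))
    (hKS : ∀ i, K i ⊆ S) (h0 : ∀ x, 0 ≤ h x) (hint : IntegrableOn h S μ)
    (hC : ∀ x, ∑ i, (K i).indicator (fun _ => (1 : ℝ)) x ≤ C) :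
    ∑ i, ∫ x in K i, h x ∂μ ≤ C * ∫ x in S, h x ∂μ := by
  have heq : ∀ i, ∫ x in K i, h x ∂μ = ∫ x in S, (K i).indicator h x ∂μ := fun i => by
    rw [setIntegral_indicator (hK i), Set.inter_eq_right.2 (hKS i)]
  simp only [heq]
  rw [← integral_finsetSum _ fun i _ => hint.indicator (hK i), ← integral_const_mul]
  refine integral_mono (integrable_finsetSum _ fun i _ => hint.indicator (hK i))
    (hint.const_mul C) fun x => ?_
  have : ∑ i, (K i).indicator h x = (∑ i, (K i).indicator (fun _ => (1 : ℝ)) x) * h x := by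
    rw [Finset.sum_mul]
    refine Finset.sum_congr rfl fun i _ => ?_
    by_cases hx : x ∈ K i <;> simp [hx]
  simp only [this]
  exact mul_le_mul_of_nonneg_right (hC x) (h0 x)

/-- A smooth compactly supported function is a finite sum of smooth functions supported on sets of
volume at most `1` whose sup norms have bounded sum. -/
lemma exists_decomposition_small_supports {d : ℕ} (i₀ : Fin d)
    {f : EuclideanSpace ℝ (Fin d) → ℝ} (hf : ContDiff ℝ (⊤ : ℕ∞) f) (hfs : HasCompactSupport f)
    (hf1 : ∀ x, |f x| ≤ 1) (hfL : ∫ x, |f x| ≤ 1) :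
    ∃ (n : ℕ) (g : Fin n → EuclideanSpace ℝ (Fin d) → ℝ) (B : Fin n → ℝ),
      (∀ k, ContDiff ℝ (⊤ : ℕ∞) (g k)) ∧ (∀ k, HasCompactSupport (g k)) ∧
      (∀ x, ∑ k, g k x = f x) ∧ (∀ k, 0 ≤ B k) ∧ (∀ k x, |g k x| ≤ B k) ∧
      (∀ k, volume.real (tsupport (g k)) ≤ 1) ∧ ∑ k, B k ≤ 12 := by
  classical
  set V := volume.real (tsupport f)
  have hV : 0 ≤ V := measureReal_nonneg
  obtain ⟨η, hη, hηV⟩ : ∃ η > 0, η * V ≤ 1 / 4 := by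
    refine ⟨1 / 4 / (V + 1), by positivity, ?_⟩
    rw [div_mul_eq_mul_div, div_le_iff₀ (by linarith)]
    linarith
  obtain ⟨ι, _, ρ, K, s, hρ, hρ0, hρ1, hKc, hKf, hKρ, hKv, hs, hKs, hover⟩ :=
    exists_fine_partition i₀ hf hfs hf1 hη
  obtain ⟨n, c, B, hB, hc, hbin, hsum⟩ := exists_bin_packing Finset.univ
    (fun i => volume.real (K i)) s zero_le_one (fun i => measureReal_nonneg) hKv
    (fun i => (hs i).1) (fun i => (hs i).2)
  have hfi : Integrable f := hf.continuous.integrable_of_hasCompactSupport hfs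
  have hconst : IntegrableOn (fun _ => η) (tsupport f) volume :=
    integrableOn_const hfs.isCompact.measure_lt_top.ne
  have hint : IntegrableOn (fun x => |f x| + η) (tsupport f) volume :=
    hfi.abs.integrableOn.add hconst
  have hweights : ∑ i, volume.real (K i) * s i ≤ 5 := by
    calc ∑ i, volume.real (K i) * s i ≤ ∑ i, ∫ x in K i, (|f x| + η) := by
          refine Finset.sum_le_sum fun i _ => ?_
          rw [← smul_eq_mul, ← setIntegral_const]
          exact setIntegral_mono_on (integrableOn_const (hKc i).measure_lt_top.ne)
            (hint.mono_set (hKf i)) (hKc i).measurableSet fun x hx => (hKs i x hx).2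
      _ ≤ 4 * ∫ x in tsupport f, (|f x| + η) :=
          sum_setIntegral_le_of_overlap (fun i => (hKc i).measurableSet)
            hKf (fun x => by positivity) hint hover
      _ = 4 * ((∫ x in tsupport f, |f x|) + η * V) := by
          rw [integral_add hfi.abs.integrableOn hconst, setIntegral_const, smul_eq_mul, mul_comm V]
      _ ≤ 4 * (1 + 1 / 4) := by
          gcongr
          exact (setIntegral_le_integral hfi.abs (.of_forall fun x => abs_nonneg _)).trans hfL
      _ = 5 := by norm_num
  let g : Fin (n + 1) → EuclideanSpace ℝ (Fin d) → ℝ :=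
    fun k x => ∑ i with c i = k, f x * ρ i x
  have hgK : ∀ k, tsupport (g k) ⊆ ⋃ i ∈ Finset.univ.filter fun i => c i = (k : ℕ), K i := by
    intro k
    refine closure_minimal (fun x hx => ?_)
      ((Finset.univ.filter fun i => c i = (k : ℕ)).finite_toSet.isClosed_biUnion
        fun i _ => (hKc i).isClosed)
    obtain ⟨i, hi, hne⟩ := Finset.exists_ne_zero_of_sum_ne_zero hx
    exact Set.mem_biUnion hi (hKρ i x hne)
  refine ⟨n + 1, g, fun k => B k, fun k => ContDiff.sum fun i _ => hf.mul (hρ i), fun k => ?_,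
    fun x => ?_, fun k => hB k, fun k x => ?_, fun k => ?_, ?_⟩
  · exact ((Finset.univ.filter fun i => c i = (k : ℕ)).finite_toSet.isCompact_biUnion
      fun i _ => hKc i).of_isClosed_subset (isClosed_tsupport _) (hgK k)
  · have hfib := Finset.sum_fiberwise_of_maps_to (s := Finset.univ) (t := Finset.range (n + 1))
      (g := c) (fun i _ => Finset.mem_range.2 (Nat.lt_succ_of_le (hc i (Finset.mem_univ i)).1))
      (fun i => f x * ρ i x)
    rw [Fin.sum_univ_eq_sum_range (fun k => ∑ i with c i = k, f x * ρ i x) (n + 1), hfib,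
      ← Finset.mul_sum]
    by_cases hx : x ∈ tsupport f
    · rw [hρ1 x hx, mul_one]
    · rw [image_eq_zero_of_notMem_tsupport hx, zero_mul]
  · by_cases hx : g k x = 0
    · rw [hx, abs_zero]
      exact hB k
    obtain ⟨i, hi, hne⟩ := Finset.exists_ne_zero_of_sum_ne_zero hx
    have hxf : x ∈ tsupport f := subset_tsupport f (left_ne_zero_of_mul hne)
    have hle : ∑ i with c i = k, ρ i x ≤ 1 := by
      rw [← hρ1 x hxf]
      exact Finset.sum_le_sum_of_subset_of_nonneg (Finset.filter_subset _ _)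
        fun i _ _ => hρ0 i x
    calc |g k x| = |f x| * ∑ i with c i = k, ρ i x := by
          simp only [g]
          rw [← Finset.mul_sum, abs_mul, abs_of_nonneg (Finset.sum_nonneg fun i _ => hρ0 i x)]
      _ ≤ |f x| := mul_le_of_le_one_right (abs_nonneg _) hle
      _ ≤ s i := (hKs i x (hKρ i x hne)).1
      _ ≤ B k := (Finset.mem_filter.1 hi).2 ▸ (hc i (Finset.mem_univ i)).2
  · refine (measureReal_mono (hgK k) ?_).trans ((measureReal_biUnion_finset_le _ _).trans
      (hbin k))
    exact ((Finset.univ.filter fun i => c i = (k : ℕ)).finite_toSet.isCompact_biUnion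
      fun i _ => hKc i).measure_lt_top.ne
  · rw [Fin.sum_univ_eq_sum_range B (n + 1)]
    linarith

open MeasureTheory

/-- **L¹-splitting.** Any smooth compactly supported zero-mean function `f` on `ℝ^d`
with `‖f‖_∞ + ‖f‖_{L¹} ≤ 1` splits as a finite sum of smooth compactly supported
zero-mean functions `f_i` with `∑ ‖f_i‖_∞ · (vol(supp f_i) + 1) ≤ 100`. -/
theorem l1_splitting (d : ℕ) (hd : 1 ≤ d)
    (f : EuclideanSpace ℝ (Fin d) → ℝ)
    (hf_smooth : ContDiff ℝ (⊤ : ℕ∞) f)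
    (hf_supp : HasCompactSupport f)
    (hf_mean : (∫ x, f x) = 0)
    (hf_norm : (⨆ x, |f x|) + (∫ x, |f x|) ≤ 1) :
    ∃ (m : ℕ) (F : Fin m → EuclideanSpace ℝ (Fin d) → ℝ),
      (∀ i, ContDiff ℝ (⊤ : ℕ∞) (F i)) ∧
      (∀ i, HasCompactSupport (F i)) ∧
      (∀ i, (∫ x, F i x) = 0) ∧
      (f = fun x => ∑ i, F i x) ∧
      (∑ i, (⨆ x, |F i x|) * ((volume (tsupport (F i))).toReal + 1)) ≤ 100 := by
  have : Nonempty (Fin d) := ⟨⟨0, hd⟩⟩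
  have hbdd : BddAbove (Set.range fun x => |f x|) :=
    (hf_smooth.continuous.abs).bddAbove_range_of_hasCompactSupport (hf_supp.comp_left abs_zero)
  have hL0 : 0 ≤ ∫ x, |f x| := integral_nonneg fun x => abs_nonneg _
  have hf1 : ∀ x, |f x| ≤ 1 := fun x => by linarith [le_ciSup hbdd x]
  have hfL : ∫ x, |f x| ≤ 1 := by linarith [(abs_nonneg _).trans (le_ciSup hbdd 0)]
  obtain ⟨χ, hχ, hχs, hχi, hχ1, hχ2⟩ :=
    exists_normalized_bump (EuclideanSpace ℝ (Fin d)) volume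
  obtain ⟨n, g, B, hg, hgs, hgf, hB, hgB, hgv, hBsum⟩ :=
    exists_decomposition_small_supports ⟨0, hd⟩ hf_smooth hf_supp hf1 hfL
  have hgi : ∀ k, Integrable (g k) := fun k =>
    (hg k).continuous.integrable_of_hasCompactSupport (hgs k)
  have hχint : Integrable χ := hχ.continuous.integrable_of_hasCompactSupport hχs
  refine ⟨n, fun k x => g k x - (∫ y, g k y) * χ x, fun k => (hg k).sub (contDiff_const.mul hχ),
    fun k => (hgs k).sub hχs.mul_left, fun k => ?_, funext fun x => ?_, ?_⟩
  · rw [integral_sub (hgi k) (hχint.const_mul _), integral_const_mul, hχi, mul_one, sub_self]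
  · have hmean : ∑ k, ∫ y, g k y = 0 := by
      rw [← integral_finsetSum _ fun k _ => hgi k, ← hf_mean]
      simp only [hgf]
    rw [Finset.sum_sub_distrib, ← Finset.sum_mul, hmean, zero_mul, sub_zero, hgf]
  · calc _ ≤ ∑ k, 8 * B k := Finset.sum_le_sum fun k _ =>
          cost_sub_mean_le (hgs k) (hgB k) (hB k) (hgv k) hχs hχ1 hχ2
      _ ≤ 100 := by
          rw [← Finset.mul_sum]
          linarith
end

section
/- Let n ≥ 1 and let u : ℝ^{2n} → ℝ be a smooth non-constant function. Then there exists a constant c > 0 (depending only on u) such that for every smooth compactly supported f : ℝ^{2n} → ℝ with ∫ f dvol = 0 and ‖f‖_∞ ≤ 1, there exist a natural number N with N ≤ c · (vol(supp f) + 1) and compactly supported volume-preserving diffeomorphisms Φ_{1,+}, Φ_{1,-}, …, Φ_{N,+}, Φ_{N,-} of ℝ^{2n} such that f = ∑_{i=1}^N (u ∘ Φ_{i,+} − u ∘ Φ_{i,-}). -/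
open MeasureTheory

/-- A compactly supported volume-preserving diffeomorphism of `ℝ^d`: a smooth
diffeomorphism that preserves Lebesgue measure and equals the identity outside
some compact set. -/
def IsCompSuppVolDiffeo (d : ℕ)
    (Φ : EuclideanSpace ℝ (Fin d) → EuclideanSpace ℝ (Fin d)) : Prop :=
  ContDiff ℝ (⊤ : ℕ∞) Φ ∧
  (∃ Ψ : EuclideanSpace ℝ (Fin d) → EuclideanSpace ℝ (Fin d),
    ContDiff ℝ (⊤ : ℕ∞) Ψ ∧ Function.LeftInverse Ψ Φ ∧ Function.RightInverse Ψ Φ) ∧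
  MeasurePreserving Φ volume volume ∧
  (∃ K : Set (EuclideanSpace ℝ (Fin d)), IsCompact K ∧ ∀ x ∉ K, Φ x = x)

open Set Function Filter Topology
open scoped ContDiff ENNReal NNReal

/-- Euclidean space of dimension `d`. -/
abbrev Euc (d : ℕ) := EuclideanSpace ℝ (Fin d)

variable {d : ℕ}

/-! ### The group of compactly supported volume-preserving diffeomorphisms -/

namespace IsCompSuppVolDiffeo

protected theorem id : IsCompSuppVolDiffeo d (fun x => x) :=
  ⟨contDiff_id, ⟨fun x => x, contDiff_id, fun _ => rfl, fun _ => rfl⟩, MeasurePreserving.id _,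
    ∅, isCompact_empty, fun _ _ => rfl⟩

theorem comp {Φ Φ' : Euc d → Euc d} (h : IsCompSuppVolDiffeo d Φ)
    (h' : IsCompSuppVolDiffeo d Φ') : IsCompSuppVolDiffeo d (fun x => Φ (Φ' x)) := by
  obtain ⟨h1, ⟨Ψ, hΨ, hl, hr⟩, h2, K, hK, hΦK⟩ := h
  obtain ⟨h1', ⟨Ψ', hΨ', hl', hr'⟩, h2', K', hK', hΦK'⟩ := h'
  refine ⟨h1.comp h1', ⟨fun x => Ψ' (Ψ x), hΨ'.comp hΨ, fun x => ?_, fun x => ?_⟩,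
    h2.comp h2', K ∪ K', hK.union hK', fun x hx => ?_⟩
  · simp only [hl (Φ' x), hl' x]
  · simp only [hr' (Ψ x), hr x]
  · simp only [mem_union, not_or] at hx
    simp [hΦK' x hx.2, hΦK x hx.1]

theorem exists_inverse {Φ : Euc d → Euc d} (h : IsCompSuppVolDiffeo d Φ) :
    ∃ Ψ, IsCompSuppVolDiffeo d Ψ ∧ LeftInverse Ψ Φ ∧ RightInverse Ψ Φ := by
  obtain ⟨h1, ⟨Ψ, hΨ, hl, hr⟩, h2, K, hK, hΦK⟩ := h
  refine ⟨Ψ, ⟨hΨ, ⟨Φ, h1, hr, hl⟩, ⟨hΨ.continuous.measurable, ?_⟩, K, hK, fun x hx => ?_⟩, hl, hr⟩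
  · ext s hs
    rw [Measure.map_apply hΨ.continuous.measurable hs,
      ← h2.measure_preimage (hΨ.continuous.measurable hs).nullMeasurableSet, ← preimage_comp,
      hl.comp_eq_id, preimage_id]
  · conv_lhs => rw [← hΦK x hx]
    exact hl x

theorem conj_linear {Φ : Euc d → Euc d} (h : IsCompSuppVolDiffeo d Φ) (M : Euc d ≃L[ℝ] Euc d) :
    IsCompSuppVolDiffeo d (fun x => M (Φ (M.symm x))) := by
  obtain ⟨h1, ⟨Ψ, hΨ, hl, hr⟩, h2, K, hK, hΦK⟩ := h
  refine ⟨by fun_prop, ⟨fun x => M (Ψ (M.symm x)), by fun_prop, fun x => ?_, fun x => ?_⟩,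
    ⟨(by fun_prop : Continuous _).measurable, ?_⟩, M '' K, hK.image M.continuous, fun x hx => ?_⟩
  · simp [hl (M.symm x)]
  · simp [hr (M.symm x)]
  · ext s hs
    have hm : Measurable Φ := h1.continuous.measurable
    rw [Measure.map_apply (by fun_prop : Continuous _).measurable hs]
    have : (fun x => M (Φ (M.symm x))) ⁻¹' s = M '' (Φ ⁻¹' (M ⁻¹' s)) := by
      ext x
      constructor
      · intro hx
        exact ⟨M.symm x, hx, by simp⟩
      · rintro ⟨y, hy, rfl⟩
        simpa using hy
    rw [this, Measure.addHaar_image_continuousLinearEquiv,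
      h2.measure_preimage (M.continuous.measurable hs).nullMeasurableSet,
      ← Measure.addHaar_image_continuousLinearEquiv, M.surjective.image_preimage]
  · have : M.symm x ∉ K := fun h => hx ⟨_, h, by simp⟩
    simp [hΦK _ this]

theorem conj_translate {Φ : Euc d → Euc d} (h : IsCompSuppVolDiffeo d Φ) (c : Euc d) :
    IsCompSuppVolDiffeo d (fun x => Φ (x - c) + c) := by
  obtain ⟨h1, ⟨Ψ, hΨ, hl, hr⟩, h2, K, hK, hΦK⟩ := h
  refine ⟨by fun_prop, ⟨fun x => Ψ (x - c) + c, by fun_prop, fun x => ?_, fun x => ?_⟩,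
    ?_, (fun x => x + c) '' K, hK.image (by fun_prop), fun x hx => ?_⟩
  · simp [hl (x - c)]
  · simp [hr (x - c)]
  · exact (measurePreserving_add_right volume c).comp
      (h2.comp (measurePreserving_sub_right volume c))
  · have : x - c ∉ K := fun h => hx ⟨_, h, by simp⟩
    simp [hΦK _ this]

/-- A compactly supported diffeomorphism whose Jacobian determinant is `±1` preserves volume. -/
theorem of_det {Φ Ψ : Euc d → Euc d} (hΦ : ContDiff ℝ ∞ Φ) (hΨ : ContDiff ℝ ∞ Ψ)
    (hl : LeftInverse Ψ Φ) (hr : RightInverse Ψ Φ)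
    (hdet : ∀ x, |(fderiv ℝ Φ x).det| = 1) {K : Set (Euc d)} (hK : IsCompact K)
    (hΦK : ∀ x ∉ K, Φ x = x) : IsCompSuppVolDiffeo d Φ := by
  refine ⟨hΦ, ⟨Ψ, hΨ, hl, hr⟩, ⟨hΦ.continuous.measurable, ?_⟩, K, hK, hΦK⟩
  ext s hs
  rw [Measure.map_apply hΦ.continuous.measurable hs]
  have hm := hΦ.continuous.measurable hs
  have := lintegral_abs_det_fderiv_eq_addHaar_image volume hm
    (fun x _ => ((hΦ.differentiable (by simp)) x).hasFDerivAt.hasFDerivWithinAt)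
    (hl.injective.injOn)
  simpa [hdet, hr.surjective.image_preimage] using this

end IsCompSuppVolDiffeo

/-! ### Sums of differences of transported copies of a function -/

/-- `f` is a sum of `N` differences `u ∘ Φ - u ∘ Φ'`. -/
def IsRep (u : Euc d → ℝ) (N : ℕ) (f : Euc d → ℝ) : Prop :=
  ∃ Φp Φm : Fin N → (Euc d → Euc d), (∀ i, IsCompSuppVolDiffeo d (Φp i)) ∧
    (∀ i, IsCompSuppVolDiffeo d (Φm i)) ∧ f = fun x => ∑ i, (u (Φp i x) - u (Φm i x))

namespace IsRep

variable {u f g : Euc d → ℝ} {N M : ℕ}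

theorem zero (u : Euc d → ℝ) (N : ℕ) : IsRep u N 0 :=
  ⟨fun _ x => x, fun _ x => x, fun _ => .id, fun _ => .id, by ext; simp⟩

theorem add (hf : IsRep u N f) (hg : IsRep u M g) : IsRep u (N + M) (f + g) := by
  obtain ⟨Φ, Φ', h, h', rfl⟩ := hf
  obtain ⟨Θ, Θ', k, k', rfl⟩ := hg
  refine ⟨Fin.append Φ Θ, Fin.append Φ' Θ', fun i => ?_, fun i => ?_, ?_⟩
  · refine Fin.addCases (fun i => ?_) (fun i => ?_) i <;> simp [h, k]
  · refine Fin.addCases (fun i => ?_) (fun i => ?_) i <;> simp [h', k']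
  · ext x
    simp [Fin.sum_univ_add]
    ring

theorem mono (hf : IsRep u N f) (h : N ≤ M) : IsRep u M f := by
  obtain ⟨k, rfl⟩ := Nat.exists_eq_add_of_le h
  simpa using hf.add (zero u k)

theorem neg (hf : IsRep u N f) : IsRep u N (-f) := by
  obtain ⟨Φ, Φ', h, h', rfl⟩ := hf
  refine ⟨Φ', Φ, h', h, ?_⟩
  ext x
  simp

theorem sub (hf : IsRep u N f) (hg : IsRep u M g) : IsRep u (N + M) (f - g) := by
  rw [sub_eq_add_neg]
  exact hf.add hg.neg

theorem comp (hf : IsRep u N f) {τ : Euc d → Euc d} (hτ : IsCompSuppVolDiffeo d τ) :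
    IsRep u N (fun x => f (τ x)) := by
  obtain ⟨Φ, Φ', h, h', rfl⟩ := hf
  exact ⟨fun i x => Φ i (τ x), fun i x => Φ' i (τ x), fun i => (h i).comp hτ,
    fun i => (h' i).comp hτ, rfl⟩

theorem single {Φ Φ' : Euc d → Euc d} (u : Euc d → ℝ) (h : IsCompSuppVolDiffeo d Φ)
    (h' : IsCompSuppVolDiffeo d Φ') : IsRep u 1 (fun x => u (Φ x) - u (Φ' x)) :=
  ⟨fun _ => Φ, fun _ => Φ', fun _ => h, fun _ => h', by simp⟩

theorem sum {ι : Type*} (s : Finset ι) {F : ι → Euc d → ℝ} (h : ∀ i ∈ s, IsRep u N (F i)) :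
    IsRep u (s.card * N) (fun x => ∑ i ∈ s, F i x) := by
  classical
  induction s using Finset.induction_on with
  | empty => simpa using! zero u 0
  | insert a s ha ih =>
    have := (h a (by simp)).add (ih fun i hi => h i (by simp [hi]))
    refine IsRep.mono (f := _) ?_ (le_of_eq ?_) (N := N + s.card * N)
    · convert this using 1
      ext x
      simp [Finset.sum_insert ha]
    · rw [Finset.card_insert_of_notMem ha]; ring

/-- Precomposing `u` with a diffeomorphism does not change which functions are representable. -/
theorem of_comp {Ψ : Euc d → Euc d} (hΨ : IsCompSuppVolDiffeo d Ψ)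
    (h : IsRep (fun x => u (Ψ x)) N f) : IsRep u N f := by
  obtain ⟨Φ, Φ', h, h', rfl⟩ := h
  exact ⟨fun i x => Ψ (Φ i x), fun i x => Ψ (Φ' i x), fun i => hΨ.comp (h i),
    fun i => hΨ.comp (h' i), rfl⟩

end IsRep

/-! ### Displacements along a coordinate direction -/

/-- The `i`-th standard basis vector. -/
noncomputable def eb (i : Fin d) : Euc d := EuclideanSpace.single i 1

@[simp] theorem eb_apply (i j : Fin d) : eb i j = if j = i then 1 else 0 := by
  simp [eb]

@[simp] theorem norm_eb (i : Fin d) : ‖eb i‖ = 1 := by simp [eb]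

/-- `k` is Lipschitz with constant `η` along the `i`-th coordinate direction. -/
def LipDir (i : Fin d) (η : ℝ) (k : Euc d → ℝ) : Prop :=
  ∀ p (s : ℝ), |k (p + s • eb i) - k p| ≤ η * |s|

/-- The displacements `p ↦ p + k p • eb i` and `p ↦ p + r p • eb i` are mutually inverse. -/
def InvPair (i : Fin d) (k r : Euc d → ℝ) : Prop :=
  (∀ p, r (p + k p • eb i) = -k p) ∧ ∀ p, k (p + r p • eb i) = -r p

section Lip

variable {i : Fin d} {η η' : ℝ} {k k' r r' : Euc d → ℝ}

theorem LipDir.mono (h : LipDir i η k) (hη : η ≤ η') : LipDir i η' k := fun p s =>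
  (h p s).trans (by gcongr)

theorem LipDir.add (h : LipDir i η k) (h' : LipDir i η' k') : LipDir i (η + η') (k + k') := by
  intro p s
  have h1 := h p s
  have h2 := h' p s
  calc |(k + k') (p + s • eb i) - (k + k') p|
      = |(k (p + s • eb i) - k p) + (k' (p + s • eb i) - k' p)| := by
        simp only [Pi.add_apply]; congr 1; ring
    _ ≤ _ := (abs_add_le _ _).trans (by linarith)

theorem LipDir.neg (h : LipDir i η k) : LipDir i η (-k) := by
  intro p s
  have h1 := h p s
  rw [← abs_neg] at h1
  convert h1 using 2
  simp only [Pi.neg_apply]; ring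

theorem LipDir.sub (h : LipDir i η k) (h' : LipDir i η' k') : LipDir i (η + η') (k - k') := by
  rw [sub_eq_add_neg]; exact h.add h'.neg

theorem LipDir.const_mul (h : LipDir i η k) (c : ℝ) : LipDir i (|c| * η) (fun p => c * k p) := by
  intro p s
  rw [← mul_sub, abs_mul, mul_assoc]
  gcongr
  exact h p s

theorem LipDir.of_fderiv (hk : Differentiable ℝ k) (h : ∀ p, |fderiv ℝ k p (eb i)| ≤ η) :
    LipDir i η k := by
  intro p s
  have hd : ∀ t : ℝ, HasDerivAt (fun t : ℝ => k (p + t • eb i))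
      (fderiv ℝ k (p + t • eb i) (eb i)) t := by
    intro t
    have h1 : HasDerivAt (fun t : ℝ => p + t • eb i) (eb i) t := by
      simpa using ((hasDerivAt_id t).smul_const (eb i)).const_add p
    exact (hk _).hasFDerivAt.comp_hasDerivAt t h1
  have := Convex.norm_image_sub_le_of_norm_hasDerivWithin_le (s := univ) (C := η)
    (fun t _ => (hd t).hasDerivWithinAt) (fun t _ => h _) convex_univ (mem_univ 0) (mem_univ s)
  simpa using this

theorem LipDir.abs_fderiv_le (h : LipDir i η k) (hk : Differentiable ℝ k) (p : Euc d) :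
    |fderiv ℝ k p (eb i)| ≤ η := by
  have h1 : HasDerivAt (fun t : ℝ => p + t • eb i) (eb i) 0 := by
    simpa using ((hasDerivAt_id (0 : ℝ)).smul_const (eb i)).const_add p
  have h2 : HasDerivAt (fun t : ℝ => k (p + t • eb i)) (fderiv ℝ k p (eb i)) 0 := by
    have := (hk (p + (0 : ℝ) • eb i)).hasFDerivAt.comp_hasDerivAt (0 : ℝ) h1
    rw [zero_smul, add_zero] at this
    exact this
  have h0 : 0 ≤ η := by
    have := h 0 1
    simpa using (abs_nonneg _).trans this
  refine h2.le_of_lip' h0 (Eventually.of_forall fun t => ?_)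
  simpa using h p t

theorem LipDir.eq_of_add_eq (h : LipDir i η k) (hη : η < 1) {p : Euc d} {s t : ℝ}
    (hs : k (p + s • eb i) + s = k (p + t • eb i) + t) : s = t := by
  have h1 := h (p + t • eb i) (s - t)
  have h2 : p + t • eb i + (s - t) • eb i = p + s • eb i := by rw [sub_smul]; abel
  rw [h2] at h1
  have h3 : k (p + s • eb i) - k (p + t • eb i) = -(s - t) := by linarith
  rw [h3, abs_neg] at h1
  by_contra hne
  have : 0 < |s - t| := abs_pos.2 (sub_ne_zero.2 hne)
  nlinarith

theorem LipDir.exists_add_eq_zero (h : LipDir i η k) (hη : η < 1) (hk : Continuous k) (p : Euc d) :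
    ∃ s : ℝ, k (p + s • eb i) + s = 0 := by
  set T := |k p| / (1 - η) with hT
  have hT0 : 0 ≤ T := div_nonneg (abs_nonneg _) (by linarith)
  have hTe : (1 - η) * T = |k p| := by rw [hT]; field_simp [show (1 - η) ≠ 0 by linarith]
  have h1 := abs_le.1 (h p T)
  have h2 := abs_le.1 (h p (-T))
  have h3 := abs_le.1 (le_refl |k p|)
  rw [abs_neg, abs_of_nonneg hT0] at h2
  rw [abs_of_nonneg hT0] at h1
  have hc : Continuous fun s : ℝ => k (p + s • eb i) + s := by fun_prop
  have := intermediate_value_Icc (show -T ≤ T by linarith) hc.continuousOn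
  obtain ⟨s, -, hs⟩ := this (show (0 : ℝ) ∈ _ from ⟨by nlinarith, by nlinarith⟩)
  exact ⟨s, hs⟩

theorem hasFDerivAt_disp (hk : Differentiable ℝ k) (p : Euc d) :
    HasFDerivAt (fun p => p + k p • eb i)
      (ContinuousLinearMap.id ℝ _ + (fderiv ℝ k p).smulRight (eb i)) p :=
  (hasFDerivAt_id p).add ((hk p).hasFDerivAt.smul_const (eb i))

theorem det_id_add_smulRight (f : Euc d →L[ℝ] ℝ) (v : Euc d) :
    (ContinuousLinearMap.id ℝ _ + f.smulRight v).det = 1 + f v :=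
  LinearMap.transvection.det (f : Euc d →ₗ[ℝ] ℝ) v

theorem det_clm_comp (A B : Euc d →L[ℝ] Euc d) : (A.comp B).det = A.det * B.det :=
  LinearMap.det_comp _ _

theorem fderiv_disp_det (hk : Differentiable ℝ k) (p : Euc d) :
    (fderiv ℝ (fun p => p + k p • eb i) p).det = 1 + fderiv ℝ k p (eb i) := by
  rw [(hasFDerivAt_disp hk p).fderiv, det_id_add_smulRight]

theorem LipDir.exists_invPair (h : LipDir i η k) (hη : η < 1) (hk : ContDiff ℝ ∞ k) :
    ∃ r, ContDiff ℝ ∞ r ∧ InvPair i k r := by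
  choose r hr using h.exists_add_eq_zero hη hk.continuous
  have hr' : ∀ p, k (p + r p • eb i) = - r p := fun p => by linarith [hr p]
  have hl : ∀ p, r (p + k p • eb i) = - k p := by
    intro p
    refine h.eq_of_add_eq hη (p := p + k p • eb i) ?_
    rw [hr]
    have : p + k p • eb i + (-k p) • eb i = p := by rw [neg_smul]; abel
    rw [this]; ring
  have hc : Continuous r := by
    rw [continuous_iff_continuousAt]
    intro q
    have h1 : Tendsto (fun p => (1 - η)⁻¹ * |k (p + r q • eb i) - k (q + r q • eb i)|) (𝓝 q)
        (𝓝 0) := by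
      have hcont : Continuous fun p => (1 - η)⁻¹ * |k (p + r q • eb i) - k (q + r q • eb i)| := by
        have := hk.continuous
        fun_prop
      simpa using hcont.tendsto q
    rw [ContinuousAt, tendsto_iff_dist_tendsto_zero]
    refine squeeze_zero (fun _ => dist_nonneg) (fun p => ?_) h1
    have h2 := h (p + r q • eb i) (r p - r q)
    have h3 : p + r q • eb i + (r p - r q) • eb i = p + r p • eb i := by rw [sub_smul]; abel
    rw [h3, hr'] at h2
    rw [Real.dist_eq, inv_mul_eq_div, le_div_iff₀ (by linarith), hr']
    have h4 : |r p - r q| ≤ |-r p - k (p + r q • eb i)| + |k (p + r q • eb i) - -r q| := by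
      rw [show r p - r q = -((-r p - k (p + r q • eb i)) + (k (p + r q • eb i) - -r q)) by ring,
        abs_neg]
      exact abs_add_le _ _
    nlinarith
  have hder : ∀ p, 1 + fderiv ℝ k p (eb i) ≠ 0 := fun p => by
    have := abs_le.1 (h.abs_fderiv_le (hk.differentiable (by simp)) p)
    linarith
  let G : Euc d ≃ₜ Euc d :=
    { toFun := fun p => p + k p • eb i
      invFun := fun p => p + r p • eb i
      left_inv := fun p => by simp [hl]
      right_inv := fun p => by simp [hr']
      continuous_toFun := by have := hk.continuous; fun_prop
      continuous_invFun := by fun_prop }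
  have hG : ContDiff ℝ ∞ G.symm := by
    refine Homeomorph.contDiff_symm (f₀' := fun p =>
      ContinuousLinearMap.toContinuousLinearEquivOfDetNeZero
        (ContinuousLinearMap.id ℝ _ + (fderiv ℝ k p).smulRight (eb i))
        (by rw [det_id_add_smulRight]; exact hder p)) G (fun p => ?_) ?_
    · exact hasFDerivAt_disp (hk.differentiable (by simp)) p
    · change ContDiff ℝ ∞ fun p => p + k p • eb i
      fun_prop
  refine ⟨r, ?_, hl, hr'⟩
  have : r = fun p => (G.symm p - p) i := by
    ext p
    change r p = (p + r p • eb i - p) i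
    simp
  rw [this]
  fun_prop

namespace InvPair

theorem symm (h : InvPair i k r) : InvPair i r k := ⟨h.2, h.1⟩

theorem lipDir (h : InvPair i k r) (hk : LipDir i η k) (hη : η ≤ 1 / 2) : LipDir i (2 * η) r := by
  intro p s
  have h1 := hk (p + r p • eb i) (s + (r (p + s • eb i) - r p))
  have h2 : p + r p • eb i + (s + (r (p + s • eb i) - r p)) • eb i
      = p + s • eb i + r (p + s • eb i) • eb i := by
    simp only [add_smul, sub_smul]; abel
  rw [h2, h.2, h.2] at h1
  have h3 : |-r (p + s • eb i) - -r p| = |r (p + s • eb i) - r p| := by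
    rw [← abs_neg]; congr 1; ring
  rw [h3] at h1
  have h4 := abs_add_le s (r (p + s • eb i) - r p)
  have h0 : 0 ≤ η := by
    have := (abs_nonneg _).trans (hk 0 1)
    simpa using this
  nlinarith [abs_nonneg s, abs_nonneg (r (p + s • eb i) - r p)]

theorem eq_zero (h : InvPair i k r) {p : Euc d} (hp : k p = 0) : r p = 0 := by
  simpa [hp] using h.1 p

/-- Displacements supported in disjoint sets invariant under translation along `eb i` add up. -/
theorem add (h : InvPair i k r) (h' : InvPair i k' r') {B B' : Set (Euc d)}
    (hB : ∀ p (s : ℝ), p ∈ B → p + s • eb i ∈ B) (hB' : ∀ p (s : ℝ), p ∈ B' → p + s • eb i ∈ B')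
    (hd : Disjoint B B') (hk : ∀ p ∉ B, k p = 0) (hk' : ∀ p ∉ B', k' p = 0) :
    InvPair i (k + k') (r + r') := by
  have key : ∀ {k r k' r' : Euc d → ℝ}, InvPair i k r → InvPair i k' r' → (∀ p ∉ B, k p = 0) →
      (∀ p ∉ B', k' p = 0) → ∀ p, (r + r') (p + (k + k') p • eb i) = -(k + k') p := by
    intro k r k' r' h h' hk hk' p
    by_cases hp : p ∈ B
    · have h1 : p ∉ B' := disjoint_left.1 hd hp
      have h2 : k' p = 0 := hk' p h1
      have h3 : r' (p + k p • eb i) = 0 := h'.eq_zero (hk' _ (disjoint_left.1 hd (hB _ _ hp)))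
      simp [h2, h3, h.1]
    · have h2 : k p = 0 := hk p hp
      by_cases hp' : p ∈ B'
      · have h3 : r (p + k' p • eb i) = 0 := h.eq_zero (hk _ (disjoint_right.1 hd (hB' _ _ hp')))
        simp [h2, h3, h'.1]
      · simp [h2, hk' p hp', h.eq_zero h2, h'.eq_zero (hk' p hp')]
  exact ⟨key h h' hk hk',
    key h.symm h'.symm (fun p hp => h.eq_zero (hk p hp)) (fun p hp => h'.eq_zero (hk' p hp))⟩

theorem comp_linear (h : InvPair i k r) (τ : Euc d →L[ℝ] Euc d) (hτ : τ (eb i) = eb i) :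
    InvPair i (fun p => k (τ p)) (fun p => r (τ p)) :=
  ⟨fun p => by simp [hτ, h.1], fun p => by simp [hτ, h.2]⟩

/-- The integral of a directional derivative of a compactly supported function vanishes. -/
theorem _root_.integral_fderiv_eq_zero {A : Euc d → ℝ} (hA : ContDiff ℝ ∞ A)
    (hc : HasCompactSupport A) (v : Euc d) : ∫ p, fderiv ℝ A p v = 0 := by
  have h1 : Integrable fun p => fderiv ℝ A p v :=
    ((hA.continuous_fderiv (by simp)).clm_apply continuous_const).integrable_of_hasCompactSupport
      (hc.fderiv_apply ℝ v)
  have := integral_mul_fderiv_eq_neg_fderiv_mul_of_integrable (μ := volume) (v := v)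
    (f := fun _ : Euc d => (1 : ℝ)) (g := A) (by simp) (by simpa using h1)
    (by simpa using hA.continuous.integrable_of_hasCompactSupport hc) (by fun_prop)
    (fun x _ => hA.differentiable (by simp) x)
  simpa using this

theorem integral_eq_neg (h : InvPair i k r) (hL : LipDir i η k) (hη : η < 1)
    (hk : ContDiff ℝ ∞ k) (hc : HasCompactSupport k) : ∫ p, r p = - ∫ p, k p := by
  have hd : Differentiable ℝ k := hk.differentiable (by simp)
  have hpos : ∀ p, 0 < 1 + fderiv ℝ k p (eb i) := fun p => by
    have := abs_le.1 (hL.abs_fderiv_le hd p)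
    linarith
  have hinj : Injective fun p => p + k p • eb i := by
    refine LeftInverse.injective (g := fun p => p + r p • eb i) fun p => ?_
    simp [h.1]
  have hsurj : Surjective fun p => p + k p • eb i := by
    refine RightInverse.surjective (g := fun p => p + r p • eb i) fun p => ?_
    simp [h.2]
  have h1 := integral_image_eq_integral_abs_det_fderiv_smul volume MeasurableSet.univ
    (fun p _ => (hasFDerivAt_disp (i := i) hd p).hasFDerivWithinAt) hinj.injOn r
  rw [image_univ, hsurj.range_eq, Measure.restrict_univ] at h1
  rw [h1]
  simp only [det_id_add_smulRight, abs_of_pos (hpos _), h.1, smul_eq_mul]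
  have h2 := integral_fderiv_eq_zero (A := fun p => k p * k p) (by fun_prop)
    (hc.mul_left) (eb i)
  have h3 : ∀ p, fderiv ℝ (fun p => k p * k p) p (eb i) = 2 * (k p * fderiv ℝ k p (eb i)) := by
    intro p
    rw [fderiv_fun_mul (hd p) (hd p)]
    simp; ring
  simp only [h3, integral_const_mul] at h2
  have h4 : Continuous fun p => fderiv ℝ k p (eb i) :=
    (hk.continuous_fderiv (by simp)).clm_apply continuous_const
  have h5 : (fun p => (1 + fderiv ℝ k p (eb i)) * -k p)
      = fun p => -(k p + k p * fderiv ℝ k p (eb i)) := by ext p; ring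
  rw [h5, integral_neg, integral_add]
  · linarith
  · exact hk.continuous.integrable_of_hasCompactSupport hc
  · exact (hk.continuous.mul h4).integrable_of_hasCompactSupport hc.mul_right

end InvPair

end Lip

/-! ### Diffeomorphisms from generating functions -/

theorem IsCompSuppVolDiffeo.mem_of_mem {Φ : Euc d → Euc d} (h : IsCompSuppVolDiffeo d Φ)
    {B : Set (Euc d)} (hB : ∀ p ∉ B, Φ p = p) {p : Euc d} (hp : p ∈ B) : Φ p ∈ B := by
  obtain ⟨-, ⟨Ψ, -, hl, -⟩, -⟩ := h
  by_contra hn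
  rw [hl.injective (hB _ hn)] at hn
  exact hn hp

theorem fderiv_fderiv_apply_comm {A : Euc d → ℝ} (hA : ContDiff ℝ ∞ A) (p v w : Euc d) :
    fderiv ℝ (fun q => fderiv ℝ A q v) p w = fderiv ℝ (fun q => fderiv ℝ A q w) p v := by
  have h1 : DifferentiableAt ℝ (fderiv ℝ A) p :=
    ((hA.fderiv_right (m := ∞) (by simp)).differentiable (by simp)) p
  have h2 := (hA.contDiffAt (x := p)).isSymmSndFDerivAt
    (by simpa using WithTop.coe_le_coe.2 (le_top : (2 : ℕ∞) ≤ ⊤))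
  have h3 : ∀ v w, fderiv ℝ (fun q => fderiv ℝ A q v) p w = fderiv ℝ (fderiv ℝ A) p w v := by
    intro v w
    rw [fderiv_clm_apply h1 (differentiableAt_const v)]
    simp
  rw [h3, h3]
  exact h2 _ _

theorem ContDiff.fderiv_const_apply {A : Euc d → ℝ} (hA : ContDiff ℝ ∞ A) (v : Euc d) :
    ContDiff ℝ ∞ fun p => fderiv ℝ A p v :=
  (hA.fderiv_right (m := ∞) (by simp)).clm_apply contDiff_const

/-- The symplectic-type map generated by `A`: its `o`-th coordinate is displaced by the inverse
of the displacement `∂_j A`. -/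
theorem exists_diffeo_of_generating {A r : Euc d → ℝ} (hA : ContDiff ℝ ∞ A)
    (hc : HasCompactSupport A) {o j : Fin d} (hj : j ≠ o) {η : ℝ} (hη : η < 1)
    (hL : LipDir o η (fun p => fderiv ℝ A p (eb j)))
    (hr : ContDiff ℝ ∞ r) (h : InvPair o (fun p => fderiv ℝ A p (eb j)) r) :
    ∃ Φ, IsCompSuppVolDiffeo d Φ ∧ (∀ p, Φ p o = p o + r p) ∧ ∀ p ∉ tsupport A, Φ p = p := by
  have hk := hA.fderiv_const_apply (eb j)
  have hk' := hA.fderiv_const_apply (eb o)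
  have hL' : LipDir j η (fun p => fderiv ℝ A p (eb o)) :=
    .of_fderiv (hk'.differentiable (by simp)) fun p => by
      rw [fderiv_fderiv_apply_comm hA]
      exact hL.abs_fderiv_le (hk.differentiable (by simp)) p
  obtain ⟨s, hs, hinv⟩ := hL'.exists_invPair hη hk'
  have hz : ∀ p ∉ tsupport A, fderiv ℝ A p = 0 := fun p hp =>
    image_eq_zero_of_notMem_tsupport fun h' => hp (tsupport_fderiv_subset ℝ h')
  have hid : ∀ p ∉ tsupport A, p + r p • eb o
      + fderiv ℝ A (p + r p • eb o) (eb o) • eb j = p := by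
    intro p hp
    have h1 : r p = 0 := h.eq_zero (by simp [hz p hp])
    simp [h1, hz p hp]
  have hG : ContDiff ℝ ∞ fun p => p + r p • eb o := by fun_prop
  have hS : ContDiff ℝ ∞ fun p => p + fderiv ℝ A p (eb o) • eb j :=
    contDiff_id.add (hk'.smul contDiff_const)
  have hG' : ContDiff ℝ ∞ fun p => p + fderiv ℝ A p (eb j) • eb o :=
    contDiff_id.add (hk.smul contDiff_const)
  have hS' : ContDiff ℝ ∞ fun p => p + s p • eb j := by fun_prop
  refine ⟨fun p => p + r p • eb o + fderiv ℝ A (p + r p • eb o) (eb o) • eb j,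
    IsCompSuppVolDiffeo.of_det (hS.comp hG) (hG'.comp hS') (fun p => ?_) (fun p => ?_)
      (fun p => ?_) hc hid, fun p => ?_, hid⟩
  · have h1 := hinv.1 (p + r p • eb o)
    simp only [comp_apply, h1]
    have h2 := h.2 p
    simp [h2]
  · have h1 := h.1 (p + s p • eb j)
    simp only [comp_apply, h1]
    have h2 := hinv.2 p
    simp [h2]
  · have hdG := hG.differentiable (by simp) p
    have hdS := hS.differentiable (by simp) (p + r p • eb o)
    have hdG' := hG'.differentiable (by simp) (p + r p • eb o)
    have e1 : fderiv ℝ (fun p => p + r p • eb o + fderiv ℝ A (p + r p • eb o) (eb o) • eb j) p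
        = (fderiv ℝ (fun p => p + fderiv ℝ A p (eb o) • eb j) (p + r p • eb o)).comp
          (fderiv ℝ (fun p => p + r p • eb o) p) :=
      fderiv_comp (g := fun p => p + fderiv ℝ A p (eb o) • eb j) p hdS hdG
    have e2 := fderiv_comp p hdG' hdG
    have e3 : (fun p => p + fderiv ℝ A p (eb j) • eb o) ∘ (fun p => p + r p • eb o) = id := by
      ext1 p
      have := h.2 p
      simp [this]
    rw [e3, fderiv_id] at e2
    have e4 := congrArg ContinuousLinearMap.det e2
    rw [det_clm_comp, ContinuousLinearMap.det, ContinuousLinearMap.coe_id, LinearMap.det_id] at e4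
    have e5 := fderiv_disp_det (i := j) (hk'.differentiable (by simp)) (p + r p • eb o)
    have e6 := fderiv_disp_det (i := o) (hk.differentiable (by simp)) (p + r p • eb o)
    rw [fderiv_fderiv_apply_comm hA, ← e6] at e5
    rw [e1, det_clm_comp, e5, ← e4, abs_one]
  · simp [hj.symm]

/-! ### Integration along coordinate lines -/

/-- `k` vanishes outside the cube `[-R, R]^d`. -/
def CubeSupp (R : ℝ) (k : Euc d → ℝ) : Prop := ∀ p i, R < |p i| → k p = 0

/-- The cube `[-R, R]^d`. -/
def cube (d : ℕ) (R : ℝ) : Set (Euc d) := {p | ∀ i, |p i| ≤ R}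

theorem isCompact_cube (R : ℝ) : IsCompact (cube d R) := by
  refine Metric.isCompact_of_isClosed_isBounded ?_ ?_
  · have : cube d R = ⋂ i, {p : Euc d | |p i| ≤ R} := by ext; simp [cube]
    rw [this]
    exact isClosed_iInter fun i => isClosed_le (by fun_prop) continuous_const
  · rw [isBounded_iff_forall_norm_le]
    refine ⟨√(∑ _i : Fin d, R ^ 2), fun p hp => ?_⟩
    rw [EuclideanSpace.norm_eq]
    gcongr with i
    exact hp i

theorem CubeSupp.eq_zero {R : ℝ} {k : Euc d → ℝ} (h : CubeSupp R k) {p : Euc d}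
    (hp : p ∉ cube d R) : k p = 0 := by
  simp only [cube, mem_ofPred_eq, not_forall, not_le] at hp
  obtain ⟨i, hi⟩ := hp
  exact h p i hi

theorem CubeSupp.hasCompactSupport {R : ℝ} {k : Euc d → ℝ} (h : CubeSupp R k) :
    HasCompactSupport k :=
  HasCompactSupport.intro (isCompact_cube R) fun _ hp => h.eq_zero hp

theorem CubeSupp.tsupport_subset {R : ℝ} {k : Euc d → ℝ} (h : CubeSupp R k) :
    tsupport k ⊆ cube d R :=
  closure_minimal (fun _ hp => by_contra fun hn => hp (h.eq_zero hn)) (isCompact_cube R).isClosed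

theorem CubeSupp.mono {R R' : ℝ} {k : Euc d → ℝ} (h : CubeSupp R k) (hR : R ≤ R') :
    CubeSupp R' k := fun p i hi => h p i (hR.trans_lt hi)

theorem CubeSupp.add {R : ℝ} {k k' : Euc d → ℝ} (h : CubeSupp R k) (h' : CubeSupp R k') :
    CubeSupp R (k + k') := fun p i hi => by simp [h p i hi, h' p i hi]

theorem CubeSupp.sub {R : ℝ} {k k' : Euc d → ℝ} (h : CubeSupp R k) (h' : CubeSupp R k') :
    CubeSupp R (k - k') := fun p i hi => by simp [h p i hi, h' p i hi]

theorem InvPair.cubeSupp {i : Fin d} {R : ℝ} {k r : Euc d → ℝ} (h : InvPair i k r)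
    (hk : CubeSupp R k) : CubeSupp R r := fun p j hj => h.eq_zero (hk p j hj)

/-- The integral of `k` over the points `p + t • eb j`, `t ∈ S`. -/
noncomputable def lineInt (S : Set ℝ) (j : Fin d) (k : Euc d → ℝ) (p : Euc d) : ℝ :=
  ∫ t in S, k (p + t • eb j)

section LineInt

variable {S : Set ℝ} {i j o : Fin d} {k : Euc d → ℝ} {R η : ℝ}

theorem lineInt_contDiff (hS : MeasurableSet S) (hk : ContDiff ℝ ∞ k) (hc : HasCompactSupport k) :
    ContDiff ℝ ∞ (lineInt S j k) := by
  obtain ⟨R, hR⟩ := hc.isCompact.isBounded.exists_norm_le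
  rw [← contDiffOn_univ]
  have hU : (univ : Set (Euc d)) = ⋃ ρ : ℝ, Metric.ball 0 ρ := by
    ext p
    simpa using exists_gt _
  rw [hU]
  refine ContDiffOn.iUnion_of_isOpen (fun ρ => ?_) fun ρ => Metric.isOpen_ball
  have := contDiffOn_convolution_right_with_param_comp (μ := (volume : Measure ℝ)) (n := ⊤)
    (f := S.indicator fun _ => (1 : ℝ)) (g := fun (p : Euc d) (x : ℝ) => k (p - x • eb j))
    (k := Metric.closedBall 0 (R + ρ)) (v := fun _ => 0) (s := Metric.ball 0 ρ)
    (ContinuousLinearMap.mul ℝ ℝ) contDiffOn_const Metric.isOpen_ball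
    (isCompact_closedBall _ _) (fun p x hp hx => ?_) ?_ ?_
  · refine this.congr fun p _ => ?_
    simp only [lineInt, convolution, ContinuousLinearMap.mul_apply']
    rw [← integral_indicator hS]
    congr 1
    ext t
    by_cases ht : t ∈ S <;> simp [ht]
  · by_contra hne
    have h1 := hR _ (subset_tsupport _ hne)
    simp only [Metric.mem_closedBall, dist_zero_right, not_le, mem_ball_zero_iff,
      Real.norm_eq_abs] at hx hp
    have h2 : ‖x • eb j‖ ≤ ‖p‖ + ‖p - x • eb j‖ := by
      rw [show x • eb j = p - (p - x • eb j) by abel]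
      exact (norm_sub_le _ _).trans (by simp)
    rw [norm_smul, norm_eb, Real.norm_eq_abs] at h2
    linarith
  · exact (locallyIntegrable_const (1 : ℝ)).indicator hS
  · refine ContDiff.contDiffOn ?_
    change ContDiff ℝ ∞ fun q : Euc d × ℝ => k (q.1 - q.2 • eb j)
    fun_prop

theorem coord_add_smul_eb (p : Euc d) (t : ℝ) (i j : Fin d) :
    (p + t • eb j) i = p i + if i = j then t else 0 := by simp

theorem continuous_line (p : Euc d) (j : Fin d) : Continuous fun t : ℝ => p + t • eb j := by
  fun_prop

/-- `k` vanishes outside the slab `|p j| ≤ R`. -/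
def SlabSupp (j : Fin d) (R : ℝ) (k : Euc d → ℝ) : Prop := ∀ p, R < |p j| → k p = 0

theorem CubeSupp.slabSupp (h : CubeSupp R k) (j : Fin d) : SlabSupp j R k := fun p hp => h p j hp

theorem SlabSupp.eq_zero_of_line (h : SlabSupp j R k) (p : Euc d) {t : ℝ}
    (ht : t ∉ Icc (-R - p j) (R - p j)) : k (p + t • eb j) = 0 := by
  refine h _ ?_
  rw [coord_add_smul_eb, if_pos rfl]
  by_contra hn
  have := abs_le.1 (not_lt.1 hn)
  exact ht ⟨by linarith, by linarith⟩

theorem SlabSupp.hasCompactSupport_line (h : SlabSupp j R k) (p : Euc d) :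
    HasCompactSupport fun t : ℝ => k (p + t • eb j) :=
  HasCompactSupport.intro isCompact_Icc fun _ ht => h.eq_zero_of_line p ht

theorem SlabSupp.integrable_line (h : SlabSupp j R k) (hk : Continuous k) (p : Euc d) :
    Integrable fun t : ℝ => k (p + t • eb j) :=
  (hk.comp (continuous_line p j)).integrable_of_hasCompactSupport (h.hasCompactSupport_line p)

theorem lineInt_add_smul_self (k : Euc d → ℝ) (p : Euc d) (s : ℝ) :
    lineInt univ j k (p + s • eb j) = lineInt univ j k p := by
  simp only [lineInt, Measure.restrict_univ]
  rw [← integral_add_left_eq_self (fun t : ℝ => k (p + t • eb j)) s]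
  congr 1
  ext t
  rw [add_smul, add_assoc]

theorem abs_lineInt_le {C : ℝ} (hS : MeasurableSet S) (h : SlabSupp j R k) (hR : 0 ≤ R)
    (hC : ∀ p, |k p| ≤ C) (p : Euc d) : |lineInt S j k p| ≤ 2 * R * C := by
  have h1 : lineInt S j k p = ∫ t in S ∩ Icc (-R - p j) (R - p j), k (p + t • eb j) := by
    rw [lineInt, setIntegral_eq_of_subset_of_forall_sdiff_eq_zero hS inter_subset_left]
    intro t ht
    exact h.eq_zero_of_line p fun hn => ht.2 ⟨ht.1, hn⟩
  have hfin : volume (S ∩ Icc (-R - p j) (R - p j)) < ⊤ :=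
    (measure_mono inter_subset_right).trans_lt (by simp)
  have h2 := norm_setIntegral_le_of_norm_le_const (f := fun t : ℝ => k (p + t • eb j)) hfin
    (fun t _ => hC (p + t • eb j))
  have hC0 : 0 ≤ C := (abs_nonneg _).trans (hC 0)
  rw [h1]
  refine h2.trans ?_
  have h3 : volume.real (S ∩ Icc (-R - p j) (R - p j)) ≤ 2 * R := by
    refine (measureReal_mono inter_subset_right (by simp)).trans ?_
    simp only [Real.volume_real_Icc]
    refine max_le (by linarith) (by linarith)
  nlinarith

theorem lineInt_sub {k k' : Euc d → ℝ} (hk : ∀ p, Integrable fun t : ℝ => k (p + t • eb j))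
    (hk' : ∀ p, Integrable fun t : ℝ => k' (p + t • eb j)) (p : Euc d) :
    lineInt S j (k - k') p = lineInt S j k p - lineInt S j k' p :=
  integral_sub (hk p).integrableOn (hk' p).integrableOn

theorem lineInt_add {k k' : Euc d → ℝ} (hk : ∀ p, Integrable fun t : ℝ => k (p + t • eb j))
    (hk' : ∀ p, Integrable fun t : ℝ => k' (p + t • eb j)) (p : Euc d) :
    lineInt S j (k + k') p = lineInt S j k p + lineInt S j k' p :=
  integral_add (hk p).integrableOn (hk' p).integrableOn

theorem lipDir_lineInt (hL : LipDir o η k) (hS : MeasurableSet S) (h : SlabSupp j R k) (hR : 0 ≤ R)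
    (hj : j ≠ o) (hk : Continuous k) : LipDir o (2 * R * η) (lineInt S j k) := by
  intro p s
  have h1 : SlabSupp j R fun q => k (q + s • eb o) := fun q hq => h _ (by simpa [hj] using hq)
  have h2 : lineInt S j k (p + s • eb o) - lineInt S j k p
      = lineInt S j ((fun q => k (q + s • eb o)) - k) p := by
    rw [lineInt_sub (fun p => h1.integrable_line (by fun_prop) p) fun p => h.integrable_line hk p]
    simp only [lineInt]
    congr 2
    ext t
    congr 1
    abel
  rw [h2, mul_assoc]
  refine abs_lineInt_le hS (fun q hq => ?_) hR (fun q => hL q s) p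
  simp [h q hq, h1 q hq]

theorem slabSupp_lineInt (h : SlabSupp i R k) (hi : i ≠ j) : SlabSupp i R (lineInt S j k) := by
  intro p hp
  have : ∀ t : ℝ, k (p + t • eb j) = 0 := fun t => h _ (by simpa [hi] using hp)
  simp [lineInt, this]

theorem lineInt_mul {g : Euc d → ℝ} (hg : ∀ p (s : ℝ), g (p + s • eb j) = g p) (p : Euc d) :
    lineInt S j (fun q => g q * k q) p = g p * lineInt S j k p := by
  simp only [lineInt, hg, integral_const_mul]

theorem lineInt_comp_coord (φ : ℝ → ℝ) (p : Euc d) :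
    lineInt univ j (fun q => φ (q j)) p = ∫ t, φ t := by
  simp only [lineInt, Measure.restrict_univ, coord_add_smul_eb, if_true]
  exact integral_add_left_eq_self φ (p j)

theorem lineInt_add_smul_of_invariant (hk : ∀ p (s : ℝ), k (p + s • eb i) = k p) (p : Euc d)
    (s : ℝ) : lineInt S j k (p + s • eb i) = lineInt S j k p := by
  simp only [lineInt]
  congr 1
  ext t
  rw [← hk (p + t • eb j) s]
  congr 1
  abel

/-- The primitive of `k` along the `j`-th direction. -/
noncomputable abbrev linePrim (j : Fin d) (k : Euc d → ℝ) : Euc d → ℝ := lineInt (Iic 0) j k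

theorem fderiv_linePrim (hk : ContDiff ℝ ∞ k) (hc : HasCompactSupport k) (h : SlabSupp j R k)
    (p : Euc d) : fderiv ℝ (linePrim j k) p (eb j) = k p := by
  have hd : Differentiable ℝ (linePrim j k) :=
    (lineInt_contDiff measurableSet_Iic hk hc).differentiable (by simp)
  have h1 : HasDerivAt (fun t : ℝ => p + t • eb j) (eb j) 0 := by
    simpa using ((hasDerivAt_id (0 : ℝ)).smul_const (eb j)).const_add p
  have h2 := (hd (p + (0 : ℝ) • eb j)).hasFDerivAt.comp_hasDerivAt (0 : ℝ) h1
  rw [zero_smul, add_zero] at h2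
  have hint := h.integrable_line hk.continuous p
  have h3 : linePrim j k ∘ (fun t : ℝ => p + t • eb j)
      = fun s => linePrim j k p + ∫ t in (0 : ℝ)..s, k (p + t • eb j) := by
    ext s
    rw [← intervalIntegral.integral_Iic_sub_Iic hint.integrableOn hint.integrableOn]
    simp only [comp_apply, linePrim, lineInt, add_sub_cancel]
    rw [← integral_indicator measurableSet_Iic, ← integral_indicator measurableSet_Iic,
      ← integral_add_left_eq_self ((Iic s).indicator fun t : ℝ => k (p + t • eb j)) s]
    congr 1
    ext t
    by_cases ht : t ≤ 0
    · rw [indicator_of_mem (by simpa using ht), indicator_of_mem (by simpa using ht), add_smul,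
        add_assoc]
    · rw [indicator_of_notMem (by simpa using ht), indicator_of_notMem (by simpa using ht)]
  have h4 : HasDerivAt (fun s => linePrim j k p + ∫ t in (0 : ℝ)..s, k (p + t • eb j)) (k p) 0 := by
    have hcont : Continuous fun t : ℝ => k (p + t • eb j) :=
      hk.continuous.comp (continuous_line p j)
    have := (hcont.integral_hasStrictDerivAt 0 0).hasDerivAt.const_add (linePrim j k p)
    simpa using this
  rw [h3] at h2
  exact h2.unique h4

theorem slabSupp_linePrim (hk : Continuous k) (h : SlabSupp j R k)
    (h0 : ∀ p, lineInt univ j k p = 0) : SlabSupp j R (linePrim j k) := by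
  intro p hp
  rcases lt_abs.1 hp with h1 | h1
  · have h2 := intervalIntegral.integral_Iic_add_Ioi
      (h.integrable_line hk p).integrableOn (h.integrable_line hk p).integrableOn (b := 0)
    have h3 : ∫ t in Ioi (0 : ℝ), k (p + t • eb j) = 0 := by
      refine setIntegral_eq_zero_of_forall_eq_zero fun t ht => h.eq_zero_of_line p fun hn => ?_
      have := hn.2
      have := mem_Ioi.1 ht
      linarith
    have h4 := h0 p
    simp only [lineInt, Measure.restrict_univ] at h4
    rw [h3, h4, add_zero] at h2
    exact h2
  · refine setIntegral_eq_zero_of_forall_eq_zero fun t ht => h.eq_zero_of_line p fun hn => ?_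
    have := hn.1
    have := mem_Iic.1 ht
    linarith

theorem cubeSupp_linePrim (hk : Continuous k) (h : CubeSupp R k)
    (h0 : ∀ p, lineInt univ j k p = 0) : CubeSupp R (linePrim j k) := by
  intro p i hi
  rcases eq_or_ne i j with rfl | hij
  · exact slabSupp_linePrim hk (h.slabSupp i) h0 p hi
  · exact slabSupp_lineInt (h.slabSupp i) hij p hi

theorem integral_eq_zero_of_lineInt_eq_zero (hk : ContDiff ℝ ∞ k) (h : CubeSupp R k)
    (h0 : ∀ p, lineInt univ j k p = 0) : ∫ p, k p = 0 := by
  have hA := cubeSupp_linePrim hk.continuous h h0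
  rw [← integral_fderiv_eq_zero (lineInt_contDiff measurableSet_Iic hk h.hasCompactSupport)
    hA.hasCompactSupport (eb j)]
  simp_rw [fderiv_linePrim hk h.hasCompactSupport (h.slabSupp j)]

theorem LipDir.mul_of_invariant {g : Euc d → ℝ} (hL : LipDir o η k)
    (hg : ∀ p (s : ℝ), g (p + s • eb o) = g p) {C : ℝ} (hC : ∀ p, |g p| ≤ C) :
    LipDir o (C * η) (fun p => g p * k p) := by
  intro p s
  simp only [hg]
  rw [← mul_sub, abs_mul, mul_assoc]
  exact mul_le_mul (hC p) (hL p s) (abs_nonneg _) ((abs_nonneg _).trans (hC p))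

end LineInt

/-! ### A standard bump function on the line -/

/-- A smooth nonnegative function on `ℝ` of integral one supported in `[-1, 1]`. -/
noncomputable def unitBump : ℝ → ℝ :=
  (⟨1 / 2, 1, by norm_num, by norm_num⟩ : ContDiffBump (0 : ℝ)).normed volume

theorem unitBump_contDiff : ContDiff ℝ ∞ unitBump := ContDiffBump.contDiff_normed _

theorem unitBump_nonneg (t : ℝ) : 0 ≤ unitBump t := ContDiffBump.nonneg_normed _ t

theorem integral_unitBump : ∫ t, unitBump t = 1 := ContDiffBump.integral_normed _

theorem unitBump_le_one (t : ℝ) : unitBump t ≤ 1 := by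
  refine (ContDiffBump.normed_le_div_measure_closedBall_rIn _ _ t).trans ?_
  simp [Real.closedBall_eq_Icc, Real.volume_real_Icc]
  norm_num

theorem abs_unitBump_le_one (t : ℝ) : |unitBump t| ≤ 1 := by
  rw [abs_of_nonneg (unitBump_nonneg t)]; exact unitBump_le_one t

theorem unitBump_eq_zero {t : ℝ} (ht : 1 ≤ |t|) : unitBump t = 0 := by
  by_contra hne
  have : t ∈ support unitBump := hne
  rw [unitBump, ContDiffBump.support_normed_eq] at this
  simp only [Metric.mem_ball, dist_zero_right, Real.norm_eq_abs] at this
  linarith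

/-! ### Compensated displacements -/

/-- A function supported in the slot `R + 1 ≤ p j ≤ R + 3` whose integrals along the `j`-th
direction are opposite to those of `k`. -/
noncomputable def compensator (j : Fin d) (R : ℝ) (k : Euc d → ℝ) (p : Euc d) : ℝ :=
  -(lineInt univ j k p * unitBump (p j - (R + 2)))

section Compensator

variable {o j : Fin d} {R η c : ℝ} {k k' r r' g u : Euc d → ℝ}

theorem compensator_contDiff (hk : ContDiff ℝ ∞ k) (hc : HasCompactSupport k) :
    ContDiff ℝ ∞ (compensator j R k) := by
  have h1 := lineInt_contDiff (j := j) MeasurableSet.univ hk hc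
  have h2 := unitBump_contDiff
  unfold compensator
  fun_prop

theorem compensator_eq_zero {p : Euc d} (hp : p j ∉ Ioo (R + 1) (R + 3)) :
    compensator j R k p = 0 := by
  have : unitBump (p j - (R + 2)) = 0 := unitBump_eq_zero <| by
    by_contra hn
    have := abs_lt.1 (not_le.1 hn)
    exact hp ⟨by linarith, by linarith⟩
  simp [compensator, this]

theorem compensator_cubeSupp (h : CubeSupp R k) (hR : 0 ≤ R) :
    CubeSupp (R + 3) (compensator j R k) := by
  intro p i hi
  rcases eq_or_ne i j with rfl | hij
  · refine compensator_eq_zero fun hn => ?_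
    rcases lt_abs.1 hi with h1 | h1
    · linarith [hn.2]
    · linarith [hn.1]
  · have := slabSupp_lineInt (S := univ) (h.slabSupp i) hij p (by linarith)
    simp [compensator, this]

theorem compensator_lipDir (hL : LipDir o η k) (h : CubeSupp R k) (hR : 0 ≤ R)
    (hj : j ≠ o) (hk : Continuous k) : LipDir o (2 * R * η) (compensator j R k) := by
  have h1 := lipDir_lineInt (S := univ) hL MeasurableSet.univ (h.slabSupp j) hR hj hk
  have h2 := (h1.mul_of_invariant (g := fun p => unitBump (p j - (R + 2)))
    (fun p s => by simp [hj]) (C := 1) fun p => abs_unitBump_le_one _).neg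
  rw [one_mul] at h2
  convert h2 using 1
  ext p
  simp [compensator, mul_comm]

theorem lineInt_compensator (p : Euc d) :
    lineInt univ j (compensator j R k) p = -lineInt univ j k p := by
  have h1 : compensator j R k = fun p => -lineInt univ j k p * unitBump (p j - (R + 2)) := by
    ext p; simp [compensator]
  rw [h1, lineInt_mul (fun p s => by rw [lineInt_add_smul_self]),
    lineInt_comp_coord (fun t => unitBump (t - (R + 2))),
    integral_sub_right_eq_self unitBump, integral_unitBump, mul_one]

theorem exists_diffeo_compensated (hk : ContDiff ℝ ∞ k) (h : CubeSupp R k) (hR : 0 ≤ R)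
    (hj : j ≠ o) (hL : LipDir o η k) (hη : η + 2 * R * η ≤ 1 / 2) (hr : ContDiff ℝ ∞ r)
    (hkr : InvPair o k r) (hg : ContDiff ℝ ∞ g) (hkg : InvPair o (compensator j R k) g) :
    ∃ Φ, IsCompSuppVolDiffeo d Φ ∧ (∀ p, Φ p o = p o + (r p + g p)) ∧
      ∀ p ∉ cube d (R + 3), Φ p = p := by
  have hk3 := compensator_contDiff (j := j) (R := R) hk h.hasCompactSupport
  have hC3 := compensator_cubeSupp (j := j) h hR
  have hC : CubeSupp (R + 3) (k + compensator j R k) := (h.mono (by linarith)).add hC3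
  have h0 : ∀ p, lineInt univ j (k + compensator j R k) p = 0 := fun p => by
    rw [lineInt_add (fun p => (h.slabSupp j).integrable_line hk.continuous p)
      (fun p => (hC3.slabSupp j).integrable_line hk3.continuous p), lineInt_compensator]
    ring
  have hA : ContDiff ℝ ∞ (linePrim j (k + compensator j R k)) :=
    lineInt_contDiff measurableSet_Iic (hk.add hk3) hC.hasCompactSupport
  have hAC := cubeSupp_linePrim (hk.add hk3).continuous hC h0
  have hder : (fun p => fderiv ℝ (linePrim j (k + compensator j R k)) p (eb j))
      = k + compensator j R k :=
    funext fun p => fderiv_linePrim (hk.add hk3) hC.hasCompactSupport (hC.slabSupp j) p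
  have hpair : InvPair o (k + compensator j R k) (r + g) := by
    refine hkr.add hkg (B := {p | |p j| ≤ R}) (B' := {p | R + 1 < p j}) (fun p s hp => ?_)
      (fun p s hp => ?_) ?_ (fun p hp => h p j (not_le.1 hp)) (fun p hp => ?_)
    · simpa [hj] using hp
    · simpa [hj] using hp
    · rw [disjoint_left]
      intro p hp hp'
      have h1 : |p j| ≤ R := hp
      have h2 : R + 1 < p j := hp'
      linarith [le_abs_self (p j)]
    · exact compensator_eq_zero fun hn => hp hn.1
  obtain ⟨Φ, h1, h2, h3⟩ := exists_diffeo_of_generating hA hAC.hasCompactSupport hj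
    (η := η + 2 * R * η) (by linarith)
    (by rw [hder]; exact hL.add (compensator_lipDir hL h hR hj hk.continuous)) (hr.add hg)
    (by rw [hder]; exact hpair)
  exact ⟨Φ, h1, h2, fun p hp => h3 p fun hn => hp (hAC.tsupport_subset hn)⟩

theorem exists_compensator_inverse (hk : ContDiff ℝ ∞ k) (h : CubeSupp R k) (hR : 0 ≤ R)
    (hj : j ≠ o) (hL : LipDir o η k) (hη : 2 * R * η < 1) :
    ∃ g, ContDiff ℝ ∞ g ∧ InvPair o (compensator j R k) g :=
  (compensator_lipDir hL h hR hj hk.continuous).exists_invPair hη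
    (compensator_contDiff hk h.hasCompactSupport)

theorem LipDir.nonneg (h : LipDir o η k) : 0 ≤ η := by
  have := (abs_nonneg _).trans (h 0 1)
  simpa using this

/-- Displacements with the same integrals along a transversal coordinate direction are
equivalent modulo one difference of transported copies of the coordinate function. -/
theorem isRep_sub_of_lineInt_eq (hu : ∀ p ∈ cube d (R + 3), u p = p o + c) (hR : 0 ≤ R)
    (hj : j ≠ o) (hη : η + 2 * R * η ≤ 1 / 2)
    (hk : ContDiff ℝ ∞ k) (h : CubeSupp R k) (hL : LipDir o η k) (hr : ContDiff ℝ ∞ r)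
    (hkr : InvPair o k r)
    (hk' : ContDiff ℝ ∞ k') (h' : CubeSupp R k') (hL' : LipDir o η k') (hr' : ContDiff ℝ ∞ r')
    (hkr' : InvPair o k' r') (heq : lineInt univ j k = lineInt univ j k') :
    IsRep u 1 (r - r') := by
  have hη0 := hL.nonneg
  obtain ⟨g, hg, hkg⟩ := exists_compensator_inverse hk h hR hj hL (by linarith)
  have hcomp : compensator j R k = compensator j R k' := by
    ext p; simp only [compensator, heq]
  obtain ⟨Φ, hΦ, hΦo, hΦi⟩ := exists_diffeo_compensated hk h hR hj hL hη hr hkr hg hkg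
  obtain ⟨Φ', hΦ', hΦo', hΦi'⟩ := exists_diffeo_compensated hk' h' hR hj hL' hη hr' hkr' hg
    (hcomp ▸ hkg)
  convert IsRep.single u hΦ hΦ' using 1
  ext p
  by_cases hp : p ∈ cube d (R + 3)
  · rw [hu _ (hΦ.mem_of_mem hΦi hp), hu _ (hΦ'.mem_of_mem hΦi' hp), hΦo, hΦo']
    simp only [Pi.sub_apply]
    ring
  · have h1 := (hkr.cubeSupp (h.mono (by linarith : R ≤ R + 3))).eq_zero hp
    have h2 := (hkr'.cubeSupp (h'.mono (by linarith : R ≤ R + 3))).eq_zero hp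
    simp [hΦi p hp, hΦi' p hp, h1, h2]

end Compensator

/-! ### Truncated rotations -/

section Rotation

variable (i j : Fin d)

/-- The infinitesimal rotation in the coordinate plane `(i, j)`. -/
noncomputable def infRot : Euc d →L[ℝ] Euc d :=
  (EuclideanSpace.proj (𝕜 := ℝ) i).smulRight (eb j)
    - (EuclideanSpace.proj (𝕜 := ℝ) j).smulRight (eb i)

/-- The rotation of angle `θ` in the coordinate plane `(i, j)`. -/
noncomputable def rot (θ : ℝ) : Euc d →L[ℝ] Euc d :=
  ContinuousLinearMap.id ℝ _ + Real.sin θ • infRot i j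
    + (1 - Real.cos θ) • (infRot i j).comp (infRot i j)

theorem infRot_apply (p : Euc d) : infRot i j p = p i • eb j - p j • eb i := by
  simp [infRot]

theorem rot_apply (θ : ℝ) (p : Euc d) : rot i j θ p
    = p + Real.sin θ • infRot i j p + (1 - Real.cos θ) • infRot i j (infRot i j p) := by
  simp [rot]

theorem inner_infRot (p q : Euc d) : inner ℝ (infRot i j p) q = -inner ℝ p (infRot i j q) := by
  simp only [infRot_apply, inner_sub_left, inner_sub_right, inner_smul_left, inner_smul_right, eb,
    EuclideanSpace.inner_single_left, EuclideanSpace.inner_single_right]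
  simp
  ring

theorem inner_self_infRot (p : Euc d) : inner ℝ p (infRot i j p) = 0 := by
  have h1 := inner_infRot i j p p
  rw [real_inner_comm] at h1
  linarith

theorem rot_zero (p : Euc d) : rot i j 0 p = p := by simp [rot_apply]

theorem inner_rot (θ : ℝ) (p q : Euc d) :
    inner ℝ (rot i j θ p) q = inner ℝ p (rot i j (-θ) q) := by
  simp only [rot_apply, inner_add_left, inner_add_right, inner_smul_left, inner_smul_right,
    inner_infRot, Real.sin_neg, Real.cos_neg]
  simp

variable {i j}

theorem infRot_cube (hij : i ≠ j) (p : Euc d) :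
    infRot i j (infRot i j (infRot i j p)) = -infRot i j p := by
  simp only [infRot_apply]
  ext k
  simp [hij, hij.symm]
  ring

theorem rot_rot (hij : i ≠ j) (α β : ℝ) (p : Euc d) :
    rot i j α (rot i j β p) = rot i j (α + β) p := by
  simp only [rot_apply, map_add, map_smul, infRot_cube hij, Real.sin_add, Real.cos_add, map_neg]
  module

theorem norm_rot (hij : i ≠ j) (θ : ℝ) (p : Euc d) : ‖rot i j θ p‖ = ‖p‖ := by
  have h : inner ℝ (rot i j θ p) (rot i j θ p) = inner ℝ p p := by
    rw [inner_rot i j, rot_rot hij, neg_add_cancel, rot_zero]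
  rw [real_inner_self_eq_norm_sq, real_inner_self_eq_norm_sq] at h
  exact (sq_eq_sq₀ (norm_nonneg _) (norm_nonneg _)).1 h

theorem abs_det_rot (hij : i ≠ j) (θ : ℝ) : |(rot i j θ).det| = 1 := by
  let f : Euc d →ₗᵢ[ℝ] Euc d := ⟨(rot i j θ : Euc d →ₗ[ℝ] Euc d), norm_rot hij θ⟩
  have := f.normDet_eq_one
  rwa [LinearMap.normDet_eq_abs_det] at this

theorem hasFDerivAt_twist (hij : i ≠ j) {θ : ℝ → ℝ} (hθ : Differentiable ℝ θ) (p : Euc d) :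
    HasFDerivAt (fun p => rot i j (θ (‖p‖ ^ 2)) p)
      ((rot i j (θ (‖p‖ ^ 2))).comp (ContinuousLinearMap.id ℝ _ +
        ((deriv θ (‖p‖ ^ 2) * 2) • innerSL ℝ p).smulRight (infRot i j p))) p := by
  have h1 : HasFDerivAt (fun p : Euc d => ‖p‖ ^ 2) (2 • innerSL ℝ p) p :=
    (hasStrictFDerivAt_norm_sq p).hasFDerivAt
  have h2 := (hθ (‖p‖ ^ 2)).hasDerivAt.comp_hasFDerivAt p h1
  have h3 : HasFDerivAt (fun p : Euc d => infRot i j p) (infRot i j) p :=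
    (infRot i j).hasFDerivAt
  have h4 : HasFDerivAt (fun p : Euc d => infRot i j (infRot i j p))
    ((infRot i j).comp (infRot i j)) p := ((infRot i j).comp (infRot i j)).hasFDerivAt
  have h5 := ((hasFDerivAt_id p).add (h2.sin.smul h3)).add
    ((h2.cos.const_sub 1).smul h4)
  have h6 : (fun p => rot i j (θ (‖p‖ ^ 2)) p) = fun p => id p
      + Real.sin ((θ ∘ fun p : Euc d => ‖p‖ ^ 2) p) • infRot i j p
      + (1 - Real.cos ((θ ∘ fun p : Euc d => ‖p‖ ^ 2) p)) • infRot i j (infRot i j p) := by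
    ext1 p; simp [rot_apply]
  rw [h6]
  refine h5.congr_fderiv ?_
  ext1 v
  have h7 := infRot_cube hij p
  simp [rot_apply, h7]
  module

/-- A rotation in a coordinate plane, truncated between two spheres. -/
theorem exists_truncated_rot (hij : i ≠ j) (α : ℝ) {r R : ℝ} (hr : 0 ≤ r)
    (hrR : r < R) :
    ∃ Φ, IsCompSuppVolDiffeo d Φ ∧ (∀ p, ‖p‖ ≤ r → Φ p = rot i j α p) ∧
      ∀ p, R ≤ ‖p‖ → Φ p = p := by
  set θ : ℝ → ℝ := fun s => α * (1 - Real.smoothTransition ((s - r ^ 2) / (R ^ 2 - r ^ 2))) with hθd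
  have hpos : 0 < R ^ 2 - r ^ 2 := by nlinarith
  have hθ : ContDiff ℝ ∞ θ := by
    have := Real.smoothTransition.contDiff (n := ⊤)
    fun_prop
  have hθ1 : ∀ p : Euc d, ‖p‖ ≤ r → θ (‖p‖ ^ 2) = α := fun p hp => by
    have : (‖p‖ ^ 2 - r ^ 2) / (R ^ 2 - r ^ 2) ≤ 0 :=
      div_nonpos_of_nonpos_of_nonneg (by nlinarith [norm_nonneg p]) hpos.le
    simp [hθd, Real.smoothTransition.zero_of_nonpos this]
  have hθ2 : ∀ p : Euc d, R ≤ ‖p‖ → θ (‖p‖ ^ 2) = 0 := fun p hp => by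
    have : 1 ≤ (‖p‖ ^ 2 - r ^ 2) / (R ^ 2 - r ^ 2) := by
      rw [one_le_div hpos]; nlinarith
    simp [hθd, Real.smoothTransition.one_of_one_le this]
  have key : ∀ θ : ℝ → ℝ, ContDiff ℝ ∞ θ → ContDiff ℝ ∞ fun p => rot i j (θ (‖p‖ ^ 2)) p := by
    intro θ hθ
    simp only [rot_apply]
    have h1 : ContDiff ℝ ∞ fun p : Euc d => ‖p‖ ^ 2 := contDiff_norm_sq ℝ
    have h2 : ContDiff ℝ ∞ fun p : Euc d => θ (‖p‖ ^ 2) := hθ.comp h1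
    fun_prop
  have hout : ∀ p : Euc d, R ≤ ‖p‖ → rot i j (θ (‖p‖ ^ 2)) p = p := fun p hp => by
    rw [hθ2 p hp, rot_zero]
  refine ⟨fun p => rot i j (θ (‖p‖ ^ 2)) p,
    .of_det (Ψ := fun p => rot i j (-θ (‖p‖ ^ 2)) p) (K := Metric.closedBall 0 R) (key θ hθ)
      (key (fun s => -θ s) hθ.neg) (fun p => ?_) (fun p => ?_) (fun p => ?_)
      (isCompact_closedBall _ _) (fun p hp => hout p ?_), fun p hp => ?_, hout⟩
  · simp only [norm_rot hij, rot_rot hij, neg_add_cancel, rot_zero]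
  · simp only [norm_rot hij, rot_rot hij, add_neg_cancel, rot_zero]
  · rw [(hasFDerivAt_twist hij (hθ.differentiable (by simp)) p).fderiv, det_clm_comp,
      det_id_add_smulRight, abs_mul, abs_det_rot hij]
    simp [inner_self_infRot]
  · simp only [Metric.mem_closedBall, dist_zero_right, not_le] at hp
    exact hp.le
  · simp only [hθ1 p hp]

end Rotation

/-! ### Linear maps extending to compactly supported diffeomorphisms -/

/-- The linear automorphisms which agree on every ball with a compactly supported
volume-preserving diffeomorphism. -/
def locExt (d : ℕ) : Subgroup (Euc d ≃L[ℝ] Euc d) where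
  carrier := {L | ∀ R : ℝ, ∃ Φ, IsCompSuppVolDiffeo d Φ ∧ ∀ p, ‖p‖ ≤ R → Φ p = L p}
  one_mem' R := ⟨fun p => p, .id, fun _ _ => rfl⟩
  mul_mem' {L L'} h h' R := by
    obtain ⟨Φ', hΦ', h1'⟩ := h' R
    obtain ⟨Φ, hΦ, h1⟩ := h (‖(L' : Euc d →L[ℝ] Euc d)‖ * R)
    refine ⟨_, hΦ.comp hΦ', fun p hp => ?_⟩
    rw [h1' p hp, h1]
    · rfl
    · exact ((L' : Euc d →L[ℝ] Euc d).le_opNorm p).trans (by gcongr)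
  inv_mem' {L} h R := by
    obtain ⟨Φ, hΦ, h1⟩ := h (‖(L.symm : Euc d →L[ℝ] Euc d)‖ * R)
    obtain ⟨Ψ, hΨ, hl, hr⟩ := hΦ.exists_inverse
    refine ⟨Ψ, hΨ, fun p hp => ?_⟩
    have h2 := h1 (L.symm p) (((L.symm : Euc d →L[ℝ] Euc d).le_opNorm p).trans (by gcongr))
    rw [L.apply_symm_apply] at h2
    conv_lhs => rw [← h2]
    exact hl _

theorem locExt_conj {L : Euc d ≃L[ℝ] Euc d} (h : L ∈ locExt d) (M : Euc d ≃L[ℝ] Euc d) :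
    M * L * M⁻¹ ∈ locExt d := by
  intro R
  obtain ⟨Φ, hΦ, h1⟩ := h (‖(M.symm : Euc d →L[ℝ] Euc d)‖ * R)
  refine ⟨_, hΦ.conj_linear M, fun p hp => ?_⟩
  have h2 : ‖M.symm p‖ ≤ ‖(M.symm : Euc d →L[ℝ] Euc d)‖ * R :=
    ((M.symm : Euc d →L[ℝ] Euc d).le_opNorm p).trans (by gcongr)
  rw [h1 _ h2]
  rfl

theorem equiv_mul_apply (L L' : Euc d ≃L[ℝ] Euc d) (p : Euc d) : (L * L') p = L (L' p) := rfl

theorem equiv_one_apply (p : Euc d) : (1 : Euc d ≃L[ℝ] Euc d) p = p := rfl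

/-- Diagonal linear automorphisms. -/
noncomputable def diagEquiv : (Fin d → ℝˣ) →* (Euc d ≃L[ℝ] Euc d) where
  toFun c := LinearEquiv.toContinuousLinearEquiv
    { toFun := fun p => WithLp.toLp 2 fun i => (c i : ℝ) * p i
      map_add' := fun p q => by ext i; simp [mul_add]
      map_smul' := fun t p => by ext i; simp; ring
      invFun := fun p => WithLp.toLp 2 fun i => ((c i)⁻¹ : ℝˣ) * p i
      left_inv := fun p => by ext i; simp
      right_inv := fun p => by ext i; simp }
  map_one' := by ext p i; simp [equiv_one_apply]
  map_mul' c c' := by ext p i; simp [mul_assoc, equiv_mul_apply]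

@[simp] theorem diagEquiv_apply (c : Fin d → ℝˣ) (p : Euc d) (i : Fin d) :
    diagEquiv c p i = c i * p i := rfl

/-- Elementary shears. -/
noncomputable def shear {o a : Fin d} (hao : a ≠ o) (t : ℝ) : Euc d ≃L[ℝ] Euc d :=
  LinearEquiv.toContinuousLinearEquiv
    { toFun := fun p => p + (t * p a) • eb o
      map_add' := fun p q => by simp; module
      map_smul' := fun s p => by simp; module
      invFun := fun p => p - (t * p a) • eb o
      left_inv := fun p => by simp [hao]
      right_inv := fun p => by simp [hao] }

@[simp] theorem shear_apply {o a : Fin d} (hao : a ≠ o) (t : ℝ) (p : Euc d) :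
    shear hao t p = p + (t * p a) • eb o := rfl

/-- The quarter turn in a coordinate plane. -/
noncomputable def quarterTurn {i j : Fin d} (hij : i ≠ j) : Euc d ≃L[ℝ] Euc d :=
  .equivOfInverse (rot i j (Real.pi / 2)) (rot i j (-(Real.pi / 2)))
    (fun p => by rw [rot_rot hij, neg_add_cancel, rot_zero])
    (fun p => by rw [rot_rot hij, add_neg_cancel, rot_zero])

theorem quarterTurn_apply {i j : Fin d} (hij : i ≠ j) (p : Euc d) :
    quarterTurn hij p = p + (-p i - p j) • eb i + (p i - p j) • eb j := by
  have : quarterTurn hij p = rot i j (Real.pi / 2) p := rfl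
  rw [this, rot_apply, infRot_apply, infRot_apply]
  ext k
  simp [hij, hij.symm]
  split_ifs <;> ring

theorem quarterTurn_mem {i j : Fin d} (hij : i ≠ j) : quarterTurn hij ∈ locExt d := by
  intro R
  obtain ⟨Φ, hΦ, h1, -⟩ := exists_truncated_rot hij (Real.pi / 2) (le_max_right R 0)
    (lt_add_one _)
  exact ⟨Φ, hΦ, fun p hp => h1 p (hp.trans (le_max_left _ _))⟩

theorem diagEquiv_mem {i j : Fin d} (hij : i ≠ j) (s : ℝˣ) :
    diagEquiv (Pi.mulSingle j s * Pi.mulSingle i s⁻¹) ∈ locExt d := by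
  have h := (locExt d).mul_mem (locExt_conj (quarterTurn_mem hij) (diagEquiv (Pi.mulSingle j s)))
    ((locExt d).inv_mem (quarterTurn_mem hij))
  convert h using 1
  rw [eq_mul_inv_iff_mul_eq, eq_mul_inv_iff_mul_eq]
  ext p k
  simp only [equiv_mul_apply, quarterTurn_apply, diagEquiv_apply]
  by_cases hki : k = i
  · subst hki
    simp [hij]
    field_simp
    ring
  · by_cases hkj : k = j
    · subst hkj
      simp [hij, hki]
    · simp [hkj, hki]

theorem shear_mem {o a : Fin d} (hao : a ≠ o) : shear hao 1 ∈ locExt d := by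
  have h := diagEquiv_mem hao.symm (Units.mk0 2 two_ne_zero)
  have h' := (locExt d).mul_mem (locExt_conj h (shear hao (4 / 3))) ((locExt d).inv_mem h)
  convert h' using 1
  rw [eq_mul_inv_iff_mul_eq, eq_mul_inv_iff_mul_eq]
  ext p k
  simp only [equiv_mul_apply, diagEquiv_apply, shear_apply]
  by_cases hk : k = o
  · subst hk
    simp [hao, equiv_mul_apply]
    ring
  · simp [hk, equiv_mul_apply]

theorem diagEquiv_update_mem (o : Fin d) (s : ℝˣ) :
    diagEquiv (Function.update (fun _ => s) o (s ^ (d - 1))⁻¹) ∈ locExt d := by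
  have h : ∏ j ∈ Finset.univ.erase o, (Pi.mulSingle j s * Pi.mulSingle o s⁻¹ : Fin d → ℝˣ)
      ∈ (locExt d).comap diagEquiv :=
    Subgroup.prod_mem _ fun j hj => diagEquiv_mem (Finset.ne_of_mem_erase hj).symm s
  rw [Subgroup.mem_comap] at h
  convert h using 2
  rw [Finset.prod_mul_distrib, Finset.prod_const, Finset.card_erase_of_mem (Finset.mem_univ _),
    Finset.card_univ, Fintype.card_fin]
  ext k
  by_cases hk : k = o
  · subst hk
    simp [Finset.prod_apply, Pi.mulSingle_apply]
  · simp [hk, Finset.prod_apply, Pi.mulSingle_apply]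

/-- If `L` extends locally to compactly supported diffeomorphisms, functions with bounded
support can be transported by `L`. -/
theorem exists_comp_eq_of_mem_locExt {L : Euc d ≃L[ℝ] Euc d} (hL : L ∈ locExt d)
    (R : ℝ) : ∃ T, IsCompSuppVolDiffeo d T ∧
      ∀ f : Euc d → ℝ, (∀ p, R < ‖p‖ → f p = 0) → ∀ p, f (T p) = f (L p) := by
  obtain ⟨S, hS, h1⟩ := (locExt d).inv_mem hL R
  obtain ⟨T, hT, hl, hr⟩ := hS.exists_inverse
  refine ⟨T, hT, fun f hf p => ?_⟩
  have key : ∀ q, ‖q‖ ≤ R → L (S q) = q := fun q hq => by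
    rw [h1 q hq]; exact L.apply_symm_apply q
  by_cases hp : ‖T p‖ ≤ R
  · rw [← key _ hp, hr p]
  · rw [hf _ (not_le.1 hp)]
    by_cases hLp : ‖L p‖ ≤ R
    · refine absurd ?_ hp
      have h2 : S (L p) = p := by rw [h1 _ hLp]; exact L.symm_apply_apply p
      rw [← h2, hl]; exact hLp
    · rw [hf _ (not_le.1 hLp)]

/-! ### Functions with equal integrals -/

/-- Concentrate `k` along the `l`-th direction without changing its line integrals. -/
noncomputable def collapse (l : Fin d) (k : Euc d → ℝ) (p : Euc d) : ℝ :=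
  unitBump (p l) * lineInt univ l k p

section Collapse

variable {o l : Fin d} {η : ℝ} {k : Euc d → ℝ}

theorem collapse_contDiff (hk : ContDiff ℝ ∞ k) (h : CubeSupp 1 k) :
    ContDiff ℝ ∞ (collapse l k) := by
  have h1 := lineInt_contDiff (j := l) MeasurableSet.univ hk h.hasCompactSupport
  have h2 := unitBump_contDiff
  unfold collapse
  fun_prop

theorem collapse_cubeSupp (h : CubeSupp 1 k) : CubeSupp 1 (collapse l k) := by
  intro p i hi
  rcases eq_or_ne i l with rfl | hil
  · simp [collapse, unitBump_eq_zero hi.le]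
  · simp [collapse, slabSupp_lineInt (S := univ) (h.slabSupp i) hil p hi]

theorem collapse_lipDir (hL : LipDir o η k) (h : CubeSupp 1 k) (hl : l ≠ o) (hk : Continuous k) :
    LipDir o (2 * η) (collapse l k) := by
  have h1 := lipDir_lineInt (S := univ) hL MeasurableSet.univ (h.slabSupp l) zero_le_one hl hk
  have h2 := h1.mul_of_invariant (g := fun p => unitBump (p l))
    (fun p s => by simp [hl]) (C := 1) fun p => abs_unitBump_le_one _
  rw [one_mul, mul_one] at h2
  exact h2

theorem lineInt_collapse : lineInt univ l (collapse l k) = lineInt univ l k := by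
  ext p
  have h1 : collapse l k = fun p => lineInt univ l k p * unitBump (p l) := by
    ext p; simp [collapse, mul_comm]
  rw [h1, lineInt_mul (fun p s => by rw [lineInt_add_smul_self]), lineInt_comp_coord,
    integral_unitBump, mul_one]

theorem integral_eq_of_lineInt_eq {k k' : Euc d → ℝ} (hk : ContDiff ℝ ∞ k) (h : CubeSupp 1 k)
    (hk' : ContDiff ℝ ∞ k') (h' : CubeSupp 1 k') (heq : lineInt univ l k = lineInt univ l k') :
    ∫ p, k p = ∫ p, k' p := by
  have hs : ContDiff ℝ ∞ (k - k') := hk.sub hk'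
  have h0 := integral_eq_zero_of_lineInt_eq_zero (j := l) hs (h.sub h') fun p => by
    rw [lineInt_sub (fun p => (h.slabSupp l).integrable_line hk.continuous p)
      (fun p => (h'.slabSupp l).integrable_line hk'.continuous p), heq, sub_self]
  have h1 := integral_sub (μ := (volume : Measure (Euc d)))
    (hk.continuous.integrable_of_hasCompactSupport h.hasCompactSupport)
    (hk'.continuous.integrable_of_hasCompactSupport h'.hasCompactSupport)
  simp only [Pi.sub_apply] at h0
  linarith

theorem integral_collapse (hk : ContDiff ℝ ∞ k) (h : CubeSupp 1 k) :
    ∫ p, collapse l k p = ∫ p, k p :=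
  integral_eq_of_lineInt_eq (collapse_contDiff hk h) (collapse_cubeSupp h) hk h lineInt_collapse

end Collapse

/-- The normalized product bump. -/
noncomputable def prodBump (p : Euc d) : ℝ := ∏ i, unitBump (p i)

theorem integral_prodBump : ∫ p : Euc d, prodBump p = 1 := by
  rw [← (EuclideanSpace.volume_preserving_symm_measurableEquiv_toLp (Fin d)).symm.integral_comp']
  have := integral_fintype_prod_volume_eq_prod (ι := Fin d) (E := fun _ => ℝ)
    (fun _ t => unitBump t)
  simpa [prodBump, integral_unitBump] using this

theorem eq_apply_zero_of_invariant {g : Euc d → ℝ}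
    (hg : ∀ i p (s : ℝ), g (p + s • eb i) = g p) (p : Euc d) : g p = g 0 := by
  have h : ∀ S : Finset (Fin d), g (∑ i ∈ S, p i • eb i) = g 0 := by
    intro S
    induction S using Finset.induction_on with
    | empty => simp
    | insert i S hi ih => rw [Finset.sum_insert hi, add_comm, hg, ih]
  rw [← h Finset.univ]
  congr 1
  ext k
  simp

/-- Concentrate a displacement along the directions of `S`. -/
theorem exists_collapse {o : Fin d} {u k r : Euc d → ℝ} {c η : ℝ}
    (hu : ∀ p ∈ cube d 4, u p = p o + c) (hk : ContDiff ℝ ∞ k) (h : CubeSupp 1 k)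
    (hL : LipDir o η k) (hη : 6 * 2 ^ d * η ≤ 1) (hr : ContDiff ℝ ∞ r) (hkr : InvPair o k r)
    (S : Finset (Fin d)) (hS : o ∉ S) :
    ∃ k' r', ContDiff ℝ ∞ k' ∧ ContDiff ℝ ∞ r' ∧ CubeSupp 1 k' ∧ LipDir o (2 ^ S.card * η) k' ∧
      InvPair o k' r' ∧ ∫ p, k' p = ∫ p, k p ∧ IsRep u S.card (r - r') ∧
      ∃ g : Euc d → ℝ, (∀ l ∈ S, ∀ p (s : ℝ), g (p + s • eb l) = g p) ∧
        ∀ p, k' p = (∏ l ∈ S, unitBump (p l)) * g p := by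
  induction S using Finset.induction_on with
  | empty =>
    exact ⟨k, r, hk, hr, h, by simpa using hL, hkr, rfl, by simpa using IsRep.zero u 0, k,
      by simp, by simp⟩
  | insert l S hl ih =>
    simp only [Finset.mem_insert, not_or] at hS
    obtain ⟨k', r', hk', hr', h', hL', hkr', hI, hrep, g, hg, hkg⟩ := ih hS.2
    have hcard : S.card + 1 ≤ d := by
      simpa [Finset.card_insert_of_notMem hl] using Finset.card_le_univ (insert l S)
    have hη0 := hL.nonneg
    have hpow : (2 : ℝ) ^ (S.card + 1) ≤ 2 ^ d := pow_le_pow_right₀ one_le_two hcard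
    have hη2 : 6 * (2 ^ (S.card + 1) * η) ≤ 1 := by nlinarith
    have hL2 := collapse_lipDir hL' h' (Ne.symm hS.1) hk'.continuous
    have h2 := collapse_cubeSupp (l := l) h'
    have hk2 := collapse_contDiff (l := l) hk' h'
    rw [← mul_assoc, ← pow_succ'] at hL2
    have hpos : 0 ≤ 2 ^ S.card * η := by positivity
    obtain ⟨r'', hr'', hkr''⟩ := hL2.exists_invPair (by linarith) hk2
    have hrep' : IsRep u 1 (r' - r'') :=
      isRep_sub_of_lineInt_eq (R := 1) (c := c) (fun p hp => hu p (by norm_num at hp; exact hp))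
        zero_le_one (Ne.symm hS.1)
        (η := 2 ^ (S.card + 1) * η) (by linarith) hk' h' (hL'.mono (by rw [pow_succ]; linarith))
        hr' hkr' hk2 h2 hL2 hr'' hkr'' lineInt_collapse.symm
    rw [Finset.card_insert_of_notMem hl]
    refine ⟨collapse l k', r'', hk2, hr'', h2, hL2, hkr'', by rw [integral_collapse hk' h', hI],
      by simpa using hrep.add hrep', lineInt univ l g, ?_, fun p => ?_⟩
    · intro i hi p s
      rcases Finset.mem_insert.1 hi with rfl | hi
      · rw [lineInt_add_smul_self]
      · exact lineInt_add_smul_of_invariant (hg i hi) p s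
    · have h3 : k' = fun p => (∏ l ∈ S, unitBump (p l)) * g p := funext hkg
      rw [collapse, h3, lineInt_mul, Finset.prod_insert hl, mul_assoc]
      intro p s
      refine Finset.prod_congr rfl fun i hi => ?_
      have : i ≠ l := fun hil => hl (hil ▸ hi)
      simp [this]

theorem abs_le_of_lipDir {o : Fin d} {k : Euc d → ℝ} {η : ℝ} (hL : LipDir o η k)
    (h : CubeSupp 1 k) (p : Euc d) : |k p| ≤ 3 * η := by
  have hη := hL.nonneg
  by_cases hp : p ∈ cube d 1
  · have h1 := hL p 3
    have h2 := abs_le.1 (hp o)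
    rw [h _ o (by simp; rw [abs_of_nonneg] <;> linarith)] at h1
    simp at h1
    linarith
  · rw [h.eq_zero hp]; simpa using by positivity

/-- A displacement whose opposite and image under the unit shear are realized. -/
theorem isRep_of_shear_generating {o a : Fin d} (hao : a ≠ o) {u B r : Euc d → ℝ} {c η : ℝ}
    (hu : ∀ p ∈ cube d 8, u p = p o + c) (hB : ContDiff ℝ ∞ B) (hBC : CubeSupp 4 B)
    (hη : η < 1) (hL : LipDir o η fun p => fderiv ℝ B p (eb o + eb a)) (hr : ContDiff ℝ ∞ r)
    (hkr : InvPair o (fun p => fderiv ℝ B p (eb o + eb a)) r) (hrC : CubeSupp 4 r) :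
    IsRep u 1 r := by
  set τ := shear hao 1 with hτ
  have hτo : τ (eb o) = eb o := by simp [hτ, hao]
  have hτa : τ (eb a) = eb o + eb a := by simp [hτ, add_comm]
  have hA : ContDiff ℝ ∞ (fun p => B (τ p)) := hB.comp τ.contDiff
  have hAC : CubeSupp 8 (fun p => B (τ p)) := by
    intro p i hi
    by_cases hpa : |p a| ≤ 4
    · refine hBC _ i ?_
      by_cases hio : i = o
      · subst hio
        have h1 : |p i| ≤ |(τ p) i| + |p a| := by
          have h2 : p i = (τ p) i - p a := by simp [hτ]
          conv_lhs => rw [h2]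
          exact abs_sub _ _
        linarith
      · simp [hτ, hio]; linarith
    · refine hBC _ a ?_
      simp [hτ, hao]; linarith
  have hder : (fun p => fderiv ℝ (fun p => B (τ p)) p (eb a))
      = fun p => fderiv ℝ B (τ p) (eb o + eb a) := by
    ext p
    have h1 : HasFDerivAt (fun p => B (τ p)) ((fderiv ℝ B (τ p)).comp (τ : Euc d →L[ℝ] Euc d)) p :=
      ((hB.differentiable (by simp)).differentiableAt.hasFDerivAt).comp p τ.hasFDerivAt
    rw [h1.fderiv]
    simp [hτa]
  obtain ⟨Φ, hΦ, hΦo, hΦi⟩ := exists_diffeo_of_generating hA hAC.hasCompactSupport hao hη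
    (r := fun p => r (τ p))
    (by
      rw [hder]; intro p s
      simp only [map_add τ, map_smul τ, hτo]
      exact hL (τ p) s)
    (hr.comp τ.contDiff) (by rw [hder]; exact hkr.comp_linear (τ : Euc d →L[ℝ] Euc d) hτo)
  have hΦc : ∀ p ∉ cube d 8, Φ p = p := fun p hp => hΦi p fun hn => hp (hAC.tsupport_subset hn)
  have hrep : IsRep u 1 fun p => r (τ p) := by
    convert IsRep.single u hΦ .id using 1
    ext p
    by_cases hp : p ∈ cube d 8
    · rw [hu _ (hΦ.mem_of_mem hΦc hp), hu _ hp, hΦo]; ring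
    · have h1 := hΦo p
      rw [hΦc p hp] at h1 ⊢
      linarith
  have hbdd : ∃ R, ∀ p, R < ‖p‖ → r (τ p) = 0 := by
    obtain ⟨R, hR⟩ := ((isCompact_cube (d := d) 4).isBounded.image
      (τ.symm : Euc d →L[ℝ] Euc d)).exists_norm_le
    refine ⟨R, fun p hp => hrC.eq_zero fun hn => hp.not_ge (hR _ ⟨τ p, hn, ?_⟩)⟩
    exact τ.symm_apply_apply p
  obtain ⟨R, hR⟩ := hbdd
  obtain ⟨T, hT, hTf⟩ := exists_comp_eq_of_mem_locExt ((locExt d).inv_mem (shear_mem hao)) R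
  convert hrep.comp hT using 1
  ext p
  rw [hTf (fun p => r (τ p)) hR]
  exact congrArg r (τ.apply_symm_apply p).symm

theorem exists_lipschitz_unitBump :
    ∃ C : ℝ, 0 ≤ C ∧ ∀ s t, |unitBump s - unitBump t| ≤ C * |s - t| := by
  have hc : HasCompactSupport unitBump := HasCompactSupport.of_support_subset_isCompact
    (isCompact_Icc (a := -1) (b := 1)) fun t ht => by
      by_contra hn
      refine ht (unitBump_eq_zero ?_)
      by_contra h1
      exact hn (abs_le.1 (not_le.1 h1).le)
  obtain ⟨C, hC⟩ := unitBump_contDiff.lipschitzWith_of_hasCompactSupport hc (by simp)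
  exact ⟨C, C.2, fun s t => by simpa [Real.dist_eq] using hC.dist_le_mul s t⟩

theorem lineInt_compensator_eq_zero {o a : Fin d} (hao : a ≠ o) {K g : Euc d → ℝ}
    (hK : ContDiff ℝ ∞ K) (h : CubeSupp 1 K) (hI : ∫ p, K p = 0)
    (hg : ∀ l ∈ Finset.univ \ {o, a}, ∀ p (s : ℝ), g (p + s • eb l) = g p)
    (hKg : ∀ p, K p = (∏ l ∈ Finset.univ \ {o, a}, unitBump (p l)) * g p) (p : Euc d) :
    lineInt univ o (compensator a 1 K) p = 0 := by
  set S : Finset (Fin d) := Finset.univ \ {o, a} with hS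
  have hprod : ∀ i ∉ S, ∀ (p : Euc d) (s : ℝ),
      ∏ l ∈ S, unitBump ((p + s • eb i) l) = ∏ l ∈ S, unitBump (p l) := by
    intro i hi p s
    refine Finset.prod_congr rfl fun l hl => ?_
    have : l ≠ i := fun hil => hi (hil ▸ hl)
    simp [this]
  have ho : o ∉ S := by simp [hS]
  have ha : a ∉ S := by simp [hS]
  have h1 : ∀ p, lineInt univ a K p = (∏ l ∈ S, unitBump (p l)) * lineInt univ a g p := by
    intro p
    have : K = fun p => (∏ l ∈ S, unitBump (p l)) * g p := funext hKg
    rw [this, lineInt_mul (hprod a ha)]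
  set G := lineInt univ o (lineInt univ a g) with hG
  have hinv : ∀ i p (s : ℝ), G (p + s • eb i) = G p := by
    intro i p s
    by_cases hio : i = o
    · subst hio; rw [hG, lineInt_add_smul_self]
    · refine lineInt_add_smul_of_invariant (fun p s => ?_) p s
      by_cases hia : i = a
      · subst hia; rw [lineInt_add_smul_self]
      · exact lineInt_add_smul_of_invariant (hg i (by simp [hS, hio, hia])) p s
  have hconst := eq_apply_zero_of_invariant hinv
  have hc1 : collapse a K = fun p => (unitBump (p a) * ∏ l ∈ S, unitBump (p l)) *
      lineInt univ a g p := by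
    ext p; rw [collapse, h1, mul_assoc]
  have hcc : collapse o (collapse a K) = fun p => G 0 * prodBump p := by
    ext p
    rw [collapse, hc1, lineInt_mul, ← hG, hconst p, prodBump,
      ← Finset.prod_sdiff (Finset.subset_univ {o, a}), ← hS, Finset.prod_pair hao.symm]
    · ring
    · intro p s
      rw [hprod o ho]; simp [hao]
  have hz : G 0 = 0 := by
    have h2 := integral_collapse (l := o) (collapse_contDiff (l := a) hK h) (collapse_cubeSupp h)
    rw [integral_collapse hK h, hI, hcc, integral_const_mul, integral_prodBump, mul_one] at h2
    exact h2
  have hm : compensator a 1 K = fun p => (-(∏ l ∈ S, unitBump (p l)) * unitBump (p a - (1 + 2))) *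
      lineInt univ a g p := by
    ext p; rw [compensator, h1]; ring
  rw [hm, lineInt_mul, ← hG, hconst p, hz, mul_zero]
  intro p s
  rw [hprod o ho]; simp [hao]

theorem exists_isRep_of_prod_form {o a : Fin d} (hao : a ≠ o) : ∃ C : ℝ, 0 < C ∧
    ∀ (u k k' r r' g g' : Euc d → ℝ) (c η : ℝ), (∀ p ∈ cube d 8, u p = p o + c) →
      ContDiff ℝ ∞ k → ContDiff ℝ ∞ k' → ContDiff ℝ ∞ r → ContDiff ℝ ∞ r' →
      CubeSupp 1 k → CubeSupp 1 k' → LipDir o η k → LipDir o η k' → C * η ≤ 1 →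
      InvPair o k r → InvPair o k' r' → ∫ p, k p = ∫ p, k' p →
      (∀ l ∈ Finset.univ \ {o, a}, ∀ p (s : ℝ), g (p + s • eb l) = g p) →
      (∀ l ∈ Finset.univ \ {o, a}, ∀ p (s : ℝ), g' (p + s • eb l) = g' p) →
      (∀ p, k p = (∏ l ∈ Finset.univ \ {o, a}, unitBump (p l)) * g p) →
      (∀ p, k' p = (∏ l ∈ Finset.univ \ {o, a}, unitBump (p l)) * g' p) →
      IsRep u 2 (r - r') := by
  obtain ⟨C₁, hC₁, hlip⟩ := exists_lipschitz_unitBump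
  refine ⟨100 + 300 * C₁, by positivity, ?_⟩
  intro u k k' r r' g g' c η hu hk hk' hr hr' h h' hL hL' hη hkr hkr' hI hg hg' hkg hkg'
  have hη0 := hL.nonneg
  have hη1 : 100 * η + 300 * (C₁ * η) ≤ 1 := by linarith
  have hCη : 0 ≤ C₁ * η := by positivity
  set K := k' - k with hKd
  have hK : ContDiff ℝ ∞ K := hk'.sub hk
  have hKC : CubeSupp 1 K := h'.sub h
  have hKL : LipDir o (2 * η) K := by rw [two_mul]; exact hL'.sub hL
  have hKI : ∫ p, K p = 0 := by
    have h1 := integral_sub (μ := (volume : Measure (Euc d)))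
      (hk'.continuous.integrable_of_hasCompactSupport h'.hasCompactSupport)
      (hk.continuous.integrable_of_hasCompactSupport h.hasCompactSupport)
    rw [hI, sub_self] at h1
    exact h1
  set m := compensator a 1 K with hm
  have hmS : ContDiff ℝ ∞ m := compensator_contDiff hK hKC.hasCompactSupport
  have hmC : CubeSupp 4 m := by
    have := compensator_cubeSupp (j := a) hKC zero_le_one
    norm_num at this; exact this
  have hmL : LipDir o (4 * η) m := by
    have := compensator_lipDir hKL hKC zero_le_one hao hK.continuous
    exact this.mono (by linarith)
  have hm0 : ∀ p, lineInt univ o m p = 0 := by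
    refine lineInt_compensator_eq_zero hao hK hKC hKI (g := g' - g) (fun l hl p s => ?_)
      fun p => ?_
    · simp [hg l hl p s, hg' l hl p s]
    · simp only [hKd, Pi.sub_apply, hkg, hkg']; ring
  have hmLa : LipDir a (12 * (C₁ * η)) m := by
    have h1 : LipDir a C₁ fun p : Euc d => unitBump (p a - (1 + 2)) := fun p s => by
      have := hlip ((p + s • eb a) a - (1 + 2)) (p a - (1 + 2))
      simpa using this
    have h2 := h1.mul_of_invariant (g := fun p => - lineInt univ a K p)
      (fun p s => by rw [lineInt_add_smul_self]) (C := 12 * η) fun p => by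
        rw [abs_neg]
        exact (abs_lineInt_le MeasurableSet.univ (hKC.slabSupp a) zero_le_one
          (abs_le_of_lipDir hKL hKC) p).trans (by linarith)
    convert h2 using 1
    · ring
    · ext p; simp [hm, compensator]
  set B := linePrim o m with hB
  have hBS : ContDiff ℝ ∞ B := lineInt_contDiff measurableSet_Iic hmS hmC.hasCompactSupport
  have hBC : CubeSupp 4 B := cubeSupp_linePrim hmS.continuous hmC hm0
  have hBo : (fun p => fderiv ℝ B p (eb o)) = m :=
    funext fun p => fderiv_linePrim hmS hmC.hasCompactSupport (hmC.slabSupp o) p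
  have hBaS : ContDiff ℝ ∞ fun p => fderiv ℝ B p (eb a) := hBS.fderiv_const_apply _
  have hBaL : LipDir o (12 * (C₁ * η)) fun p => fderiv ℝ B p (eb a) := by
    refine .of_fderiv (hBaS.differentiable (by simp)) fun p => ?_
    rw [fderiv_fderiv_apply_comm hBS, hBo]
    exact hmLa.abs_fderiv_le (hmS.differentiable (by simp)) p
  have hBz : ∀ p : Euc d, p a < 2 → B p = 0 := by
    intro p hp
    have : ∀ t : ℝ, m (p + t • eb o) = 0 := fun t =>
      compensator_eq_zero fun hn => by
        have := hn.1
        simp [hao] at this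
        linarith
    simp [hB, linePrim, lineInt, this]
  have hdz : ∀ p : Euc d, p a < 2 → fderiv ℝ B p = 0 := by
    intro p hp
    have ho : {q : Euc d | q a < 2} ∈ 𝓝 p :=
      (isOpen_lt (by fun_prop) continuous_const).mem_nhds hp
    have : B =ᶠ[𝓝 p] fun _ => 0 := by
      filter_upwards [ho] with q hq using hBz q hq
    rw [this.fderiv_eq]; simp
  have hdC : ∀ p ∉ tsupport B, fderiv ℝ B p = 0 := fun p hp => by
    by_contra hn
    exact hp (support_fderiv_subset ℝ hn)
  set b := fun p => fderiv ℝ B p (eb o + eb a) with hb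
  have hb' : b = m + fun p => fderiv ℝ B p (eb a) := by
    rw [← hBo]; ext p; simp [hb]
  have hbS : ContDiff ℝ ∞ b := hBS.fderiv_const_apply _
  have hbC : CubeSupp 4 b := fun p i hi => by
    have : p ∉ tsupport B := fun hn => (hBC.tsupport_subset hn i).not_gt hi
    simp [hb, hdC p this]
  have hbL : LipDir o (4 * η + 12 * (C₁ * η)) b := by rw [hb']; exact hmL.add hBaL
  obtain ⟨q, hqS, hbq⟩ := hbL.exists_invPair (by linarith) hbS
  have hq : IsRep u 1 q :=
    isRep_of_shear_generating hao hu hBS hBC (by linarith) hbL hqS hbq (hbq.cubeSupp hbC)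
  have hpair : InvPair o (k' + b) (r' + q) := by
    refine hkr'.add hbq (B := {p | |p a| ≤ 1}) (B' := {p | 3 / 2 < p a}) (fun p s hp => ?_)
      (fun p s hp => ?_) ?_ (fun p hp => h' p a (not_le.1 hp)) (fun p hp => ?_)
    · simpa [hao] using hp
    · simpa [hao] using hp
    · rw [disjoint_left]
      intro p hp hp'
      have h1 : |p a| ≤ 1 := hp
      have h2 : 3 / 2 < p a := hp'
      linarith [le_abs_self (p a)]
    · have h1 : p a ≤ 3 / 2 := not_lt.1 hp
      simp [hb, hdz p (by linarith)]
  have hda0 : ∀ p, lineInt univ a (fun p => fderiv ℝ B p (eb a)) p = 0 := by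
    intro p
    rw [lineInt, Measure.restrict_univ]
    refine integral_eq_zero_of_hasDerivAt_of_integrable (f := fun t : ℝ => B (p + t • eb a))
      (fun t => ?_) ?_ ((hBC.slabSupp a).integrable_line hBS.continuous p)
    · have h1 : HasDerivAt (fun t : ℝ => p + t • eb a) (eb a) t := by
        simpa using ((hasDerivAt_id t).smul_const (eb a)).const_add p
      exact ((hBS.differentiable (by simp)).differentiableAt.hasFDerivAt).comp_hasDerivAt t h1
    · refine SlabSupp.integrable_line (R := 4) (fun p hp => ?_) hBaS.continuous p
      have : p ∉ tsupport B := fun hn => (hBC.tsupport_subset hn a).not_gt hp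
      simp [hdC p this]
  have hline : lineInt univ a k = lineInt univ a (k' + b) := by
    ext p
    have hi := fun p => (h.slabSupp a).integrable_line hk.continuous p
    have hi' := fun p => (h'.slabSupp a).integrable_line hk'.continuous p
    have hib := fun p => (hbC.slabSupp a).integrable_line hbS.continuous p
    have him := fun p => (hmC.slabSupp a).integrable_line hmS.continuous p
    have hbm : b - m = fun p => fderiv ℝ B p (eb a) := by rw [hb']; simp
    have h1 := lineInt_sub (S := univ) hib him p
    rw [hbm, hda0, lineInt_compensator, hKd, lineInt_sub hi' hi] at h1
    rw [lineInt_add hi' hib]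
    linarith
  have hrep : IsRep u 1 (r - (r' + q)) := by
    refine isRep_sub_of_lineInt_eq (R := 4) (η := 5 * η + 12 * (C₁ * η)) (c := c)
      (fun p hp => hu p fun i => (hp i).trans (by norm_num)) (by norm_num) hao (by linarith)
      hk (h.mono (by norm_num)) (hL.mono (by linarith)) hr hkr (hk'.add hbS)
      ((h'.mono (by norm_num)).add hbC) ((hL'.add hbL).mono (by linarith)) (hr'.add hqS)
      hpair hline
  convert hrep.add hq using 1
  abel

/-- Small functions with equal integrals are equivalent, if `u` is a coordinate near the origin. -/
theorem exists_isRep_sub_of_integral_eq {o a : Fin d} (hao : a ≠ o) : ∃ η : ℝ, 0 < η ∧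
    ∀ (u F F' : Euc d → ℝ) (c : ℝ), (∀ p ∈ cube d 8, u p = p o + c) →
      ContDiff ℝ ∞ F → ContDiff ℝ ∞ F' → CubeSupp 1 F → CubeSupp 1 F' →
      LipDir o η F → LipDir o η F' → ∫ p, F p = ∫ p, F' p → IsRep u (2 * d + 2) (F - F') := by
  obtain ⟨C, hC, key⟩ := exists_isRep_of_prod_form hao
  have hp : (0 : ℝ) < 2 ^ d := by positivity
  have h1p : (1 : ℝ) ≤ 2 ^ d := one_le_pow₀ one_le_two
  obtain ⟨η, hη0, hη6, hηC⟩ : ∃ η : ℝ, 0 < η ∧ 12 * 2 ^ d * η ≤ 1 ∧ 2 * C * 2 ^ d * η ≤ 1 := by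
    refine ⟨1 / (12 * 2 ^ d + 2 * C * 2 ^ d), by positivity, ?_, ?_⟩
    · rw [mul_one_div]
      exact div_le_one_of_le₀ (le_add_of_nonneg_right (by positivity)) (by positivity)
    · rw [mul_one_div]
      exact div_le_one_of_le₀ (le_add_of_nonneg_left (by positivity)) (by positivity)
  have hη12 : 12 * η ≤ 1 := by nlinarith
  refine ⟨η, hη0, fun u F F' c hu hF hF' h h' hL hL' hI => ?_⟩
  obtain ⟨k, hk, hFk⟩ := hL.exists_invPair (by linarith) hF
  obtain ⟨k', hk', hFk'⟩ := hL'.exists_invPair (by linarith) hF'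
  have hkL := hFk.lipDir hL (by linarith)
  have hkL' := hFk'.lipDir hL' (by linarith)
  have hkI := hFk.integral_eq_neg hL (by linarith) hF h.hasCompactSupport
  have hkI' := hFk'.integral_eq_neg hL' (by linarith) hF' h'.hasCompactSupport
  set S : Finset (Fin d) := Finset.univ \ {o, a} with hS
  have hu4 : ∀ p ∈ cube d 4, u p = p o + c := fun p hp =>
    hu p fun i => (hp i).trans (by norm_num)
  have hScard : S.card ≤ d := by simpa using Finset.card_le_univ S
  have hpow : (2 : ℝ) ^ S.card ≤ 2 ^ d := pow_le_pow_right₀ one_le_two hScard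
  obtain ⟨k₁, r₁, hk₁, hr₁, hC₁, hL₁, hkr₁, hI₁, hrep₁, g₁, hg₁, hkg₁⟩ :=
    exists_collapse hu4 hk (hFk.cubeSupp h) hkL (by linarith) hF hFk.symm S (by simp [hS])
  obtain ⟨k₂, r₂, hk₂, hr₂, hC₂, hL₂, hkr₂, hI₂, hrep₂, g₂, hg₂, hkg₂⟩ :=
    exists_collapse hu4 hk' (hFk'.cubeSupp h') hkL' (by linarith) hF' hFk'.symm S (by simp [hS])
  have hmid : IsRep u 2 (r₁ - r₂) := key u k₁ k₂ r₁ r₂ g₁ g₂ c (2 ^ S.card * (2 * η)) hu hk₁ hk₂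
    hr₁ hr₂ hC₁ hC₂ hL₁ hL₂ (by
      have : C * (2 ^ S.card * (2 * η)) ≤ C * (2 ^ d * (2 * η)) := by gcongr
      linarith) hkr₁ hkr₂ (by rw [hI₁, hI₂, hkI, hkI', hI]) hg₁ hg₂ hkg₁ hkg₂
  have := ((hrep₁.add hmid).sub hrep₂).mono (M := 2 * d + 2) (by omega)
  convert this using 1
  abel

/-! ### Rearrangement of lattice balls -/

/-- The points of the cubic lattice of mesh `K`. -/
noncomputable def lat (K : ℝ) (q : Fin d → ℤ) : Euc d := WithLp.toLp 2 fun i => K * q i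

@[simp] theorem lat_apply (K : ℝ) (q : Fin d → ℤ) (i : Fin d) : lat K q i = K * q i := rfl

theorem lat_add_single (K : ℝ) (q : Fin d → ℤ) (i : Fin d) :
    lat K (q + Pi.single i 1) = lat K q + K • eb i := by
  ext l
  by_cases hl : l = i
  · subst hl; simp [mul_add]
  · simp [hl]

theorem abs_coord_le_norm (p : Euc d) (i : Fin d) : |p i| ≤ ‖p‖ := by
  simpa using PiLp.norm_apply_le p i

theorem le_norm_lat_sub {K : ℝ} (hK : 0 ≤ K) {q q' : Fin d → ℤ} (h : q ≠ q') :
    K ≤ ‖lat K q - lat K q'‖ := by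
  obtain ⟨i, hi⟩ := Function.ne_iff.1 h
  refine le_trans ?_ (abs_coord_le_norm _ i)
  have h1 : (lat K q - lat K q') i = K * ((q i - q' i : ℤ) : ℝ) := by simp [mul_sub]
  rw [h1, abs_mul, abs_of_nonneg hK]
  have h2 : (1 : ℝ) ≤ |((q i - q' i : ℤ) : ℝ)| := by
    exact_mod_cast Int.one_le_abs (sub_ne_zero.2 hi)
  nlinarith

theorem sq_add_sq_le_norm_sq (p : Euc d) {i l : Fin d} (h : i ≠ l) :
    p i ^ 2 + p l ^ 2 ≤ ‖p‖ ^ 2 := by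
  rw [EuclideanSpace.real_norm_sq_eq, ← Finset.sum_pair (f := fun i => p i ^ 2) h]
  exact Finset.sum_le_sum_of_subset_of_nonneg (Finset.subset_univ _) fun _ _ _ => sq_nonneg _

theorem le_norm_sq_lat_sub_midpoint {K : ℝ} {q s : Fin d → ℤ} {i : Fin d}
    (h : s ≠ q) (h' : s ≠ q + Pi.single i 1) :
    5 / 4 * K ^ 2 ≤ ‖lat K s - (lat K q + (K / 2) • eb i)‖ ^ 2 := by
  set p := lat K s - (lat K q + (K / 2) • eb i) with hp
  have hi : p i = K * ((s i - q i : ℤ) - 1 / 2) := by simp [hp]; ring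
  have hint : ∀ n : ℤ, (1 : ℝ) / 4 ≤ ((n : ℝ) - 1 / 2) ^ 2 := fun n => by
    have : (0 : ℤ) ≤ n * (n - 1) := by
      rcases le_or_gt n 0 with h | h <;> nlinarith
    have : (0 : ℝ) ≤ n * (n - 1) := by exact_mod_cast this
    nlinarith
  have hK2 := sq_nonneg K
  by_cases hl : ∃ l, l ≠ i ∧ s l ≠ q l
  · obtain ⟨l, hli, hl⟩ := hl
    have h1 := sq_add_sq_le_norm_sq p hli.symm
    have h2 : p l = K * (s l - q l : ℤ) := by simp [hp, hli]; ring
    have h3 : (1 : ℝ) ≤ ((s l - q l : ℤ) : ℝ) ^ 2 := by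
      have : (1 : ℤ) ≤ (s l - q l) ^ 2 := by
        have := Int.one_le_abs (sub_ne_zero.2 hl)
        rw [← sq_abs]; nlinarith
      exact_mod_cast this
    rw [hi, h2, mul_pow, mul_pow] at h1
    nlinarith [hint (s i - q i)]
  · push Not at hl
    have h1 : s i ≠ q i := fun hn => h (funext fun l => by
      by_cases hli : l = i
      · rw [hli, hn]
      · exact hl l hli)
    have h2 : s i ≠ q i + 1 := fun hn => h' (funext fun l => by
      by_cases hli : l = i
      · subst hli; simp [hn]
      · simp [hli, hl l hli])
    have h3 : (2 : ℤ) ≤ (s i - q i) * (s i - q i - 1) := by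
      rcases lt_or_gt_of_ne h1 with h3 | h3
      · nlinarith
      · have : q i + 2 ≤ s i := by omega
        nlinarith
    have h4 : (2 : ℝ) ≤ ((s i - q i : ℤ) : ℝ) * ((s i - q i : ℤ) - 1) := by exact_mod_cast h3
    have h5 := abs_coord_le_norm p i
    have h6 : p i ^ 2 ≤ ‖p‖ ^ 2 := by
      rw [← sq_abs]; gcongr
    rw [hi, mul_pow] at h6
    nlinarith

/-- A truncated half turn around an arbitrary centre. -/
theorem exists_half_turn {i j : Fin d} (hij : i ≠ j) (c : Euc d) {r R : ℝ} (hr : 0 ≤ r)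
    (hrR : r < R) : ∃ Φ, IsCompSuppVolDiffeo d Φ ∧
      (∀ w, ‖w‖ ≤ r → Φ (c + w) = c + rot i j Real.pi w) ∧
      ∀ p, R ≤ ‖p - c‖ → Φ p = p := by
  obtain ⟨Φ, hΦ, h1, h2⟩ := exists_truncated_rot hij Real.pi hr hrR
  refine ⟨_, hΦ.conj_translate c, fun w hw => ?_, fun p hp => ?_⟩
  · simp only [add_sub_cancel_left]
    rw [h1 w hw, add_comm]
  · simp only [h2 _ hp, sub_add_cancel]

theorem rot_pi_eb {i j : Fin d} (hij : i ≠ j) : rot i j Real.pi (eb i) = -eb i := by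
  simp only [rot_apply, infRot_apply]
  ext k
  simp [hij, hij.symm]
  split_ifs <;> ring

theorem rot_pi_rot_pi {i j : Fin d} (hij : i ≠ j) (w : Euc d) :
    rot i j Real.pi (rot i j Real.pi w) = w := by
  rw [rot_rot hij, ← two_mul, rot_apply]
  simp

/-- The permutations of the lattice realized by diffeomorphisms translating the balls around
lattice points. -/
def latticePerms (d : ℕ) (ρ : ℝ) : Subgroup (Equiv.Perm (Fin d → ℤ)) where
  carrier := {σ | ∃ Φ, IsCompSuppVolDiffeo d Φ ∧
    ∀ q w, ‖w‖ ≤ ρ → Φ (lat (4 * ρ) q + w) = lat (4 * ρ) (σ q) + w}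
  one_mem' := ⟨fun p => p, .id, fun _ _ _ => rfl⟩
  mul_mem' := by
    rintro σ τ ⟨Φ, hΦ, h⟩ ⟨Θ, hΘ, k⟩
    exact ⟨_, hΦ.comp hΘ, fun q w hw => by rw [k q w hw, h _ w hw]; rfl⟩
  inv_mem' := by
    rintro σ ⟨Φ, hΦ, h⟩
    obtain ⟨Ψ, hΨ, hl, hr⟩ := hΦ.exists_inverse
    refine ⟨Ψ, hΨ, fun q w hw => ?_⟩
    have := h (σ⁻¹ q) w hw
    rw [show σ (σ⁻¹ q) = q from σ.apply_symm_apply q] at this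
    rw [← this, hl]

theorem swap_adjacent_mem {ρ : ℝ} (hρ : 0 < ρ) {i j : Fin d} (hij : i ≠ j) (q : Fin d → ℤ) :
    Equiv.swap q (q + Pi.single i 1) ∈ latticePerms d ρ := by
  set q' := q + Pi.single i 1 with hq'
  have hqq : q ≠ q' := fun h => by simpa [hq'] using congrFun h i
  set m := lat (4 * ρ) q + (4 * ρ / 2) • eb i with hm
  have hm' : lat (4 * ρ) q' = m + (2 * ρ) • eb i := by rw [lat_add_single, hm]; module
  have hmq : lat (4 * ρ) q = m - (2 * ρ) • eb i := by rw [hm]; module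
  obtain ⟨Φ, hΦ, hΦ1, hΦ2⟩ := exists_half_turn hij m (r := 3 * ρ) (R := 3.4 * ρ)
    (by positivity) (by linarith)
  obtain ⟨Θ, hΘ, hΘ1, hΘ2⟩ := exists_half_turn hij (lat (4 * ρ) q) (r := ρ) (R := 2 * ρ)
    hρ.le (by linarith)
  obtain ⟨Θ', hΘ', hΘ1', hΘ2'⟩ := exists_half_turn hij (lat (4 * ρ) q') (r := ρ) (R := 2 * ρ)
    hρ.le (by linarith)
  have hn : ‖(2 * ρ) • eb i‖ = 2 * ρ := by
    rw [norm_smul, norm_eb, Real.norm_of_nonneg (by linarith), mul_one]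
  have hfar : ∀ s t : Fin d → ℤ, s ≠ t → ∀ w : Euc d, ‖w‖ ≤ ρ →
      2 * ρ ≤ ‖lat (4 * ρ) s + w - lat (4 * ρ) t‖ := by
    intro s t hst w hw
    have h1 := le_norm_lat_sub (K := 4 * ρ) (by linarith) hst
    have h2 := norm_sub_le (lat (4 * ρ) s + w - lat (4 * ρ) t) w
    rw [show lat (4 * ρ) s + w - lat (4 * ρ) t - w = lat (4 * ρ) s - lat (4 * ρ) t by abel] at h2
    linarith
  refine ⟨_, hΘ.comp (hΘ'.comp hΦ), fun s w hw => ?_⟩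
  have hrw : ‖rot i j Real.pi w‖ ≤ ρ := by rwa [norm_rot hij]
  by_cases hs : s = q
  · subst hs
    rw [Equiv.swap_apply_left]
    have h1 : Φ (lat (4 * ρ) s + w) = lat (4 * ρ) q' + rot i j Real.pi w := by
      rw [hmq, sub_add_eq_add_sub, add_sub_assoc, hΦ1 _ ((norm_sub_le _ _).trans (by linarith)),
        hm', map_sub, map_smul, rot_pi_eb hij]
      module
    rw [h1, hΘ1' _ hrw, rot_pi_rot_pi hij, hΘ2 _ (hfar _ _ hqq.symm _ hw)]
  by_cases hs' : s = q'
  · rw [hs', Equiv.swap_apply_right]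
    have h1 : Φ (lat (4 * ρ) q' + w) = lat (4 * ρ) q + rot i j Real.pi w := by
      rw [hm', add_assoc, hΦ1 _ ((norm_add_le _ _).trans (by linarith)),
        hmq, map_add, map_smul, rot_pi_eb hij]
      module
    rw [h1, hΘ2' _ (hfar _ _ hqq _ hrw), hΘ1 _ hrw, rot_pi_rot_pi hij]
  · rw [Equiv.swap_apply_of_ne_of_ne hs hs']
    have h1 : Φ (lat (4 * ρ) s + w) = lat (4 * ρ) s + w := by
      refine hΦ2 _ ?_
      have h2 := le_norm_sq_lat_sub_midpoint (K := 4 * ρ) hs hs'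
      rw [← hm] at h2
      have h3 : 4.4 * ρ ≤ ‖lat (4 * ρ) s - m‖ := by
        refine le_of_sq_le_sq ?_ (norm_nonneg _)
        nlinarith
      have h4 := norm_sub_le (lat (4 * ρ) s + w - m) w
      rw [show lat (4 * ρ) s + w - m - w = lat (4 * ρ) s - m by abel] at h4
      linarith
    rw [h1, hΘ2' _ (hfar _ _ hs' _ hw), hΘ2 _ (hfar _ _ hs _ hw)]

theorem swap_mem_latticePerms {ρ : ℝ} (hρ : 0 < ρ) (hd : 2 ≤ d) (q q' : Fin d → ℤ) :
    Equiv.swap q q' ∈ latticePerms d ρ := by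
  have : Nontrivial (Fin d) := Fin.nontrivial_iff_two_le.2 hd
  have hadj : ∀ i q, Equiv.swap q (q + Pi.single i 1) ∈ latticePerms d ρ := fun i q => by
    obtain ⟨j, hj⟩ := exists_ne i
    exact swap_adjacent_mem hρ hj.symm q
  have haxis : ∀ i q (n : ℤ), Equiv.swap q (q + Pi.single i n) ∈ latticePerms d ρ := by
    intro i q n
    induction n with
    | zero => simp [Equiv.swap_self, ← Equiv.Perm.one_def, (latticePerms d ρ).one_mem]
    | succ n ih =>
      refine SubmonoidClass.swap_mem_trans _ ih ?_
      rw [Pi.single_add, ← add_assoc]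
      exact hadj _ _
    | pred n ih =>
      refine SubmonoidClass.swap_mem_trans _ ih ?_
      rw [Equiv.swap_comm]
      convert hadj i (q + Pi.single i (-(n : ℤ) - 1)) using 2
      rw [add_assoc, ← Pi.single_add, sub_add_cancel]
  have hsum : ∀ S : Finset (Fin d),
      Equiv.swap q (q + ∑ i ∈ S, Pi.single i (q' i - q i)) ∈ latticePerms d ρ := by
    intro S
    induction S using Finset.induction_on with
    | empty => simp [Equiv.swap_self, ← Equiv.Perm.one_def, (latticePerms d ρ).one_mem]
    | insert i S hi ih =>
      refine SubmonoidClass.swap_mem_trans _ ih ?_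
      rw [Finset.sum_insert hi, add_comm (Pi.single _ _), ← add_assoc]
      exact haxis _ _ _
  convert hsum Finset.univ using 2
  rw [Finset.univ_sum_single (fun i => q' i - q i)]
  ext l
  simp

/-- Finitely many lattice balls can be moved to arbitrary distinct lattice positions. -/
theorem exists_diffeo_lattice {ρ : ℝ} (hρ : 0 < ρ) (hd : 2 ≤ d) (v : Euc d)
    (S : Finset (Fin d → ℤ)) (φ : (Fin d → ℤ) → Fin d → ℤ) (hφ : Set.InjOn φ S) :
    ∃ Φ, IsCompSuppVolDiffeo d Φ ∧ ∀ q ∈ S, ∀ w, ‖w‖ ≤ ρ →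
      Φ (v + lat (4 * ρ) q + w) = v + lat (4 * ρ) (φ q) + w := by
  have key : ∃ σ ∈ latticePerms d ρ, ∀ q ∈ S, σ q = φ q := by
    induction S using Finset.induction_on with
    | empty => exact ⟨1, (latticePerms d ρ).one_mem, by simp⟩
    | insert x S hx ih =>
      obtain ⟨σ, hσ, h⟩ := ih (hφ.mono (by simp))
      refine ⟨Equiv.swap (σ x) (φ x) * σ,
        (latticePerms d ρ).mul_mem (swap_mem_latticePerms hρ hd _ _) hσ, fun q hq => ?_⟩
      rcases Finset.mem_insert.1 hq with rfl | hq'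
      · simp
      · have hne : q ≠ x := fun hn => hx (hn ▸ hq')
        rw [Equiv.Perm.mul_apply, Equiv.swap_apply_of_ne_of_ne, h q hq']
        · exact σ.injective.ne hne
        · rw [h q hq']
          exact fun hn => hne (hφ (by simpa using Or.inr hq') (by simp) hn)
  obtain ⟨σ, ⟨Φ, hΦ, h⟩, hσ⟩ := key
  refine ⟨_, hΦ.conj_translate v, fun q hq w hw => ?_⟩
  rw [← hσ q hq]
  simp only [add_assoc, add_sub_cancel_left]
  rw [h q w hw]
  abel

/-! ### A partition of unity on a lattice of cubes -/

theorem exists_lipDir {k : Euc d → ℝ} (hk : ContDiff ℝ ∞ k) (hc : HasCompactSupport k) :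
    ∃ C : ℝ, 0 ≤ C ∧ ∀ i, LipDir i C k := by
  obtain ⟨C, hC⟩ := hk.lipschitzWith_of_hasCompactSupport hc (by simp)
  refine ⟨C, C.2, fun i p s => ?_⟩
  have := hC.dist_le_mul (p + s • eb i) p
  simpa [Real.dist_eq, dist_eq_norm, norm_smul, norm_eb] using this

theorem LipDir.mul {o : Fin d} {k k' : Euc d → ℝ} {η η' A A' : ℝ} (h : LipDir o η k)
    (h' : LipDir o η' k') (hA : ∀ p, |k p| ≤ A) (hA' : ∀ p, |k' p| ≤ A') :
    LipDir o (η * A' + A * η') fun p => k p * k' p := by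
  intro p s
  have h1 : k (p + s • eb o) * k' (p + s • eb o) - k p * k' p
      = (k (p + s • eb o) - k p) * k' (p + s • eb o) + k p * (k' (p + s • eb o) - k' p) := by ring
  rw [h1]
  refine (abs_add_le _ _).trans ?_
  rw [abs_mul, abs_mul]
  have h2 : |k (p + s • eb o) - k p| * |k' (p + s • eb o)| ≤ η * |s| * A' :=
    mul_le_mul (h p s) (hA' _) (abs_nonneg _) ((abs_nonneg _).trans (h p s))
  have h3 : |k p| * |k' (p + s • eb o) - k' p| ≤ A * (η' * |s|) :=
    mul_le_mul (hA p) (h' p s) (abs_nonneg _) ((abs_nonneg _).trans (hA p))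
  linarith

/-- A smooth bump on `[-1, 1]` whose integer translates sum to one. -/
noncomputable def tooth (t : ℝ) : ℝ := Real.smoothTransition (t + 1) - Real.smoothTransition t

theorem tooth_contDiff : ContDiff ℝ ∞ tooth := by
  have := Real.smoothTransition.contDiff (n := ⊤)
  unfold tooth
  fun_prop

theorem tooth_nonneg (t : ℝ) : 0 ≤ tooth t :=
  sub_nonneg.2 (Real.smoothTransition.monotone (by linarith))

theorem tooth_le_one (t : ℝ) : tooth t ≤ 1 := by
  have h1 := Real.smoothTransition.le_one (t + 1)
  have h2 := Real.smoothTransition.nonneg t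
  unfold tooth
  linarith

theorem tooth_eq_zero {t : ℝ} (ht : 1 ≤ |t|) : tooth t = 0 := by
  unfold tooth
  rcases le_abs.1 ht with h | h
  · rw [Real.smoothTransition.one_of_one_le h, Real.smoothTransition.one_of_one_le (by linarith),
      sub_self]
  · rw [Real.smoothTransition.zero_of_nonpos (by linarith),
      Real.smoothTransition.zero_of_nonpos (by linarith), sub_self]

theorem sum_tooth (N : ℕ) {t : ℝ} (ht : |t| ≤ N) :
    ∑ z ∈ Finset.Icc (-(N : ℤ)) N, tooth (t - z) = 1 := by
  have h : ∀ n : ℕ, ∑ z ∈ Finset.Ico (-(N : ℤ)) (-(N : ℤ) + n), tooth (t - z)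
      = Real.smoothTransition (t + N + 1) - Real.smoothTransition (t + N + 1 - n) := by
    intro n
    induction n with
    | zero => simp
    | succ n ih =>
      have : Finset.Ico (-(N : ℤ)) (-(N : ℤ) + (n + 1 : ℕ))
          = insert (-(N : ℤ) + n) (Finset.Ico (-(N : ℤ)) (-(N : ℤ) + n)) := by
        ext z; simp
      rw [this, Finset.sum_insert (by simp), ih, tooth]
      push_cast
      ring_nf
  have h1 : Finset.Icc (-(N : ℤ)) N = Finset.Ico (-(N : ℤ)) (-(N : ℤ) + (2 * N + 1 : ℕ)) := by
    ext z; simp; omega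
  have h2 := abs_le.1 ht
  rw [h1, h, Real.smoothTransition.one_of_one_le (by linarith),
    Real.smoothTransition.zero_of_nonpos (by push_cast; linarith), sub_zero]

theorem integral_tooth_pos : 0 < ∫ t, tooth t := by
  refine tooth_contDiff.continuous.integral_pos_of_hasCompactSupport_nonneg_nonzero (x := 0)
    (.of_support_subset_isCompact (isCompact_Icc (a := -1) (b := 1)) fun t ht => ?_)
    tooth_nonneg ?_
  · by_contra hn
    refine ht (tooth_eq_zero ?_)
    by_contra h1
    exact hn (abs_le.1 (not_le.1 h1).le)
  · simp [tooth]

/-- The product bump on `[-1, 1]^d`. -/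
noncomputable def cell (p : Euc d) : ℝ := ∏ i, tooth (p i)

theorem cell_contDiff : ContDiff ℝ ∞ (cell (d := d)) := by
  have := tooth_contDiff
  unfold cell
  fun_prop

theorem cell_cubeSupp : CubeSupp 1 (cell (d := d)) := fun _ i hi =>
  Finset.prod_eq_zero (Finset.mem_univ i) (tooth_eq_zero hi.le)

theorem cell_nonneg (p : Euc d) : 0 ≤ cell p := Finset.prod_nonneg fun _ _ => tooth_nonneg _

theorem cell_le_one (p : Euc d) : cell p ≤ 1 :=
  Finset.prod_le_one (fun _ _ => tooth_nonneg _) fun _ _ => tooth_le_one _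

theorem abs_cell_le_one (p : Euc d) : |cell p| ≤ 1 := by
  rw [abs_of_nonneg (cell_nonneg p)]; exact cell_le_one p

theorem norm_le_of_mem_cube {p : Euc d} {R : ℝ} (hp : p ∈ cube d R) : ‖p‖ ≤ d * R := by
  have h : p = ∑ i, p i • eb i := by ext k; simp
  rw [h]
  refine (norm_sum_le _ _).trans ?_
  calc ∑ i, ‖p i • eb i‖ ≤ ∑ _i : Fin d, R := Finset.sum_le_sum fun i _ => by
        rw [norm_smul, norm_eb, mul_one]; exact hp i
    _ = d * R := by simp

theorem cell_eq_zero_of_norm {p : Euc d} (hp : d < ‖p‖) : cell p = 0 :=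
  cell_cubeSupp.eq_zero fun hn => hp.not_ge (by simpa using norm_le_of_mem_cube hn)

theorem sum_cell (N : ℕ) {p : Euc d} (hp : p ∈ cube d N) :
    ∑ z ∈ Fintype.piFinset fun _ : Fin d => Finset.Icc (-(N : ℤ)) N, cell (p - lat 1 z) = 1 := by
  have h := Finset.prod_univ_sum (fun _ : Fin d => Finset.Icc (-(N : ℤ)) N)
    (fun i z => tooth (p i - z))
  rw [Finset.prod_congr rfl fun i _ => sum_tooth N (hp i), Finset.prod_const_one] at h
  refine Eq.trans ?_ h.symm
  refine Finset.sum_congr rfl fun z _ => ?_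
  simp [cell]

/-- The number of lattice cells needed to cover a compact set. -/
theorem exists_card_lattice_le (hd : 0 < d) {A : Set (Euc d)} (hA : IsCompact A) :
    ∃ ε₀ > 0, ∀ ε : ℝ, 0 < ε → ε < ε₀ → ∀ Z : Finset (Fin d → ℤ),
      (∀ z ∈ Z, ∃ x ∈ A, ‖x - lat ε z‖ ≤ d * ε) →
      Z.card * ε ^ d * (volume (Metric.ball (0 : Euc d) (1 / 2))).toReal
        ≤ (volume A).toReal + 1 := by
  have hlim := tendsto_measure_cthickening_of_isCompact (μ := volume) hA
  have hfin := hA.measure_lt_top (μ := volume)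
  have hev : ∀ᶠ r in 𝓝 (0 : ℝ), volume (Metric.cthickening r A) < volume A + 1 :=
    hlim.eventually_lt_const (ENNReal.lt_add_right hfin.ne one_ne_zero)
  obtain ⟨r₀, hr₀, hr⟩ := Metric.eventually_nhds_iff.1 hev
  refine ⟨r₀ / (d + 1), by positivity, fun ε hε hε0 Z hZ => ?_⟩
  have hd1 : (0 : ℝ) < d + 1 := by positivity
  have hball : ∀ z ∈ Z, Metric.ball (lat ε z) (ε / 2) ⊆ Metric.cthickening ((d + 1) * ε) A := by
    intro z hz y hy
    obtain ⟨x, hxA, hx⟩ := hZ z hz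
    refine Metric.mem_cthickening_of_dist_le y x _ _ hxA ?_
    rw [Metric.mem_ball] at hy
    have := dist_triangle y (lat ε z) x
    have h5 : dist (lat ε z) x = ‖x - lat ε z‖ := by rw [dist_comm, dist_eq_norm]
    linarith
  have hdisj : (Z : Set (Fin d → ℤ)).PairwiseDisjoint fun z => Metric.ball (lat ε z) (ε / 2) := by
    intro z _ z' _ hne
    refine Metric.ball_disjoint_ball ?_
    rw [dist_eq_norm]
    linarith [le_norm_lat_sub hε.le hne]
  have h1 := measure_mono (μ := volume) (iUnion₂_subset hball)
  rw [measure_biUnion_finset hdisj fun _ _ => measurableSet_ball] at h1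
  have h2 : ∀ z : Fin d → ℤ, volume (Metric.ball (lat ε z) (ε / 2))
      = ENNReal.ofReal (ε ^ d) * volume (Metric.ball (0 : Euc d) (1 / 2)) := fun z => by
    have := Measure.addHaar_ball_mul_of_pos (μ := volume) (lat ε z) hε (1 / 2)
    rw [mul_one_div] at this
    simpa using this
  simp only [h2, Finset.sum_const, nsmul_eq_mul] at h1
  have h3 := h1.trans (hr (y := (d + 1) * ε) (by
    rw [dist_zero_right, Real.norm_of_nonneg (by positivity)]
    rw [lt_div_iff₀ hd1] at hε0
    linarith)).le
  have h4 := ENNReal.toReal_mono (by finiteness) h3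
  rw [ENNReal.toReal_add hfin.ne (by simp)] at h4
  simpa [hε.le, mul_assoc] using h4

/-! ### Functions supported in long boxes -/

theorem exists_integral_comp_linear (M : Euc d ≃L[ℝ] Euc d) :
    ∃ c : ℝ, 0 < c ∧ (∀ f : Euc d → ℝ, ∫ x, f (M x) = c * ∫ x, f x) ∧
      ∀ s : Set (Euc d), (volume (M ⁻¹' s)).toReal = c * (volume s).toReal := by
  have hdet : LinearMap.det (M : Euc d →ₗ[ℝ] Euc d) ≠ 0 := M.toLinearEquiv.isUnit_det'.ne_zero
  refine ⟨|(LinearMap.det (M : Euc d →ₗ[ℝ] Euc d))⁻¹|, by positivity, fun f => ?_, fun s => ?_⟩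
  · have h := Measure.map_linearMap_addHaar_eq_smul_addHaar (volume : Measure (Euc d)) hdet
    have h1 := M.toHomeomorph.measurableEmbedding.integral_map (μ := volume) f
    have h2 : Measure.map M.toHomeomorph (volume : Measure (Euc d))
        = ENNReal.ofReal |(LinearMap.det (M : Euc d →ₗ[ℝ] Euc d))⁻¹| • volume := h
    rw [h2, integral_smul_measure, ENNReal.toReal_ofReal (abs_nonneg _)] at h1
    exact h1.symm
  · have h := Measure.addHaar_preimage_linearMap (volume : Measure (Euc d)) hdet s
    have h2 : (M ⁻¹' s) = (M : Euc d →ₗ[ℝ] Euc d) ⁻¹' s := rfl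
    rw [h2, h, ENNReal.toReal_mul, ENNReal.toReal_ofReal (abs_nonneg _)]

theorem IsRep.of_comp_linear {u h : Euc d → ℝ} {N : ℕ} (M : Euc d ≃L[ℝ] Euc d)
    (hr : IsRep (fun x => u (M x)) N h) : IsRep u N fun x => h (M.symm x) := by
  obtain ⟨Φ, Φ', h, h', rfl⟩ := hr
  exact ⟨fun i x => M (Φ i (M.symm x)), fun i x => M (Φ' i (M.symm x)),
    fun i => (h i).conj_linear M, fun i => (h' i).conj_linear M, rfl⟩

/-- A large Lipschitz constant only costs more summands. -/
theorem exists_isRep_sub_of_lipDir {o a : Fin d} (hao : a ≠ o) (C : ℝ) : ∃ N : ℕ,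
    ∀ (u F F' : Euc d → ℝ) (c : ℝ), (∀ p ∈ cube d 8, u p = p o + c) →
      ContDiff ℝ ∞ F → ContDiff ℝ ∞ F' → CubeSupp 1 F → CubeSupp 1 F' →
      LipDir o C F → LipDir o C F' → ∫ p, F p = ∫ p, F' p → IsRep u N (F - F') := by
  obtain ⟨η, hη, key⟩ := exists_isRep_sub_of_integral_eq hao
  obtain ⟨L, hL⟩ := exists_nat_gt (max 1 (C / η))
  have hL1 : (1 : ℝ) < L := (le_max_left _ _).trans_lt hL
  have hL0 : (0 : ℝ) < L := by linarith
  have hLC : (L : ℝ)⁻¹ * C ≤ η := by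
    have := ((le_max_right _ _).trans_lt hL).le
    rw [div_le_iff₀ hη] at this
    rw [inv_mul_le_iff₀ hL0]
    exact this
  have hinv : |(L : ℝ)⁻¹| = (L : ℝ)⁻¹ := abs_of_pos (by positivity)
  refine ⟨L * (2 * d + 2), fun u F F' c hu hF hF' hs hs' hl hl' hi => ?_⟩
  have h := key u (fun p => (L : ℝ)⁻¹ * F p) (fun p => (L : ℝ)⁻¹ * F' p) c hu
    (by fun_prop) (by fun_prop) (fun p i h => by simp [hs p i h]) (fun p i h => by simp [hs' p i h])
    ((hl.const_mul _).mono (by rwa [hinv])) ((hl'.const_mul _).mono (by rwa [hinv]))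
    (by rw [integral_const_mul, integral_const_mul, hi])
  have h2 := IsRep.sum (Finset.range L) fun i _ => h
  rw [Finset.card_range] at h2
  convert h2 using 1
  ext p
  simp
  field_simp

/-- Functions supported in the box of half-width `R` in the direction `o` and `n * R` in the
other directions. -/
def BoxSupp (o : Fin d) (R : ℝ) (n : ℕ) (k : Euc d → ℝ) : Prop :=
  ∀ p, (R < |p o| → k p = 0) ∧ ∀ l, l ≠ o → n * R < |p l| → k p = 0

/-- Two functions in a long box can be interchanged by at most `N` summands. -/
def BoxFlexible (o : Fin d) (R C : ℝ) (n N : ℕ) (u : Euc d → ℝ) : Prop :=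
  ∀ F F' : Euc d → ℝ, ContDiff ℝ ∞ F → ContDiff ℝ ∞ F' → BoxSupp o R n F → BoxSupp o R n F' →
    LipDir o C F → LipDir o C F' → ∫ p, F p = ∫ p, F' p → IsRep u N (F - F')

theorem exists_boxFlexible {o a : Fin d} (hao : a ≠ o) {R : ℝ} (hR : 0 < R) (C : ℝ) : ∃ N : ℕ,
    ∀ (u : Euc d → ℝ) (c : ℝ), (∀ p ∈ cube d 8, u p = p o + c) → ∀ b : ℕ, 0 < b →
      BoxFlexible o R C (b ^ d) N fun x => u ((1 / (R * b ^ (d - 1))) • x) := by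
  obtain ⟨N, key⟩ := exists_isRep_sub_of_lipDir hao (R * C)
  refine ⟨N, fun u c hu b hb F F' hF hF' hs hs' hl hl' hi => ?_⟩
  have hb0 : (b : ℝ) ≠ 0 := by positivity
  have hpow : (b : ℝ) ^ d = b ^ (d - 1) * b := by
    rw [← pow_succ, Nat.sub_add_cancel o.pos]
  set L := diagEquiv (Function.update (fun _ => (Units.mk0 (b : ℝ) hb0)⁻¹) o
    ((Units.mk0 (b : ℝ) hb0)⁻¹ ^ (d - 1))⁻¹) with hL
  obtain ⟨T, hT, hTL⟩ := exists_comp_eq_of_mem_locExt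
    (diagEquiv_update_mem o (Units.mk0 (b : ℝ) hb0)⁻¹) d
  set D := diagEquiv (Function.update (fun _ => Units.mk0 ((b : ℝ) ^ d * R) (by positivity)) o
    (Units.mk0 R hR.ne')) with hD
  have hDo : ∀ p, D p o = R * p o := fun p => by simp [hD]
  have hDl : ∀ p, ∀ l ≠ o, D p l = b ^ d * R * p l := fun p l hlo => by simp [hD, hlo]
  have hsupp : ∀ {G}, BoxSupp o R (b ^ d) G → CubeSupp 1 fun p => G (D p) := by
    intro G hG p i hi
    by_cases hio : i = o
    · subst hio
      refine (hG _).1 ?_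
      rw [hDo, abs_mul, abs_of_pos hR]
      nlinarith
    · refine (hG _).2 i hio ?_
      rw [hDl p i hio, abs_mul, abs_of_pos (by positivity)]
      push_cast
      have : 0 < (b : ℝ) ^ d * R := by positivity
      nlinarith
  have hlip : ∀ {G}, LipDir o C G → LipDir o (R * C) fun p => G (D p) := by
    intro G hG p s
    have h1 : D (p + s • eb o) = D p + (R * s) • eb o := by
      ext l
      by_cases hlo : l = o
      · subst hlo; simp [hDo]; ring
      · simp [hDl _ l hlo, hlo]
    simp only [h1]
    refine (hG (D p) (R * s)).trans (le_of_eq ?_)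
    rw [abs_mul, abs_of_pos hR]
    ring
  obtain ⟨e, -, he, -⟩ := exists_integral_comp_linear D
  have hrep := (key u (fun p => F (D p)) (fun p => F' (D p)) c hu (hF.comp D.contDiff)
    (hF'.comp D.contDiff) (hsupp hs) (hsupp hs') (hlip hl) (hlip hl') (by rw [he, he, hi])).comp hT
  have hsub : CubeSupp 1 ((fun p => F (D p)) - fun p => F' (D p)) := (hsupp hs).sub (hsupp hs')
  simp only [hTL _ fun p hp => hsub.eq_zero
    fun hn => hp.not_ge (by simpa using norm_le_of_mem_cube hn)] at hrep
  have hε : (1 / (R * b ^ (d - 1)) : ℝ) ≠ 0 := by positivity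
  set E : Euc d ≃L[ℝ] Euc d := diagEquiv fun _ => (Units.mk0 _ hε)⁻¹ with hE
  have hEs : ∀ x, (1 / (R * b ^ (d - 1)) : ℝ) • E x = x := fun x => by
    ext i
    simp only [hE, PiLp.smul_apply, diagEquiv_apply, Units.val_inv_eq_inv_val, Units.val_mk0,
      smul_eq_mul]
    field_simp
  have h3 := IsRep.of_comp_linear (u := fun x => u ((1 / (R * b ^ (d - 1)) : ℝ) • x)) E
    (h := fun x => F (E x) - F' (E x)) (N := N) (by
      simp only [hEs]
      convert hrep using 1
      ext x
      have h4 : ∀ x, D (L x) = E x := fun x => by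
        ext l
        by_cases hlo : l = o
        · subst hlo
          simp [hDo, hL, hE]
          field_simp
        · simp [hDl _ l hlo, hL, hE, hlo]
          rw [hpow]
          field_simp
      simp [← h4, hL])
  simpa using! h3

/-! ### Rearranging pieces of a function into a long box -/

/-- The part of `g` near the sparse lattice points indexed by `S`. -/
noncomputable def chunk (g : Euc d → ℝ) (v : Euc d) (S : Finset (Fin d → ℤ)) (x : Euc d) : ℝ :=
  ∑ q ∈ S, g x * cell (x - v - lat (4 * d) q)

/-- The part of `g` near the sparse lattice points indexed by `S`, cut into pieces which are
translated as prescribed by `φ`. -/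
noncomputable def moved (g : Euc d → ℝ) (v : Euc d) (S : Finset (Fin d → ℤ))
    (φ : (Fin d → ℤ) → Fin d → ℤ) (y : Euc d) : ℝ :=
  ∑ q ∈ S, g (y + lat (4 * d) q - lat (4 * d) (φ q)) * cell (y - v - lat (4 * d) (φ q))

theorem moved_id (g : Euc d → ℝ) (v : Euc d) (S : Finset (Fin d → ℤ)) :
    moved g v S id = chunk g v S := by
  ext; simp [moved, chunk]

section

variable {g : Euc d → ℝ} {v : Euc d} {S Q : Finset (Fin d → ℤ)} {φ : (Fin d → ℤ) → Fin d → ℤ}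
  {o a : Fin d} {n N : ℕ} {c : ℝ}

theorem moved_contDiff (hg : ContDiff ℝ ∞ g) : ContDiff ℝ ∞ (moved g v S φ) := by
  have := cell_contDiff (d := d)
  unfold moved
  fun_prop

theorem lipDir_sum_of_disjoint {ι : Type*} {T : Finset ι} {H : ι → Euc d → ℝ} (hc : 0 ≤ c)
    (hH : ∀ q ∈ T, LipDir o c (H q))
    (hd : ∀ q ∈ T, ∀ q' ∈ T, q ≠ q' → ∀ p (s : ℝ), H q p ≠ 0 → H q' (p + s • eb o) = 0) :
    LipDir o c fun p => ∑ q ∈ T, H q p := by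
  intro p s
  rw [← Finset.sum_sub_distrib]
  by_cases h : ∃ q ∈ T, H q (p + s • eb o) - H q p ≠ 0
  · obtain ⟨q, hq, h⟩ := h
    rw [Finset.sum_eq_single_of_mem q hq fun q' hq' hne => ?_]
    · exact hH q hq p s
    · by_cases hp : H q p = 0
      · have h1 : H q (p + s • eb o) ≠ 0 := fun h2 => h (by rw [hp, h2, sub_zero])
        have h3 := hd q hq q' hq' hne.symm _ 0 h1
        have h4 := hd q hq q' hq' hne.symm _ (-s) h1
        simp only [zero_smul, add_zero, neg_smul, add_neg_cancel_right] at h3 h4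
        rw [h3, h4, sub_zero]
      · have h3 := hd q hq q' hq' hne.symm _ 0 hp
        have h4 := hd q hq q' hq' hne.symm _ s hp
        simp only [zero_smul, add_zero] at h3
        rw [h3, h4, sub_zero]
  · push Not at h
    rw [Finset.sum_eq_zero h, abs_zero]
    positivity

theorem LipDir.comp_sub {k : Euc d → ℝ} (h : LipDir o c k) (w : Euc d) :
    LipDir o c fun p => k (p - w) := fun p s => by
  have := h (p - w) s
  rwa [← add_sub_right_comm] at this

theorem cell_ne_zero {p : Euc d} (hp : cell p ≠ 0) (i : Fin d) : |p i| ≤ 1 :=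
  not_lt.1 fun h => hp (cell_cubeSupp p i h)

theorem moved_lipDir (hc : LipDir o c (cell (d := d))) (hg : LipDir o 1 g) (hg1 : ∀ p, |g p| ≤ 1)
    (hφ : Set.InjOn φ S) (ho : ∀ q ∈ S, φ q o = 0) : LipDir o (1 + c) (moved g v S φ) := by
  refine lipDir_sum_of_disjoint (by linarith [hc.nonneg]) (fun q _ => ?_)
    fun q hq q' hq' hne p s hp => ?_
  · have h1 := hg.comp_sub (lat (4 * d) (φ q) - lat (4 * d) q)
    have h2 := hc.comp_sub (v + lat (4 * d) (φ q))
    have h3 := h1.mul h2 (fun _ => hg1 _) (fun _ => abs_cell_le_one _)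
    simp only [one_mul, sub_sub_eq_add_sub, ← sub_sub] at h3
    exact h3
  · by_contra hp'
    obtain ⟨l, hl⟩ := Function.ne_iff.1 (hφ.ne hq hq' hne)
    have hlo : l ≠ o := by rintro rfl; exact hl (by rw [ho q hq, ho q' hq'])
    have h1 := abs_le.1 (cell_ne_zero (right_ne_zero_of_mul hp) l)
    have h2 := abs_le.1 (cell_ne_zero (right_ne_zero_of_mul hp') l)
    simp [hlo] at h1 h2
    have hd1 : (1 : ℝ) ≤ d := by exact_mod_cast o.pos
    rcases lt_or_gt_of_ne hl with h | h
    · have h3 : (φ q l : ℝ) + 1 ≤ φ q' l := by exact_mod_cast h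
      nlinarith
    · have h3 : (φ q' l : ℝ) + 1 ≤ φ q l := by exact_mod_cast h
      nlinarith

theorem moved_boxSupp (hn : 0 < n) (hv : ∀ i, 0 ≤ v i ∧ v i ≤ 4 * d)
    (ho : ∀ q ∈ S, φ q o = 0) (hl : ∀ q ∈ S, ∀ l, 0 ≤ φ q l ∧ φ q l < 2 * n) :
    BoxSupp o (3 * (4 * d) + 1) n (moved g v S φ) := by
  have hd1 : (1 : ℝ) ≤ d := by exact_mod_cast o.pos
  have hn1 : (1 : ℝ) ≤ n := by exact_mod_cast hn
  refine fun p => ⟨fun hp => ?_, fun l _ hp => ?_⟩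
  · refine Finset.sum_eq_zero fun q hq => ?_
    by_contra hne
    have h1 := abs_le.1 (cell_ne_zero (right_ne_zero_of_mul hne) o)
    simp [ho q hq] at h1
    have := hv o
    rcases lt_abs.1 hp with h | h <;> linarith
  · refine Finset.sum_eq_zero fun q hq => ?_
    by_contra hne
    have h1 := abs_le.1 (cell_ne_zero (right_ne_zero_of_mul hne) l)
    simp at h1
    have := hv l
    have h2 : (0 : ℝ) ≤ φ q l := by exact_mod_cast (hl q hq l).1
    have h3 : (φ q l : ℝ) ≤ 2 * n := by exact_mod_cast (hl q hq l).2.le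
    have h4 : (d : ℝ) * φ q l ≤ d * (2 * n) := by gcongr
    have h5 : 0 ≤ (d : ℝ) * φ q l := by positivity
    have h6 : (d : ℝ) ≤ n * d := by nlinarith
    rcases lt_abs.1 hp with h | h <;> nlinarith

theorem exists_diffeo_moved (hd : 2 ≤ d) (v : Euc d) (hφ : Set.InjOn φ Q) :
    ∃ Φ, IsCompSuppVolDiffeo d Φ ∧ ∀ S ⊆ Q, ∀ g y, moved g v S φ (Φ y) = chunk g v S y := by
  have hd0 : (0 : ℝ) < d := by positivity
  obtain ⟨Φ, hΦ, h⟩ := exists_diffeo_lattice hd0 hd v Q φ hφ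
  refine ⟨Φ, hΦ, fun S hS g y => Finset.sum_congr rfl fun q hq => ?_⟩
  by_cases hy : ‖y - v - lat (4 * d) q‖ ≤ d
  · have h1 := h q (hS hq) _ hy
    have h2 : v + lat (4 * d) q + (y - v - lat (4 * d) q) = y := by abel
    rw [h2] at h1
    rw [h1]
    congr 2 <;> abel
  · rw [cell_eq_zero_of_norm (not_le.1 hy), mul_zero, cell_eq_zero_of_norm, mul_zero]
    by_contra hn
    have h1 := h q (hS hq) _ (not_lt.1 hn)
    have h2 : v + lat (4 * d) (φ q) + (Φ y - v - lat (4 * d) (φ q)) = Φ y := by abel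
    rw [h2] at h1
    obtain ⟨Ψ, -, hΨ, -⟩ := hΦ.exists_inverse
    refine hy ?_
    have h3 := hΨ.injective h1
    have h4 : y - v - lat (4 * d) q = Φ y - v - lat (4 * d) (φ q) := by
      rw [sub_sub, sub_eq_iff_eq_add']
      exact h3.symm
    rw [h4]
    exact not_lt.1 hn

theorem integral_cell_pos : 0 < ∫ p : Euc d, cell p := by
  have h : ∫ p : Euc d, cell p = (∫ t, tooth t) ^ d := by
    rw [← (EuclideanSpace.volume_preserving_symm_measurableEquiv_toLp (Fin d)).symm.integral_comp']
    have := integral_fintype_prod_volume_eq_prod (ι := Fin d) (E := fun _ => ℝ) (fun _ t => tooth t)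
    simpa [cell] using this
  rw [h]
  exact pow_pos integral_tooth_pos d

theorem integrable_cell_sub (w : Euc d) : Integrable fun p => cell (p - w) :=
  (cell_contDiff.continuous.integrable_of_hasCompactSupport
    cell_cubeSupp.hasCompactSupport).comp_sub_right w

theorem integrable_chunk_one : Integrable (chunk (fun _ => 1) v S) := by
  refine integrable_finsetSum _ fun q _ => ?_
  simpa [sub_sub] using integrable_cell_sub (v + lat (4 * d) q)

theorem integral_chunk_one : ∫ x, chunk (fun _ => 1) v S x = S.card * ∫ p : Euc d, cell p := by
  simp only [chunk, one_mul, sub_sub]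
  rw [integral_finsetSum _ fun q _ => integrable_cell_sub _]
  simp [integral_sub_right_eq_self (cell (d := d))]

theorem abs_integral_chunk_le (hg1 : ∀ p, |g p| ≤ 1) :
    |∫ x, chunk g v S x| ≤ S.card * ∫ p : Euc d, cell p := by
  rw [← integral_chunk_one (v := v), ← Real.norm_eq_abs]
  refine norm_integral_le_of_norm_le integrable_chunk_one (.of_forall fun x => ?_)
  refine (norm_sum_le _ _).trans (Finset.sum_le_sum fun q _ => ?_)
  rw [Real.norm_eq_abs, abs_mul, abs_of_nonneg (cell_nonneg _)]
  exact mul_le_mul_of_nonneg_right (hg1 x) (cell_nonneg _)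

/-- The first layer of slots. -/
noncomputable def slots (o : Fin d) (n : ℕ) : Finset (Fin d → ℤ) :=
  Fintype.piFinset fun i => if i = o then {0} else Finset.Ico 0 (n : ℤ)

theorem mem_slots {q : Fin d → ℤ} :
    q ∈ slots o n ↔ q o = 0 ∧ ∀ l ≠ o, 0 ≤ q l ∧ q l < n := by
  simp only [slots, Fintype.mem_piFinset]
  constructor
  · intro h
    refine ⟨by simpa using h o, fun l hl => by simpa [hl] using h l⟩
  · rintro ⟨h, h'⟩ l
    by_cases hl : l = o
    · subst hl; simpa using h
    · simpa [hl] using h' l hl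

theorem card_slots : (slots o n).card = n ^ (d - 1) := by
  rw [slots, Fintype.card_piFinset, ← Finset.mul_prod_erase _ _ (Finset.mem_univ o),
    Finset.prod_congr rfl fun i hi => by rw [if_neg (Finset.ne_of_mem_erase hi)]]
  simp

/-- The points of a small set can be moved injectively into slots, those which already are in
the first layer being fixed. -/
theorem exists_slot_assignment (hao : a ≠ o) (hn : 0 < n) (hS : S.card ≤ n ^ (d - 1)) :
    ∃ φ : (Fin d → ℤ) → Fin d → ℤ, Set.InjOn φ (S ∪ slots o n : Finset _) ∧
      (∀ q ∈ slots o n, φ q = q) ∧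
      ∀ q ∈ S ∪ slots o n, φ q o = 0 ∧ ∀ l, 0 ≤ φ q l ∧ φ q l < 2 * n := by
  classical
  obtain ⟨ψ, hψ, hψi⟩ := (S : Set (Fin d → ℤ)).toFinite.exists_injOn_of_encard_le
    (t := (slots o n : Set (Fin d → ℤ))) (by
      rw [encard_coe_eq_coe_finsetCard, encard_coe_eq_coe_finsetCard, card_slots]
      exact_mod_cast hS)
  have hψ' : ∀ q ∈ S, ψ q ∈ slots o n := fun q hq => hψ hq
  have hA : ∀ q ∈ slots o n, q o = 0 ∧ ∀ l, 0 ≤ q l ∧ q l < n := fun q hq => by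
    refine ⟨(mem_slots.1 hq).1, fun l => ?_⟩
    by_cases hl : l = o
    · subst hl; rw [(mem_slots.1 hq).1]; omega
    · exact (mem_slots.1 hq).2 l hl
  have hS : ∀ q ∈ S ∪ slots o n, q ∉ slots o n → q ∈ S := fun q hq hn =>
    (Finset.mem_union.1 hq).resolve_right hn
  refine ⟨fun q => if q ∈ slots o n then q else ψ q + Pi.single a (n : ℤ), ?_,
    fun q hq => if_pos hq, fun q hq => ?_⟩
  · intro q hq q' hq' heq
    dsimp only at heq
    split_ifs at heq with h h' h'
    · exact heq
    · have h1 := (hA _ h).2 a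
      have h2 := (hA _ (hψ' _ (hS _ hq' h'))).2 a
      rw [heq] at h1
      simp at h1
      omega
    · have h1 := (hA _ h').2 a
      have h2 := (hA _ (hψ' _ (hS _ hq h))).2 a
      rw [← heq] at h1
      simp at h1
      omega
    · exact hψi (hS _ hq h) (hS _ hq' h') (add_right_cancel heq)
  · dsimp only
    split_ifs with h
    · refine ⟨(hA _ h).1, fun l => ?_⟩
      have := (hA _ h).2 l
      omega
    · have h1 := hA _ (hψ' _ (hS _ hq h))
      refine ⟨by simp [h1.1, hao.symm], fun l => ?_⟩
      have h2 := h1.2 l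
      by_cases hl : l = a
      · subst hl; simp; omega
      · simp [hl]; omega

theorem exists_isRep_chunk_sub (hd : 2 ≤ d) (hao : a ≠ o) (hn : 0 < n) {w : Euc d → ℝ}
    (hc : LipDir o c (cell (d := d)))
    (hw : BoxFlexible o (3 * (4 * d) + 1) (1 + c) n N w)
    (hg : ContDiff ℝ ∞ g) (hL : LipDir o 1 g) (hg1 : ∀ p, |g p| ≤ 1)
    (hv : ∀ i, 0 ≤ v i ∧ v i ≤ 4 * d) (hS : S.card ≤ n ^ (d - 1)) :
    ∃ t : ℝ, ∫ x, chunk g v S x = t * ∫ x, chunk (fun _ => 1) 0 (slots o n) x ∧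
      IsRep w (2 * N) (chunk g v S - fun x => t * chunk (fun _ => 1) 0 (slots o n) x) := by
  classical
  obtain ⟨φ, hφ, hφA, hφS⟩ := exists_slot_assignment hao hn hS
  obtain ⟨Φ, hΦ, hΦm⟩ := exists_diffeo_moved hd v hφ
  have hpos := integral_cell_pos (d := d)
  have hcard : ((slots o n).card : ℝ) = n ^ (d - 1) := by rw [card_slots]; push_cast; rfl
  have hI : 0 < ((slots o n).card : ℝ) * ∫ p : Euc d, cell p := by
    rw [hcard]; positivity
  set t := (∫ x, chunk g v S x) / ((slots o n).card * ∫ p : Euc d, cell p) with ht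
  have hint : ∫ x, chunk g v S x = t * ∫ x, chunk (fun _ => 1) 0 (slots o n) x := by
    rw [integral_chunk_one, ht, div_mul_cancel₀ _ hI.ne']
  have ht1 : |t| ≤ 1 := by
    rw [ht, abs_div, abs_of_pos hI, div_le_one hI]
    refine (abs_integral_chunk_le hg1).trans (mul_le_mul_of_nonneg_right ?_ hpos.le)
    rw [hcard]
    exact_mod_cast hS
  have hA : ∀ q ∈ slots o n, id q o = 0 ∧ ∀ l, 0 ≤ id q l ∧ id q l < 2 * n := fun q hq => by
    have := hφS q (Finset.mem_union_right _ hq)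
    rwa [hφA q hq] at this
  have hconst : ∀ v, moved (fun _ => t) v (slots o n) id
      = fun x => t * chunk (fun _ => 1) v (slots o n) x := fun v => by
    rw [moved_id]
    ext x
    simp [chunk, Finset.mul_sum]
  have hlipt : LipDir o 1 fun _ : Euc d => t := fun p s => by simp
  have hbox : ∀ v : Euc d, (∀ i, 0 ≤ v i ∧ v i ≤ 4 * d) → 
      BoxSupp o (3 * (4 * d) + 1) n (moved (fun _ => t) v (slots o n) id) := fun v hv =>
    moved_boxSupp hn hv (fun q hq => (hA q hq).1) fun q hq => (hA q hq).2
  have hlip : ∀ v : Euc d, LipDir o (1 + c) (moved (fun _ => t) v (slots o n) id) := fun v =>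
    moved_lipDir hc hlipt (fun _ => ht1) (injOn_id _) fun q hq => (hA q hq).1
  have hSu : S ⊆ S ∪ slots o n := Finset.subset_union_left
  have hmi : ∫ y, moved g v S φ y = ∫ x, chunk g v S x := by
    have hm := hΦ.2.2.1
    conv_lhs => rw [← hm.map_eq]
    rw [integral_map hm.measurable.aemeasurable
      (moved_contDiff hg).continuous.aestronglyMeasurable]
    exact integral_congr_ae (.of_forall fun x => hΦm S hSu g x)
  have h1 := (hw (moved g v S φ) (moved (fun _ => t) v (slots o n) id) (moved_contDiff hg)
    (moved_contDiff contDiff_const)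
    (moved_boxSupp hn hv (fun q hq => (hφS q (hSu hq)).1) fun q hq => (hφS q (hSu hq)).2)
    (hbox v hv)
    (moved_lipDir hc hL hg1 (hφ.mono (by simp)) fun q hq => (hφS q (hSu hq)).1) (hlip v) (by
      rw [hmi, hint, hconst, integral_const_mul, integral_chunk_one, integral_chunk_one])).comp hΦ
  have h2 := hw (moved (fun _ => t) v (slots o n) id) (moved (fun _ => t) 0 (slots o n) id)
    (moved_contDiff contDiff_const) (moved_contDiff contDiff_const) (hbox v hv)
    (hbox 0 fun i => by simp) (hlip v) (hlip 0) (by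
      rw [hconst, hconst, integral_const_mul, integral_const_mul, integral_chunk_one,
        integral_chunk_one])
  have hfix : ∀ x, t * chunk (fun _ => 1) v (slots o n) (Φ x)
      = t * chunk (fun _ => 1) v (slots o n) x := fun x => by
    have h3 : moved (fun _ => t) v (slots o n) φ (Φ x)
        = moved (fun _ => t) v (slots o n) id (Φ x) :=
      Finset.sum_congr rfl fun q hq => by rw [hφA q hq, id]
    rw [← congrFun (hconst v) x, ← congrFun (hconst v) (Φ x), ← h3,
      hΦm _ Finset.subset_union_right, moved_id]
  refine ⟨t, hint, ?_⟩
  have h3 := h1.add h2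
  rw [← two_mul] at h3
  convert h3 using 1
  ext x
  simp only [Pi.sub_apply, Pi.add_apply, hfix, hΦm S hSu, hconst]
  ring

/-- Sets of any size are split into parts of the size handled above. -/
theorem exists_isRep_chunk_sub_of_card (hd : 2 ≤ d) (hao : a ≠ o) (hn : 0 < n) {w : Euc d → ℝ}
    (hc : LipDir o c (cell (d := d)))
    (hw : BoxFlexible o (3 * (4 * d) + 1) (1 + c) n N w)
    (hg : ContDiff ℝ ∞ g) (hL : LipDir o 1 g) (hg1 : ∀ p, |g p| ≤ 1) (hgi : Integrable g)
    (hv : ∀ i, 0 ≤ v i ∧ v i ≤ 4 * d) (k : ℕ) (hS : S.card ≤ k * n ^ (d - 1)) :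
    ∃ t : ℝ, ∫ x, chunk g v S x = t * ∫ x, chunk (fun _ => 1) 0 (slots o n) x ∧
      IsRep w (k * (2 * N)) (chunk g v S - fun x => t * chunk (fun _ => 1) 0 (slots o n) x) := by
  classical
  have hcell := (cell_contDiff (d := d)).continuous
  have hint : ∀ S, Integrable (chunk g v S) := fun S => integrable_finsetSum _ fun q _ =>
    hgi.mul_bdd (c := 1) (by fun_prop : Continuous _).aestronglyMeasurable
      (.of_forall fun x => by simpa using abs_cell_le_one _)
  induction k generalizing S with
  | zero =>
    have : S = ∅ := by simpa using hS
    subst this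
    exact ⟨0, by simp [chunk], by convert IsRep.zero w _ using 1; ext; simp [chunk]⟩
  | succ k ih =>
    obtain ⟨S', hS', hc'⟩ := Finset.exists_subset_card_eq (min_le_left S.card (n ^ (d - 1)))
    obtain ⟨t, ht, hr⟩ := exists_isRep_chunk_sub hd hao hn hc hw hg hL hg1 hv (S := S')
      (hc'.le.trans (min_le_right _ _))
    obtain ⟨t', ht', hr'⟩ := ih (S := S \ S') (by
      rw [Finset.card_sdiff_of_subset hS', hc']
      rw [add_mul, one_mul] at hS
      omega)
    have hadd : chunk g v S = chunk g v (S \ S') + chunk g v S' := by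
      ext x
      exact (Finset.sum_sdiff hS').symm
    refine ⟨t' + t, ?_, ?_⟩
    · rw [hadd, add_mul, ← ht, ← ht', ← integral_add (hint _) (hint _)]
      rfl
    · rw [add_mul, one_mul]
      convert hr'.add hr using 1
      rw [hadd]
      ext x
      simp
      ring

end

theorem exists_isRep_partition_sub {o a : Fin d} {n N : ℕ} {c : ℝ} {g : Euc d → ℝ} (hd : 2 ≤ d)
    (hao : a ≠ o) (hn : 0 < n) {w : Euc d → ℝ} (hc : LipDir o c (cell (d := d)))
    (hw : BoxFlexible o (3 * (4 * d) + 1) (1 + c) n N w)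
    (hg : ContDiff ℝ ∞ g) (hL : LipDir o 1 g) (hg1 : ∀ p, |g p| ≤ 1) (hgi : Integrable g)
    (k : ℕ) (Z : Finset (Fin d → ℤ)) (hZ : Z.card ≤ k * n ^ (d - 1)) :
    ∃ t : ℝ, ∫ x, ∑ z ∈ Z, g x * cell (x - lat 1 z)
        = t * ∫ x, chunk (fun _ => 1) 0 (slots o n) x ∧
      IsRep w ((4 * d) ^ d * (k * (2 * N))) ((fun x => ∑ z ∈ Z, g x * cell (x - lat 1 z)) -
        fun x => t * chunk (fun _ => 1) 0 (slots o n) x) := by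
  classical
  have hd0 : (0 : ℤ) < 4 * d := by omega
  have hcell := (cell_contDiff (d := d)).continuous
  have hint : ∀ w, Integrable fun x => g x * cell (x - w) := fun w =>
    hgi.mul_bdd (c := 1) (by fun_prop : Continuous _).aestronglyMeasurable
      (.of_forall fun x => by simpa using abs_cell_le_one _)
  set P : Finset (Fin d → ℤ) := Fintype.piFinset fun _ => Finset.Ico 0 (4 * d : ℤ) with hP
  set S : (Fin d → ℤ) → Finset (Fin d → ℤ) := fun r =>
    (Z.filter fun z => (fun i => z i % (4 * d : ℤ)) = r).image fun z i => z i / (4 * d : ℤ) with hS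
  have hchunk : ∀ r, chunk g (lat 1 r) (S r)
      = fun x => ∑ z ∈ Z with (fun i => z i % (4 * d : ℤ)) = r, g x * cell (x - lat 1 z) := by
    intro r
    ext x
    rw [chunk, hS, Finset.sum_image]
    · refine Finset.sum_congr rfl fun z hz => ?_
      rw [sub_sub]
      congr 3
      ext i
      have h1 := congrFun (Finset.mem_filter.1 hz).2 i
      have h2 := Int.emod_add_mul_ediv (z i) (4 * d)
      rw [h1] at h2
      have h3 : (z i : ℝ) = r i + 4 * d * (z i / (4 * d : ℤ) : ℤ) := by exact_mod_cast h2.symm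
      simp only [PiLp.add_apply, lat_apply]
      linear_combination -h3
    · intro z hz z' hz' heq
      ext i
      have h1 := congrFun (Finset.mem_filter.1 hz).2 i
      have h2 := congrFun (Finset.mem_filter.1 hz').2 i
      have h3 := congrFun heq i
      dsimp only at h1 h2 h3
      rw [← Int.emod_add_mul_ediv (z i) (4 * d), ← Int.emod_add_mul_ediv (z' i) (4 * d), h1, h2, h3]
  have hsum : ∀ x, ∑ z ∈ Z, g x * cell (x - lat 1 z) = ∑ r ∈ P, chunk g (lat 1 r) (S r) x := by
    intro x
    simp only [hchunk]
    refine (Finset.sum_fiberwise_of_maps_to (fun z _ => ?_) _).symm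
    rw [hP, Fintype.mem_piFinset]
    exact fun i => Finset.mem_Ico.2 ⟨Int.emod_nonneg _ hd0.ne', Int.emod_lt_of_pos _ hd0⟩
  have hex : ∀ r ∈ P, ∃ t : ℝ, ∫ x, chunk g (lat 1 r) (S r) x
        = t * ∫ x, chunk (fun _ => 1) 0 (slots o n) x ∧ IsRep w (k * (2 * N))
      (chunk g (lat 1 r) (S r) - fun x => t * chunk (fun _ => 1) 0 (slots o n) x) := fun r hr => by
    refine exists_isRep_chunk_sub_of_card hd hao hn hc hw hg hL hg1 hgi (fun i => ?_) k
      ((Finset.card_image_le.trans (Finset.card_filter_le _ _)).trans hZ)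
    have := Finset.mem_Ico.1 (Fintype.mem_piFinset.1 hr i)
    simp only [lat_apply, one_mul]
    exact ⟨by exact_mod_cast this.1, by exact_mod_cast this.2.le⟩
  choose! t ht hr using hex
  refine ⟨∑ r ∈ P, t r, ?_, ?_⟩
  · simp only [hsum]
    rw [integral_finsetSum _ fun r _ => ?_, Finset.sum_mul]
    · exact Finset.sum_congr rfl ht
    · rw [hchunk]
      exact integrable_finsetSum _ fun z _ => hint _
  · have h := IsRep.sum P hr
    have hPc : P.card = (4 * d) ^ d := by
      rw [hP, Fintype.card_piFinset, Finset.prod_const, Int.card_Ico, Finset.card_univ,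
        Fintype.card_fin]
      congr 1
    rw [hPc] at h
    convert h using 1
    ext x
    simp [hsum, Finset.sum_mul]

/-- The conclusion of the main theorem. -/
def Flexible (u : Euc d → ℝ) : Prop :=
  ∃ C : ℝ, 0 < C ∧ ∀ f : Euc d → ℝ, ContDiff ℝ ∞ f → HasCompactSupport f → ∫ x, f x = 0 →
    (∀ x, |f x| ≤ 1) → ∃ N : ℕ, N ≤ C * ((volume (tsupport f)).toReal + 1) ∧ IsRep u N f

theorem flexible_of_eq_coord (hd : 2 ≤ d) {o : Fin d} {u : Euc d → ℝ} {c₀ : ℝ}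
    (hu : ∀ p ∈ cube d 8, u p = p o + c₀) : Flexible u := by
  classical
  have : Nontrivial (Fin d) := Fin.nontrivial_iff_two_le.2 hd
  obtain ⟨a, hao⟩ := exists_ne o
  obtain ⟨c, hc0, hc⟩ := exists_lipDir (cell_contDiff (d := d)) cell_cubeSupp.hasCompactSupport
  set R : ℝ := 3 * (4 * d) + 1 with hR
  have hR1 : 1 ≤ R := by rw [hR]; linarith [(Nat.cast_nonneg d : (0 : ℝ) ≤ d)]
  have hR0 : 0 < R := by linarith
  obtain ⟨N, hN⟩ := exists_boxFlexible hao hR0 (1 + c)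
  set κ := (volume (Metric.ball (0 : Euc d) (1 / 2))).toReal with hκ
  have hκ0 : 0 < κ := ENNReal.toReal_pos (Metric.measure_ball_pos _ _ (by norm_num)).ne'
    measure_ball_lt_top.ne
  refine ⟨(4 * d) ^ d * ((R ^ d / κ + 1) * (2 * N)) + 1, by positivity, fun f hf hfc hfi hf1 => ?_⟩
  obtain ⟨Cf, hCf0, hCf⟩ := exists_lipDir hf hfc
  obtain ⟨ε₀, hε₀, hcard⟩ := exists_card_lattice_le (by omega) hfc.isCompact
  obtain ⟨b, hb⟩ := exists_nat_gt (max (max 1 (1 / ε₀)) Cf)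
  have hb1 : (1 : ℝ) < b := (le_max_left _ _).trans_lt ((le_max_left _ _).trans_lt hb)
  have hbε : 1 / ε₀ < b := (le_max_right _ _).trans_lt ((le_max_left _ _).trans_lt hb)
  have hbC : Cf < b := (le_max_right _ _).trans_lt hb
  have hb0 : (0 : ℝ) < b := by linarith
  set ε : ℝ := 1 / (R * b ^ (d - 1)) with hε
  have hε0 : 0 < ε := by positivity
  have hεb : ε * b ≤ 1 := by
    rw [hε, one_div_mul_eq_div, div_le_one (by positivity)]
    have h1 : (b : ℝ) ≤ b ^ (d - 1) := le_self_pow₀ hb1.le (by omega)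
    nlinarith
  have hεε : ε < ε₀ := by
    rw [div_lt_iff₀ hε₀] at hbε
    by_contra hn
    nlinarith
  have hεC : ε * Cf ≤ 1 := by nlinarith
  have hn : 0 < b ^ d := by
    have : 0 < b := by exact_mod_cast hb0
    positivity
  set M : Euc d ≃L[ℝ] Euc d := diagEquiv fun _ => Units.mk0 ε hε0.ne' with hM
  have hMs : ∀ x, M x = ε • x := fun x => by ext i; simp [hM]
  set g : Euc d → ℝ := fun x => f (ε • x) with hg
  have hgs : ContDiff ℝ ∞ g := by rw [hg]; fun_prop
  have hgc : HasCompactSupport g := by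
    have := hfc.comp_homeomorph M.toHomeomorph
    convert this using 1
    ext x
    simp [hg, ← hMs]
  have hgi : Integrable g := hgs.continuous.integrable_of_hasCompactSupport hgc
  have hgL : LipDir o 1 g := fun p s => by
    have h1 := hCf o (ε • p) (ε * s)
    simp only [hg, smul_add, smul_smul]
    refine h1.trans ?_
    rw [abs_mul, abs_of_pos hε0]
    nlinarith [abs_nonneg s]
  obtain ⟨B, hB⟩ := hgc.isCompact.isBounded.exists_norm_le
  obtain ⟨m, hm⟩ := exists_nat_ge B
  set Z : Finset (Fin d → ℤ) := (Fintype.piFinset fun _ => Finset.Icc (-(m : ℤ)) m).filter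
    fun z => ∃ x ∈ tsupport f, ‖x - lat ε z‖ ≤ d * ε with hZ
  have hcardZ := hcard ε hε0 hεε Z fun z hz => (Finset.mem_filter.1 hz).2
  have hgZ : (fun x => ∑ z ∈ Z, g x * cell (x - lat 1 z)) = g := by
    ext x
    by_cases hx : g x = 0
    · simp [hx]
    have hxm : x ∈ cube d m := fun i =>
      (abs_coord_le_norm x i).trans ((hB x (subset_tsupport g hx)).trans hm)
    rw [← Finset.mul_sum, hZ, Finset.sum_filter_of_ne, sum_cell m hxm, mul_one]
    intro z _ hz
    have h1 : ‖x - lat 1 z‖ ≤ d := not_lt.1 fun h => hz (cell_eq_zero_of_norm h)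
    refine ⟨ε • x, subset_tsupport f hx, ?_⟩
    have h2 : ε • x - lat ε z = ε • (x - lat 1 z) := by ext i; simp; ring
    rw [h2, norm_smul, Real.norm_of_nonneg hε0.le, mul_comm]
    gcongr
  set V := (volume (tsupport f)).toReal with hV
  have hV0 : 0 ≤ V := ENNReal.toReal_nonneg
  have hn0 : (0 : ℝ) < ((b ^ d : ℕ) : ℝ) ^ (d - 1) := by positivity
  have hεd : ε ^ d = 1 / (R ^ d * ((b ^ d : ℕ) : ℝ) ^ (d - 1)) := by
    rw [hε, div_pow, one_pow, mul_pow]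
    push_cast
    rw [pow_right_comm (b : ℝ) d (d - 1)]
  set k := ⌈(Z.card : ℝ) / ((b ^ d : ℕ) : ℝ) ^ (d - 1)⌉₊ with hk
  have hk1 : (Z.card : ℝ) / ((b ^ d : ℕ) : ℝ) ^ (d - 1) ≤ R ^ d / κ * (V + 1) := by
    rw [hεd] at hcardZ
    rw [div_mul_eq_mul_div, le_div_iff₀ hκ0]
    have : 0 < R ^ d := by positivity
    calc (Z.card : ℝ) / ((b ^ d : ℕ) : ℝ) ^ (d - 1) * κ
        = R ^ d * (Z.card * (1 / (R ^ d * ((b ^ d : ℕ) : ℝ) ^ (d - 1))) * κ) := by field_simp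
      _ ≤ R ^ d * (V + 1) := by gcongr
  have hk2 : (k : ℝ) ≤ (R ^ d / κ + 1) * (V + 1) := by
    have := (Nat.ceil_lt_add_one (by positivity :
      0 ≤ (Z.card : ℝ) / ((b ^ d : ℕ) : ℝ) ^ (d - 1))).le
    linarith
  have hZk : Z.card ≤ k * (b ^ d) ^ (d - 1) := by
    have := Nat.le_ceil ((Z.card : ℝ) / ((b ^ d : ℕ) : ℝ) ^ (d - 1))
    rw [div_le_iff₀ hn0, ← hk] at this
    exact_mod_cast this
  obtain ⟨t, ht, hr⟩ := exists_isRep_partition_sub hd hao hn (hc o)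
    (hN u c₀ hu b (by exact_mod_cast hb0)) hgs hgL (fun p => hf1 _) hgi k Z hZk
  rw [hgZ] at ht hr
  have ht0 : t = 0 := by
    rw [Measure.integral_comp_smul, hfi, smul_zero, integral_chunk_one, card_slots] at ht
    have := integral_cell_pos (d := d)
    have h2 : (0 : ℝ) < ((b ^ d : ℕ) : ℝ) ^ (d - 1) * ∫ p : Euc d, cell p := by positivity
    push_cast at ht h2
    exact (mul_eq_zero.1 ht.symm).resolve_right h2.ne'
  refine ⟨(4 * d) ^ d * (k * (2 * N)), ?_, ?_⟩
  · push_cast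
    calc (4 * (d : ℝ)) ^ d * (k * (2 * N))
        ≤ (4 * (d : ℝ)) ^ d * ((R ^ d / κ + 1) * (V + 1) * (2 * N)) := by gcongr
      _ ≤ _ := by nlinarith
  · have h1 := IsRep.of_comp_linear (u := u) (h := g) M (by
      simp only [hMs]
      convert hr using 1
      ext x
      simp [ht0])
    convert h1 using 1
    ext x
    simp only [hg, ← hMs, M.apply_symm_apply]

/-! ### Straightening a function near a noncritical point -/

namespace Flexible

variable {u : Euc d → ℝ}

theorem of_comp {Ψ : Euc d → Euc d} (hΨ : IsCompSuppVolDiffeo d Ψ)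
    (h : Flexible fun x => u (Ψ x)) : Flexible u := by
  obtain ⟨C, hC, H⟩ := h
  refine ⟨C, hC, fun f h1 h2 h3 h4 => ?_⟩
  obtain ⟨N, hN, hr⟩ := H f h1 h2 h3 h4
  exact ⟨N, hN, hr.of_comp hΨ⟩

theorem of_sub_const (c : ℝ) (h : Flexible fun x => u x - c) : Flexible u := by
  obtain ⟨C, hC, H⟩ := h
  refine ⟨C, hC, fun f h1 h2 h3 h4 => ?_⟩
  obtain ⟨N, hN, Φ, Φ', hΦ, hΦ', hf⟩ := H f h1 h2 h3 h4
  exact ⟨N, hN, Φ, Φ', hΦ, hΦ', by simpa using hf⟩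

theorem of_comp_linear (M : Euc d ≃L[ℝ] Euc d) (h : Flexible fun x => u (M x)) : Flexible u := by
  obtain ⟨C, hC, H⟩ := h
  obtain ⟨e, he, hint, hvol⟩ := exists_integral_comp_linear M
  refine ⟨C * (e + 1), by positivity, fun f h1 h2 h3 h4 => ?_⟩
  obtain ⟨N, hN, hr⟩ := H (fun x => f (M x)) (h1.comp M.contDiff)
    (h2.comp_homeomorph M.toHomeomorph) (by rw [hint, h3, mul_zero]) fun x => h4 (M x)
  refine ⟨N, hN.trans ?_, by simpa using hr.of_comp_linear M⟩
  have h5 : tsupport (fun x => f (M x)) = M ⁻¹' tsupport f :=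
    tsupport_comp_eq_preimage f M.toHomeomorph
  rw [h5, hvol, mul_assoc]
  have h6 : 0 ≤ (volume (tsupport f)).toReal := ENNReal.toReal_nonneg
  gcongr
  nlinarith

theorem of_comp_add_right (c : Euc d) (h : Flexible fun x => u (x + c)) : Flexible u := by
  obtain ⟨C, hC, H⟩ := h
  refine ⟨C, hC, fun f h1 h2 h3 h4 => ?_⟩
  obtain ⟨N, hN, Φ, Φ', hΦ, hΦ', hf⟩ := H (fun x => f (x + c)) (by fun_prop)
    (h2.comp_homeomorph (Homeomorph.addRight c)) (by rw [integral_add_right_eq_self f c, h3])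
    fun x => h4 (x + c)
  have h5 : tsupport (fun x => f (x + c)) = (fun x => x + c) ⁻¹' tsupport f :=
    tsupport_comp_eq_preimage f (Homeomorph.addRight c)
  rw [h5, measure_preimage_add_right] at hN
  refine ⟨N, hN, fun i x => Φ i (x - c) + c, fun i x => Φ' i (x - c) + c,
    fun i => (hΦ i).conj_translate c, fun i => (hΦ' i).conj_translate c, ?_⟩
  ext x
  simpa using congrFun hf (x - c)

theorem of_const_mul {s : ℝ} (hs : s ≠ 0) (h : Flexible fun x => s * u x) : Flexible u := by
  obtain ⟨C, hC, H⟩ := h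
  obtain ⟨L, hL⟩ := exists_nat_gt |s|
  have hL0 : (0 : ℝ) < L := (abs_nonneg s).trans_lt hL
  refine ⟨L * C, by positivity, fun f h1 h2 h3 h4 => ?_⟩
  obtain ⟨N, hN, Φ, Φ', hΦ, hΦ', hf⟩ := H (fun x => s / L * f x) (by fun_prop) h2.mul_left
    (by rw [integral_const_mul, h3, mul_zero]) fun x => by
      rw [abs_mul, abs_div, Nat.abs_cast]
      exact mul_le_one₀ ((div_le_one hL0).2 hL.le) (abs_nonneg _) (h4 x)
  have hr : IsRep u N fun x => (L : ℝ)⁻¹ * f x := by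
    refine ⟨Φ, Φ', hΦ, hΦ', ?_⟩
    ext x
    have h5 := congrFun hf x
    simp only [← mul_sub, ← Finset.mul_sum] at h5
    refine mul_left_cancel₀ hs ?_
    rw [← h5]
    ring
  refine ⟨L * N, ?_, ?_⟩
  · push_cast
    rw [mul_assoc]
    gcongr
    refine hN.trans ?_
    gcongr
    · exact h2.isCompact.measure_lt_top.ne
    · exact tsupport_mul_subset_right
  · have := IsRep.sum (Finset.range L) (F := fun _ x => (L : ℝ)⁻¹ * f x) fun _ _ => hr
    rw [Finset.card_range] at this
    convert this using 1
    ext x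
    simp [hL0.ne']

end Flexible

/-- A small compactly supported perturbation of a coordinate is realized, near the origin, as a
component of a volume-preserving diffeomorphism. -/
theorem exists_diffeo_coord_eq {o j : Fin d} (hj : j ≠ o) {f : Euc d → ℝ} (hf : ContDiff ℝ ∞ f)
    (hS : CubeSupp 2 f) (hL : LipDir o (1 / 20) f) :
    ∃ Φ, IsCompSuppVolDiffeo d Φ ∧ ∀ p : Euc d, |p j| ≤ 2 → Φ p o = p o + f p := by
  obtain ⟨k, hk, hfk⟩ := hL.exists_invPair (by norm_num) hf
  have hkL := hfk.lipDir hL (by norm_num)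
  have hkS := hfk.cubeSupp hS
  obtain ⟨g, hg, hkg⟩ := exists_compensator_inverse hk hkS zero_le_two hj hkL (by norm_num)
  obtain ⟨Φ, hΦ, hΦo, -⟩ := exists_diffeo_compensated hk hkS zero_le_two hj hkL (by norm_num) hf
    hfk.symm hg hkg
  refine ⟨Φ, hΦ, fun p hp => ?_⟩
  rw [hΦo, hkg.eq_zero (compensator_eq_zero fun hn => ?_), add_zero]
  linarith [le_abs_self (p j), hn.1]

/-- Rescaling a function which vanishes to first order at the origin makes it small. -/
theorem exists_rescale_lipDir {o : Fin d} {h : Euc d → ℝ} (hh : ContDiff ℝ ∞ h) (h0 : h 0 = 0)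
    (hd0 : fderiv ℝ h 0 = 0) : ∃ ε : ℝ, 0 < ε ∧ ∃ f : Euc d → ℝ, ContDiff ℝ ∞ f ∧ CubeSupp 2 f ∧
      LipDir o (1 / 20) f ∧ ∀ p ∈ Metric.ball (0 : Euc d) 1, f p = ε⁻¹ * h (ε • p) := by
  let χ : ContDiffBump (0 : Euc d) := ⟨1, 2, one_pos, one_lt_two⟩
  have hχ : ContDiff ℝ ∞ χ := χ.contDiff
  obtain ⟨C, hC, hχL⟩ := exists_lipDir hχ χ.hasCompactSupport
  have hhd : Differentiable ℝ h := hh.differentiable (by simp)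
  set τ : ℝ := (20 * (2 * C + 1))⁻¹ with hτ
  have hτ0 : 0 < τ := by positivity
  have hnhds : ∀ᶠ y in 𝓝 (0 : Euc d), ‖fderiv ℝ h y‖ < τ := by
    have : Tendsto (fun y => ‖fderiv ℝ h y‖) (𝓝 0) (𝓝 0) := by
      simpa [hd0] using (hh.continuous_fderiv (by simp)).norm.tendsto 0
    exact this.eventually_lt_const hτ0
  obtain ⟨δ, hδ, hball⟩ := Metric.eventually_nhds_iff_ball.1 hnhds
  have hle : ∀ y ∈ Metric.ball (0 : Euc d) δ, |h y| ≤ τ * ‖y‖ := fun y hy => by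
    simpa [h0] using (convex_ball (0 : Euc d) δ).norm_image_sub_le_of_norm_fderiv_le
      (fun x _ => hhd x) (fun x hx => (hball x hx).le) (Metric.mem_ball_self hδ) hy
  set ε := δ / 4 with hε
  have hε0 : 0 < ε := by positivity
  have hf : ContDiff ℝ ∞ fun p => χ p * (ε⁻¹ * h (ε • p)) := by fun_prop
  refine ⟨ε, hε0, _, hf, fun p i hp => ?_, ?_, fun p hp => ?_⟩
  · have : χ p = 0 := χ.zero_of_le_dist (by
      simpa using hp.le.trans (abs_coord_le_norm p i))
    simp [this]
  · refine LipDir.of_fderiv (hf.differentiable (by simp)) fun p => ?_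
    have hder : HasFDerivAt (fun p => ε⁻¹ * h (ε • p)) (fderiv ℝ h (ε • p)) p := by
      have h1 := ((hhd (ε • p)).hasFDerivAt.comp p
        ((hasFDerivAt_id p).const_smul ε)).const_mul ε⁻¹
      refine h1.congr_fderiv ?_
      ext v
      simp [hε0.ne']
    have hmul : HasFDerivAt (fun p => χ p * (ε⁻¹ * h (ε • p))) _ p :=
      (hχ.differentiable (by simp) p).hasFDerivAt.mul hder
    rw [hmul.fderiv]
    by_cases hp : p ∈ Metric.closedBall (0 : Euc d) 2
    · have hp2 : ‖p‖ ≤ 2 := by simpa using hp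
      have hmem : ε • p ∈ Metric.ball (0 : Euc d) δ := by
        rw [mem_ball_zero_iff, norm_smul, Real.norm_of_nonneg hε0.le]
        nlinarith
      have h1 : |ε⁻¹ * h (ε • p)| ≤ τ * 2 := by
        have := hle _ hmem
        rw [norm_smul, Real.norm_of_nonneg hε0.le] at this
        rw [abs_mul, abs_inv, abs_of_pos hε0, inv_mul_le_iff₀ hε0]
        nlinarith [mul_pos hε0 hτ0]
      have h2 : |fderiv ℝ h (ε • p) (eb o)| ≤ τ := by
        have := (fderiv ℝ h (ε • p)).le_opNorm (eb o)
        rw [norm_eb, mul_one] at this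
        exact this.trans (hball _ hmem).le
      have h3 := (hχL o).abs_fderiv_le (hχ.differentiable (by simp)) p
      have h4 : |χ p| ≤ 1 := abs_le.2 ⟨by linarith [χ.nonneg (x := p)], χ.le_one⟩
      have h5 : 1 / 20 = 1 * τ + τ * 2 * C := by rw [hτ]; field_simp; ring
      simp only [add_apply, smul_apply, smul_eq_mul]
      refine (abs_add_le _ _).trans ?_
      rw [h5, abs_mul, abs_mul]
      gcongr
    · have h1 : χ p = 0 := χ.zero_of_le_dist (by simpa using (not_le.1 (by simpa using hp)).le)
      have h2 : fderiv ℝ χ p = 0 :=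
        (IsLocalMin.fderiv_eq_zero (Eventually.of_forall fun y => h1.trans_le χ.nonneg))
      simp [h1, h2]
  · have : χ p = 1 := χ.one_of_mem_closedBall (Metric.ball_subset_closedBall hp)
    simp [this]

theorem Flexible.of_comp_smul {u : Euc d → ℝ} {s : ℝ} (hs : s ≠ 0)
    (h : Flexible fun x => u (s • x)) : Flexible u :=
  of_comp_linear (ContinuousLinearEquiv.smulLeft (Units.mk0 s hs)) h

theorem flexible_of_fderiv_zero_eq (hd : 2 ≤ d) {o : Fin d} {v : Euc d → ℝ} (hv : ContDiff ℝ ∞ v)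
    (h0 : v 0 = 0) (hd0 : ∀ x, fderiv ℝ v 0 x = x o) : Flexible v := by
  have : Nontrivial (Fin d) := Fin.nontrivial_iff_two_le.2 hd
  obtain ⟨j, hj⟩ := exists_ne o
  have hfd : fderiv ℝ (fun x => v x - x o) 0 = 0 := by
    have h1 : HasFDerivAt (fun x : Euc d => x o) (EuclideanSpace.proj o : Euc d →L[ℝ] ℝ) 0 :=
      (EuclideanSpace.proj o : Euc d →L[ℝ] ℝ).hasFDerivAt
    have h2 : HasFDerivAt (fun x => v x - x o) _ 0 :=
      (hv.differentiable (by simp) 0).hasFDerivAt.sub h1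
    rw [h2.fderiv]
    ext x
    simp [hd0]
  obtain ⟨ε, hε, f, hf, hS, hL, hfe⟩ := exists_rescale_lipDir (o := o)
    (h := fun x => v x - x o) (by fun_prop) (by simp [h0]) hfd
  obtain ⟨Φ, hΦ, hΦo⟩ := exists_diffeo_coord_eq hj hf hS hL
  obtain ⟨Ψ, hΨ, hl, hr⟩ := hΦ.exists_inverse
  have hvΦ : ∀ p ∈ Metric.ball (0 : Euc d) 1, ε⁻¹ * v (ε • p) = Φ p o := fun p hp => by
    rw [hΦo, hfe p hp]
    · simp only [PiLp.smul_apply, smul_eq_mul]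
      field_simp
      ring
    · have := abs_coord_le_norm p j
      rw [mem_ball_zero_iff] at hp
      linarith
  have hnhds : ∀ᶠ q in 𝓝 (Φ 0), Ψ q ∈ Metric.ball (0 : Euc d) 1 := by
    refine hΨ.1.continuous.continuousAt.eventually_mem ?_
    rw [hl]
    exact Metric.ball_mem_nhds _ one_pos
  obtain ⟨δ, hδ, hball⟩ := Metric.eventually_nhds_iff_ball.1 hnhds
  set s := δ / (d * 8 + 1) with hs
  have hs0 : 0 < s := by positivity
  refine Flexible.of_comp_smul hε.ne' (Flexible.of_const_mul (inv_ne_zero hε.ne')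
    (Flexible.of_comp hΨ (Flexible.of_comp_add_right (Φ 0) (Flexible.of_comp_smul hs0.ne'
    (Flexible.of_const_mul (inv_ne_zero hs0.ne')
    (flexible_of_eq_coord hd (o := o) (c₀ := s⁻¹ * Φ 0 o) fun p hp => ?_))))))
  have hmem : s • p + Φ 0 ∈ Metric.ball (Φ 0) δ := by
    rw [mem_ball_iff_norm, add_sub_cancel_right, norm_smul, Real.norm_of_nonneg hs0.le]
    have h1 := norm_le_of_mem_cube hp
    calc s * ‖p‖ ≤ s * (d * 8) := by gcongr
      _ < s * (d * 8 + 1) := by gcongr; linarith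
      _ = δ := by rw [hs]; field_simp
  simp only
  rw [hvΦ _ (hball _ hmem), hr]
  simp only [PiLp.add_apply, PiLp.smul_apply, smul_eq_mul]
  field_simp

theorem flexible_of_not_const (hd : 2 ≤ d) {u : Euc d → ℝ} (hu : ContDiff ℝ ∞ u)
    (hne : ∃ x y, u x ≠ u y) : Flexible u := by
  have hdu : Differentiable ℝ u := hu.differentiable (by simp)
  obtain ⟨x, y, hxy⟩ := hne
  obtain ⟨p, hp⟩ : ∃ p, fderiv ℝ u p ≠ 0 := by
    by_contra! hn
    exact hxy (is_const_of_fderiv_eq_zero hdu hn x y)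
  set ℓ := fderiv ℝ u p with hℓ
  obtain ⟨o, ho⟩ : ∃ o, ℓ (eb o) ≠ 0 := by
    by_contra! hn
    refine hp (ContinuousLinearMap.coe_injective
      ((EuclideanSpace.basisFun (Fin d) ℝ).toBasis.ext fun i => ?_))
    simpa [eb] using hn i
  let π : Euc d →L[ℝ] ℝ := EuclideanSpace.proj o
  let T : Euc d →L[ℝ] Euc d := .id ℝ _ + ((ℓ (eb o))⁻¹ • (π - ℓ)).smulRight (eb o)
  let T' : Euc d →L[ℝ] Euc d := .id ℝ _ + (ℓ - π).smulRight (eb o)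
  have hT : ∀ x, T x = x + ((ℓ (eb o))⁻¹ * (x o - ℓ x)) • eb o := fun x => by simp [T, π]
  have hT' : ∀ x, T' x = x + (ℓ x - x o) • eb o := fun x => by simp [T', π]
  have hℓT : ∀ x, ℓ (T x) = x o := fun x => by
    rw [hT, map_add, map_smul, smul_eq_mul]
    field_simp
    ring
  let M : Euc d ≃L[ℝ] Euc d := .equivOfInverse T T'
    (fun x => by
      rw [hT', hℓT, hT, add_assoc, ← add_smul]
      simp)
    (fun x => by
      rw [hT, hT', map_add, map_smul, add_assoc, ← add_smul]
      simp only [PiLp.add_apply, PiLp.smul_apply, eb_apply, smul_eq_mul, if_true]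
      convert add_zero x
      convert zero_smul ℝ (eb o)
      field_simp
      ring)
  have hM : ∀ x, ℓ (M x) = x o := hℓT
  refine Flexible.of_comp_add_right p (Flexible.of_comp_linear M (Flexible.of_sub_const (u p)
    (flexible_of_fderiv_zero_eq hd (o := o) (by fun_prop) (by simp) fun x => ?_)))
  have h1 : HasFDerivAt u ℓ (M 0 + p) := by simpa using (hdu p).hasFDerivAt
  have h2 : HasFDerivAt (fun x => u (M x + p) - u p) _ 0 :=
    (h1.comp (0 : Euc d) ((M : Euc d →L[ℝ] Euc d).hasFDerivAt.add_const p)).sub_const (u p)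
  rw [h2.fderiv]
  exact hM x

/-- **Theorem 1 for `(ℝ^{2n}, ω_std)`.** For a smooth non-constant `u`, there is
`c = c(u) > 0` such that every smooth compactly supported zero-mean `f` with
`‖f‖_∞ ≤ 1` can be written as `∑_{i=1}^N (u ∘ Φ_{i,+} − u ∘ Φ_{i,-})` with
`N ≤ c · (vol(supp f) + 1)` and the `Φ_{i,±}` compactly supported
volume-preserving diffeomorphisms. -/
theorem flexibility_of_adjoint_action (n : ℕ) (hn : 1 ≤ n)
    (u : EuclideanSpace ℝ (Fin (2 * n)) → ℝ)
    (hu_smooth : ContDiff ℝ (⊤ : ℕ∞) u)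
    (hu_nonconst : ∃ x y, u x ≠ u y) :
    ∃ c : ℝ, 0 < c ∧
      ∀ f : EuclideanSpace ℝ (Fin (2 * n)) → ℝ,
        ContDiff ℝ (⊤ : ℕ∞) f → HasCompactSupport f → (∫ x, f x) = 0 →
        (⨆ x, |f x|) ≤ 1 →
        ∃ N : ℕ, (N : ℝ) ≤ c * ((volume (tsupport f)).toReal + 1) ∧
          ∃ Φp Φm : Fin N → (EuclideanSpace ℝ (Fin (2 * n)) → EuclideanSpace ℝ (Fin (2 * n))),
            (∀ i, IsCompSuppVolDiffeo (2 * n) (Φp i)) ∧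
            (∀ i, IsCompSuppVolDiffeo (2 * n) (Φm i)) ∧
            f = fun x => ∑ i, (u (Φp i x) - u (Φm i x)) := by
  obtain ⟨C, hC, H⟩ := flexible_of_not_const (by omega) hu_smooth hu_nonconst
  refine ⟨C, hC, fun f hf hfc hfi hf1 => H f hf hfc hfi fun x => (le_ciSup ?_ x).trans hf1⟩
  exact hf.continuous.abs.bddAbove_range_of_hasCompactSupport (hfc.comp_left abs_zero)
end
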